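/- Under Assumption C, the Hausdorff dimension of the attractor and of the self-affine measure satisfy dim_H(Λ) = dim_H(ν) = min{ log N/(−log b), 1 + log(Nb)/(−log c) }. -/

import Mathlib

open MeasureTheory Filter Set Topology
open scoped ENNReal

noncomputable section

/-- One triangular affine map `S_i(x,y) = (c x + u_i, d_i x + b y + v_i)`. -/
def Smap {N : ℕ} (c b : ℝ) (u v d : Fin N → ℝ) (i : Fin N) (p : ℝ × ℝ) : ℝ × ℝ :=
  (c * p.1 + u i, d i * p.1 + b * p.2 + v i)

/-- Composition along a finite word: `Sword [i₁,…,iₙ] = S_{i₁} ∘ ⋯ ∘ S_{iₙ}`. -/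
def Sword {N : ℕ} (c b : ℝ) (u v d : Fin N → ℝ) : List (Fin N) → (ℝ × ℝ) → ℝ × ℝ
  | [] => id
  | i :: w => Smap c b u v d i ∘ Sword c b u v d w

/-- The closed unit square `[0,1]²`. -/
def unitSq : Set (ℝ × ℝ) := Set.Icc 0 1 ×ˢ Set.Icc 0 1

/-- The length-`n` prefix of an infinite word, as a list. -/
def prefixWord {N : ℕ} (i : ℕ → Fin N) (n : ℕ) : List (Fin N) :=
  List.ofFn (fun k : Fin n => i k)

/-- The transversality condition: there is `c₃ > 0` such that for every `n` and all
`𝐢, 𝐣` with different first symbols, the projection to the `x`-axis of the intersection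
of the two level-`n` cylinder parallelograms has diameter `< c₃ bⁿ`. -/
def Transversality (N : ℕ) (c b : ℝ) (u v d : Fin N → ℝ) : Prop :=
  ∃ c₃ > (0 : ℝ), ∀ (n : ℕ) (i j : ℕ → Fin N), i 0 ≠ j 0 →
    Metric.diam (Prod.fst '' (Sword c b u v d (prefixWord i n) '' unitSq ∩
      Sword c b u v d (prefixWord j n) '' unitSq)) < c₃ * b ^ n

/-- `μ` is the uniform Bernoulli measure `(1/N,…,1/N)^ℕ` on the symbolic space. -/
def IsUniformBernoulli (N : ℕ) (μ : Measure (ℕ → Fin N)) : Prop :=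
  IsProbabilityMeasure μ ∧ ∀ (n : ℕ) (w : Fin n → Fin N),
    μ {x | ∀ k : Fin n, x (k : ℕ) = w k} = (1 / (N : ℝ≥0∞)) ^ n

/-- `m` is absolutely continuous w.r.t. Lebesgue measure with an `L^q` density. -/
def HasLqDensity (m : Measure ℝ) (q : ℝ) : Prop :=
  ∃ φ : ℝ → ℝ≥0∞, m = MeasureTheory.volume.withDensity φ ∧ (∫⁻ t, φ t ^ q) < ⊤

/-- The Hausdorff dimension of a measure: the infimum of Hausdorff dimensions
of sets of full measure. -/
def measureDimH {X : Type*} [EMetricSpace X] [MeasurableSpace X] (m : Measure X) : ℝ≥0∞ :=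
  ⨅ (A : Set X) (_ : m Aᶜ = 0), dimH A

/-- Composition of the affine maps `x ↦ λᵢ x + tᵢ` along a finite word. -/
def psiWord {N : ℕ} (lam t : Fin N → ℝ) : List (Fin N) → ℝ → ℝ
  | [] => id
  | i :: w => fun x => lam i * psiWord lam t w x + t i

/-- Hochman's exponential separation condition for the self-similar IFS `{x ↦ λᵢ x + tᵢ}`:
there are `ε > 0` and `n_k ↑ ∞` such that any two distinct words of length `n_k` whose
compositions have equal derivative have translation parts at distance `> ε^{n_k}`. -/
def HochmanESC (N : ℕ) (lam t : Fin N → ℝ) : Prop :=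
  ∃ ε > (0 : ℝ), ∃ nk : ℕ → ℕ, StrictMono nk ∧
    ∀ k, ∀ w1 w2 : Fin (nk k) → Fin N, w1 ≠ w2 →
      (∏ m, lam (w1 m)) = (∏ m, lam (w2 m)) →
        ε ^ (nk k) < |psiWord lam t (List.ofFn w1) 0 - psiWord lam t (List.ofFn w2) 0|

section
open MeasureTheory Filter Set Topology
open scoped ENNReal
noncomputable section

/-! ### Scalar inequalities -/

def psiE (p q : ℝ) : ℝ := Real.negMulLog p + Real.negMulLog q - Real.negMulLog (p + q)

def jsE (p q : ℝ) : ℝ :=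
  Real.negMulLog ((p + q) / 2) - (Real.negMulLog p + Real.negMulLog q) / 2

theorem negMulLog_mul_pos {l x : ℝ} : Real.negMulLog (l * x) =
    l * Real.negMulLog x + x * Real.negMulLog l := by
  rw [Real.negMulLog_mul]; ring

/-- Gibbs: `-p log p ≤ -p log a + a - p`. -/
theorem negMulLog_le_gibbs {p a : ℝ} (hp : 0 ≤ p) (ha : 0 < a) :
    Real.negMulLog p ≤ -(p * Real.log a) + a - p := by
  rcases hp.eq_or_lt with rfl | hp
  · simp; exact ha.le
  · have h := Real.log_le_sub_one_of_pos (x := a / p) (by positivity)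
    rw [Real.log_div ha.ne' hp.ne'] at h
    have h2 : p * (Real.log a - Real.log p) ≤ p * (a / p - 1) :=
      mul_le_mul_of_nonneg_left h hp.le
    have h3 : p * (a / p - 1) = a - p := by field_simp
    rw [h3] at h2
    simp only [Real.negMulLog]
    nlinarith

theorem psiE_le {p q P Q : ℝ} (hp : 0 ≤ p) (hq : 0 ≤ q) (hP : 0 < P) (hQ : 0 < Q) :
    psiE p q ≤ -(p * Real.log (P / (P + Q))) - q * Real.log (Q / (P + Q)) := by
  have hPQ : 0 < P + Q := by positivity
  rcases (add_nonneg hp hq).eq_or_lt with h | h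
  · have hp0 : p = 0 := by linarith
    have hq0 : q = 0 := by linarith
    subst hp0; subst hq0; simp [psiE]
  · have h1 := negMulLog_le_gibbs (a := (p + q) * (P / (P + Q))) hp (by positivity)
    have h2 := negMulLog_le_gibbs (a := (p + q) * (Q / (P + Q))) hq (by positivity)
    rw [Real.log_mul h.ne' (by positivity)] at h1 h2
    have h3 : (p + q) * (P / (P + Q)) + (p + q) * (Q / (P + Q)) = p + q := by field_simp
    have h4 : Real.negMulLog (p + q) = -((p + q) * Real.log (p + q)) := by
      simp only [Real.negMulLog]; ring
    unfold psiE
    rw [h4]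
    nlinarith

theorem psiE_eq {P Q : ℝ} (hP : 0 < P) (hQ : 0 < Q) :
    psiE P Q = -(P * Real.log (P / (P + Q))) - Q * Real.log (Q / (P + Q)) := by
  have hPQ : 0 < P + Q := by positivity
  rw [Real.log_div hP.ne' hPQ.ne', Real.log_div hQ.ne' hPQ.ne']
  simp only [psiE, Real.negMulLog]; ring

theorem psiE_zero_left (q : ℝ) : psiE 0 q = 0 := by simp [psiE]
theorem psiE_zero_right (q : ℝ) : psiE q 0 = 0 := by simp [psiE]

theorem psiE_nonneg {p q : ℝ} (hp : 0 ≤ p) (hq : 0 ≤ q) : 0 ≤ psiE p q := by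
  rcases hp.eq_or_lt with rfl | hp
  · rw [psiE_zero_left]
  rcases hq.eq_or_lt with rfl | hq
  · rw [psiE_zero_right]
  rw [psiE_eq hp hq]
  have h1 : Real.log (p / (p + q)) ≤ 0 :=
    Real.log_nonpos (by positivity) (by rw [div_le_one (by positivity)]; linarith)
  have h2 : Real.log (q / (p + q)) ≤ 0 :=
    Real.log_nonpos (by positivity) (by rw [div_le_one (by positivity)]; linarith)
  nlinarith

theorem psiE_superadd {ι : Type*} (s : Finset ι) (l p q : ι → ℝ) (hl : ∀ i ∈ s, 0 ≤ l i)
    (hp : ∀ i ∈ s, 0 ≤ p i) (hq : ∀ i ∈ s, 0 ≤ q i) :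
    ∑ i ∈ s, l i * psiE (p i) (q i) ≤ psiE (∑ i ∈ s, l i * p i) (∑ i ∈ s, l i * q i) := by
  set P := ∑ i ∈ s, l i * p i with hP
  set Q := ∑ i ∈ s, l i * q i with hQ
  have hP0 : 0 ≤ P := Finset.sum_nonneg fun i hi => mul_nonneg (hl i hi) (hp i hi)
  have hQ0 : 0 ≤ Q := Finset.sum_nonneg fun i hi => mul_nonneg (hl i hi) (hq i hi)
  rcases hP0.eq_or_lt with h | h
  · have h0 := (Finset.sum_eq_zero_iff_of_nonneg
      (fun i hi => mul_nonneg (hl i hi) (hp i hi))).1 (hP.symm.trans h.symm)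
    rw [← h, psiE_zero_left]
    apply le_of_eq
    apply Finset.sum_eq_zero
    intro i hi
    rcases mul_eq_zero.1 (h0 i hi) with h1 | h1
    · rw [h1, zero_mul]
    · rw [h1, psiE_zero_left, mul_zero]
  rcases hQ0.eq_or_lt with h' | h'
  · have h0 := (Finset.sum_eq_zero_iff_of_nonneg
      (fun i hi => mul_nonneg (hl i hi) (hq i hi))).1 (hQ.symm.trans h'.symm)
    rw [← h', psiE_zero_right]
    apply le_of_eq
    apply Finset.sum_eq_zero
    intro i hi
    rcases mul_eq_zero.1 (h0 i hi) with h1 | h1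
    · rw [h1, zero_mul]
    · rw [h1, psiE_zero_right, mul_zero]
  rw [psiE_eq h h']
  calc ∑ i ∈ s, l i * psiE (p i) (q i)
      ≤ ∑ i ∈ s, l i * (-(p i * Real.log (P / (P + Q))) - q i * Real.log (Q / (P + Q))) :=
        Finset.sum_le_sum fun i hi =>
          mul_le_mul_of_nonneg_left (psiE_le (hp i hi) (hq i hi) h h') (hl i hi)
    _ = -(P * Real.log (P / (P + Q))) - Q * Real.log (Q / (P + Q)) := by
        rw [hP, hQ, ← neg_mul, Finset.sum_mul, ← Finset.sum_neg_distrib, Finset.sum_mul,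
          ← Finset.sum_sub_distrib]
        apply Finset.sum_congr rfl
        intro i _; ring

theorem two_jsE (p q : ℝ) : 2 * jsE p q = (p + q) * Real.log 2 - psiE p q := by
  have h : Real.negMulLog ((p + q) / 2) = (Real.negMulLog (p + q) + (p + q) * Real.log 2) / 2 := by
    rw [div_eq_mul_inv, Real.negMulLog_mul]
    simp [Real.negMulLog]; ring
  unfold jsE psiE; rw [h]; ring

theorem psiE_le_log_two {p q : ℝ} (hp : 0 ≤ p) (hq : 0 ≤ q) : psiE p q ≤ (p + q) * Real.log 2 := by
  have h := psiE_le hp hq (P := 1) (Q := 1) one_pos one_pos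
  have h2 : Real.log ((1 : ℝ) / (1 + 1)) = - Real.log 2 := by
    rw [← Real.log_inv]; norm_num
  rw [h2] at h; linarith

theorem jsE_nonneg {p q : ℝ} (hp : 0 ≤ p) (hq : 0 ≤ q) : 0 ≤ jsE p q := by
  have := two_jsE p q; have := psiE_le_log_two hp hq; linarith

theorem jsE_comm (p q : ℝ) : jsE p q = jsE q p := by
  unfold jsE; rw [add_comm p q, add_comm (Real.negMulLog p)]

theorem jsE_le {p q : ℝ} (hp : 0 ≤ p) (hq : 0 ≤ q) : jsE p q ≤ Real.log 2 / 2 * |p - q| := by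
  wlog h : q ≤ p generalizing p q
  · rw [jsE_comm, abs_sub_comm]; exact this hq hp (by linarith)
  rw [abs_of_nonneg (by linarith)]
  -- psi superadditive: (p,q) = (q,q) + (p-q,0)
  have h1 := psiE_superadd (Finset.univ : Finset (Fin 2)) (fun _ => 1) ![q, p - q] ![q, 0]
    (by intros; norm_num) (by intro i _; fin_cases i <;> simp [hq, h])
    (by intro i _; fin_cases i <;> simp [hq])
  simp [Fin.sum_univ_two, psiE_zero_right] at h1
  have h2 := two_jsE p q
  have h3 := two_jsE q q
  have h4 : jsE q q = 0 := by unfold jsE; ring_nf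
  rw [h4] at h3
  linarith

theorem mul_log_ge {t : ℝ} (ht : 0 ≤ t) (ht2 : t ≤ 2) :
    (t - 1) + (t - 1) ^ 2 / 6 ≤ -Real.negMulLog t := by
  rcases ht.eq_or_lt with rfl | ht
  · simp; norm_num
  set s := Real.sqrt t with hs
  have hs0 : 0 < s := Real.sqrt_pos.2 ht
  have hss : s * s = t := Real.mul_self_sqrt ht.le
  have h1 := Real.log_le_sub_one_of_pos (x := s⁻¹) (by positivity)
  rw [Real.log_inv] at h1
  have hlog : Real.log t = 2 * Real.log s := by rw [← hss, Real.log_mul hs0.ne' hs0.ne']; ring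
  have h2 : Real.log t ≥ 2 * (1 - s⁻¹) := by rw [hlog]; linarith
  have h3 : t * Real.log t ≥ t * (2 * (1 - s⁻¹)) := mul_le_mul_of_nonneg_left h2 ht.le
  have h4 : t * (2 * (1 - s⁻¹)) = 2 * t - 2 * s := by
    rw [← hss]; field_simp
  have hs2 : s ≤ 1.4143 := by
    by_contra hc; push Not at hc; nlinarith
  have h5 : (t - 1) ^ 2 = (s - 1) ^ 2 * (s + 1) ^ 2 := by rw [← hss]; ring
  have h6 : (s + 1) ^ 2 ≤ 6 := by nlinarith
  have h7 : (s - 1) ^ 2 * (s + 1) ^ 2 ≤ (s - 1) ^ 2 * 6 :=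
    mul_le_mul_of_nonneg_left h6 (sq_nonneg _)
  simp only [Real.negMulLog]
  nlinarith

theorem jsE_ge {p q : ℝ} (hp : 0 ≤ p) (hq : 0 ≤ q) : (p - q) ^ 2 ≤ 12 * (p + q) * jsE p q := by
  rcases (add_nonneg hp hq).eq_or_lt with h | h
  · have hp0 : p = 0 := by linarith
    have hq0 : q = 0 := by linarith
    subst hp0; subst hq0; simp
  set m := (p + q) / 2 with hm
  have hm0 : 0 < m := by positivity
  have e1 : p = m * (p / m) := by field_simp
  have e2 : q = m * (q / m) := by field_simp
  have b1 := mul_log_ge (t := p / m) (by positivity) (by rw [div_le_iff₀ hm0]; linarith)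
  have b2 := mul_log_ge (t := q / m) (by positivity) (by rw [div_le_iff₀ hm0]; linarith)
  have e3 : p / m + q / m = 2 := by rw [← add_div, hm]; field_simp
  have hj : jsE p q = m * ((-Real.negMulLog (p / m) - Real.negMulLog (q / m)) / 2) := by
    have a1 : Real.negMulLog p = m * Real.negMulLog (p / m) + (p / m) * Real.negMulLog m := by
      conv_lhs => rw [e1]
      exact negMulLog_mul_pos
    have a2 : Real.negMulLog q = m * Real.negMulLog (q / m) + (q / m) * Real.negMulLog m := by
      conv_lhs => rw [e2]
      exact negMulLog_mul_pos
    unfold jsE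
    rw [← hm, a1, a2]
    have : q / m = 2 - p / m := by linarith
    rw [this]; ring
  have hx : q / m - 1 = -(p / m - 1) := by linarith
  have e4 : p - q = 2 * m * (p / m - 1) := by field_simp; rw [hm]; ring
  have h5 : jsE p q ≥ m * ((p / m - 1) ^ 2 / 6) := by
    rw [hj]; apply mul_le_mul_of_nonneg_left _ hm0.le
    rw [hx] at b2
    nlinarith
  have e5 : p + q = 2 * m := by rw [hm]; ring
  rw [e4, e5]
  nlinarith

theorem abs_sub_le_jsE {p q θ : ℝ} (hp : 0 ≤ p) (hq : 0 ≤ q) (hθ : 0 < θ) :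
    |p - q| ≤ θ * ((p + q) / 2) + 6 / θ * jsE p q := by
  have h := jsE_ge hp hq
  have hj := jsE_nonneg hp hq
  have h1 : 0 ≤ θ * ((p + q) / 2) := by positivity
  have h2 : 0 ≤ 6 / θ * jsE p q := by positivity
  refine abs_le_of_sq_le_sq ?_ (by positivity)
  have h3 : (θ * ((p + q) / 2)) * (6 / θ * jsE p q) = 3 * (p + q) * jsE p q := by
    field_simp; ring
  nlinarith [sq_nonneg (θ * ((p + q) / 2) - 6 / θ * jsE p q)]

theorem log_le_tangent {x M : ℝ} (hx : 0 < x) (hM : 0 < M) : Real.log x ≤ x / M + Real.log M := by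
  have h := Real.log_le_sub_one_of_pos (x := x / M) (by positivity)
  rw [Real.log_div hx.ne' hM.ne'] at h; linarith

theorem negMulLog_modulus {ε : ℝ} (hε : 0 < ε) : ∃ C : ℝ, 0 ≤ C ∧ ∀ a ∈ Icc (0:ℝ) 1,
    ∀ b ∈ Icc (0:ℝ) 1, |Real.negMulLog a - Real.negMulLog b| ≤ ε + C * |a - b| := by
  have hu : UniformContinuousOn Real.negMulLog (Icc (0:ℝ) 1) :=
    isCompact_Icc.uniformContinuousOn_of_continuous Real.continuous_negMulLog.continuousOn
  rw [Metric.uniformContinuousOn_iff] at hu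
  obtain ⟨δ, hδ, h⟩ := hu ε hε
  refine ⟨1 / δ, by positivity, fun a ha b hb => ?_⟩
  by_cases hd : |a - b| < δ
  · have := h a ha b hb (by rwa [Real.dist_eq])
    rw [Real.dist_eq] at this
    have : 0 ≤ 1 / δ * |a - b| := by positivity
    linarith
  · push Not at hd
    have h1 : 1 ≤ 1 / δ * |a - b| := by rw [one_div_mul_eq_div, le_div_iff₀ hδ]; linarith
    have k : ∀ x ∈ Icc (0:ℝ) 1, 0 ≤ Real.negMulLog x ∧ Real.negMulLog x ≤ 1 := by
      intro x hx
      refine ⟨Real.negMulLog_nonneg hx.1 hx.2, ?_⟩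
      have := negMulLog_le_gibbs (p := x) (a := 1) hx.1 one_pos
      simp at this; linarith [hx.1]
    have ka := k a ha
    have kb := k b hb
    have : |Real.negMulLog a - Real.negMulLog b| ≤ 1 := by
      rw [abs_le]; constructor <;> linarith
    linarith

end
end

section
open MeasureTheory Filter Set Topology
open scoped ENNReal
noncomputable section

/-! ### Distribution functions -/

structure IsCdf (A : ℝ) (F : ℝ → ℝ) : Prop where
  mono : Monotone F
  left : ∀ x, x ≤ -A → F x = 0
  right : ∀ x, A ≤ x → F x = 1

def pw (F : ℝ → ℝ) (r x : ℝ) : ℝ := F (x + r) - F x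

theorem integrable_of_bdd_supp {f : ℝ → ℝ} (hf : Measurable f) {C M : ℝ}
    (hb : ∀ x, |f x| ≤ C) (h0 : ∀ x, M < |x| → f x = 0) : Integrable f := by
  have h1 : IntegrableOn f (Icc (-M) M) := by
    apply Measure.integrableOn_of_bounded (M := C) (by simp) hf.aestronglyMeasurable
    exact Eventually.of_forall (fun x => by rw [Real.norm_eq_abs]; exact hb x)
  refine (integrableOn_iff_integrable_of_support_subset ?_).1 h1
  intro x hx
  by_contra hc
  apply hx
  apply h0
  by_contra h
  push Not at h
  exact hc (abs_le.1 h)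

theorem iadd {f g : ℝ → ℝ} (hf : Integrable f) (hg : Integrable g) :
    Integrable (fun x => f x + g x) := hf.add hg

theorem isub {f g : ℝ → ℝ} (hf : Integrable f) (hg : Integrable g) :
    Integrable (fun x => f x - g x) := hf.sub hg

namespace IsCdf
variable {A : ℝ} {F G : ℝ → ℝ}

theorem pos (h : IsCdf A F) : 0 < A := by
  by_contra hc
  push Not at hc
  have h1 := h.left 0 (by linarith)
  have h2 := h.right 0 hc
  linarith

theorem nonneg (h : IsCdf A F) (x : ℝ) : 0 ≤ F x := by
  rcases le_total x (-A) with hx | hx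
  · rw [h.left x hx]
  · rw [← h.left (-A) le_rfl]; exact h.mono hx

theorem le_one (h : IsCdf A F) (x : ℝ) : F x ≤ 1 := by
  rcases le_total A x with hx | hx
  · rw [h.right x hx]
  · rw [← h.right A le_rfl]; exact h.mono hx

theorem meas (h : IsCdf A F) : Measurable F := h.mono.measurable

theorem enlarge (h : IsCdf A F) {B : ℝ} (hAB : A ≤ B) : IsCdf B F :=
  ⟨h.mono, fun x hx => h.left x (by linarith), fun x hx => h.right x (by linarith)⟩

theorem pw_nonneg (h : IsCdf A F) {r : ℝ} (hr : 0 ≤ r) (x : ℝ) : 0 ≤ pw F r x :=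
  sub_nonneg.2 (h.mono (by linarith))

theorem pw_le_one (h : IsCdf A F) {r : ℝ} (x : ℝ) : pw F r x ≤ 1 := by
  unfold pw; linarith [h.nonneg x, h.le_one (x + r)]

theorem abs_pw_le_one (h : IsCdf A F) {r : ℝ} (x : ℝ) : |pw F r x| ≤ 1 := by
  unfold pw; rw [abs_le]
  constructor <;> linarith [h.nonneg x, h.le_one (x + r), h.nonneg (x + r), h.le_one x]

theorem pw_meas (h : IsCdf A F) (r : ℝ) : Measurable (pw F r) :=
  (h.meas.comp (measurable_id.add_const r)).sub h.meas

theorem pw_zero (h : IsCdf A F) {r : ℝ} {x : ℝ} (hx : A + |r| < |x|) : pw F r x = 0 := by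
  unfold pw
  have h1 := abs_le.1 (le_refl |r|)
  have h2 := abs_nonneg r
  rcases le_total 0 x with h0 | h0
  · rw [abs_of_nonneg h0] at hx
    rw [h.right _ (by linarith), h.right _ (by linarith), sub_self]
  · rw [abs_of_nonpos h0] at hx
    rw [h.left _ (by linarith), h.left _ (by linarith), sub_self]

theorem sub_zero' (h : IsCdf A F) (h' : IsCdf A G) {x : ℝ} (hx : A < |x|) : F x - G x = 0 := by
  rcases le_total 0 x with h0 | h0
  · rw [abs_of_nonneg h0] at hx
    rw [h.right _ (by linarith), h'.right _ (by linarith), sub_self]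
  · rw [abs_of_nonpos h0] at hx
    rw [h.left _ (by linarith), h'.left _ (by linarith), sub_self]

/-- the mixture of cdfs -/
theorem mix {ι : Type*} (s : Finset ι) {l : ι → ℝ} {f : ι → ℝ → ℝ} (hl : ∀ i ∈ s, 0 ≤ l i)
    (hl1 : ∑ i ∈ s, l i = 1) (hf : ∀ i ∈ s, IsCdf A (f i)) :
    IsCdf A (fun x => ∑ i ∈ s, l i * f i x) where
  mono := fun x y hxy => Finset.sum_le_sum fun i hi =>
    mul_le_mul_of_nonneg_left ((hf i hi).mono hxy) (hl i hi)
  left := fun x hx => Finset.sum_eq_zero fun i hi => by rw [(hf i hi).left x hx, mul_zero]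
  right := fun x hx => by
    rw [← hl1]; exact Finset.sum_congr rfl fun i hi => by rw [(hf i hi).right x hx, mul_one]

theorem half (h : IsCdf A F) (h' : IsCdf A G) : IsCdf A (fun x => (F x + G x) / 2) where
  mono := fun x y hxy => by
    have := h.mono hxy; have := h'.mono hxy; simp only; linarith
  left := fun x hx => by rw [h.left x hx, h'.left x hx]; norm_num
  right := fun x hx => by rw [h.right x hx, h'.right x hx]; norm_num

theorem comp_add (h : IsCdf A F) (a : ℝ) : IsCdf (A + |a|) (fun x => F (x + a)) where
  mono := fun x y hxy => h.mono (by linarith)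
  left := fun x hx => h.left _ (by linarith [le_abs_self a])
  right := fun x hx => h.right _ (by linarith [neg_abs_le a])

/-- generic integrability of a measurable function of increments -/
theorem integrable_phi (h : IsCdf A F) {f : ℝ → ℝ} (hf : Continuous f) (hf0 : f 0 = 0) {r : ℝ} :
    Integrable (fun x => f (pw F r x)) := by
  obtain ⟨C, hC⟩ := (isCompact_Icc (a := (-1:ℝ)) (b := 1)).exists_bound_of_continuousOn
    hf.continuousOn
  refine integrable_of_bdd_supp (hf.measurable.comp (h.pw_meas r)) (C := C) (M := A + |r|)
    (fun x => hC _ (abs_le.1 (h.abs_pw_le_one x))) (fun x hx => ?_)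
  rw [h.pw_zero hx, hf0]

theorem integrable_pw (h : IsCdf A F) {r : ℝ} : Integrable (fun x => pw F r x) :=
  h.integrable_phi continuous_id rfl

theorem integral_pw (h : IsCdf A F) (r : ℝ) : ∫ x, pw F r x = r := by
  set H : ℝ → ℝ := fun x => F x - indicator (Ici 0) 1 x with hH
  have hm : Measurable H := h.meas.sub (measurable_one.indicator measurableSet_Ici)
  have hA := h.pos
  have hHi : Integrable H := by
    refine integrable_of_bdd_supp hm (C := 1) (M := A) (fun x => ?_) (fun x hx => ?_)
    · have h1 := h.nonneg x
      have h2 := h.le_one x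
      by_cases h0 : x ∈ Ici (0:ℝ)
      · simp only [hH, indicator_of_mem h0, Pi.one_apply]; rw [abs_le]; constructor <;> linarith
      · simp only [hH, indicator_of_notMem h0]; rw [abs_le]; constructor <;> linarith
    · rcases le_total 0 x with h0 | h0
      · rw [abs_of_nonneg h0] at hx
        have : x ∈ Ici (0:ℝ) := h0
        simp only [hH, indicator_of_mem this, Pi.one_apply]
        rw [h.right x hx.le, sub_self]
      · rw [abs_of_nonpos h0] at hx
        have : x ∉ Ici (0:ℝ) := by simp only [mem_Ici]; linarith
        simp only [hH, indicator_of_notMem this]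
        rw [h.left x (by linarith), sub_self]
  have hHi' : Integrable (fun x => H (x + r)) := hHi.comp_add_right r
  have e : ∀ x, pw F r x = (H (x + r) - H x) +
      (indicator (Ici (-r)) 1 x - indicator (Ici 0) 1 x) := by
    intro x
    have : (indicator (Ici (0:ℝ)) 1 (x + r) : ℝ) = indicator (Ici (-r)) 1 x := by
      simp only [indicator, mem_Ici, Pi.one_apply]
      have : (0 ≤ x + r) ↔ (-r ≤ x) := ⟨fun h => by linarith, fun h => by linarith⟩
      simp only [this]
    simp only [hH, pw, this]; ring
  have h1 : ∫ x, (H (x + r) - H x) = 0 := by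
    rw [integral_sub hHi' hHi, integral_add_right_eq_self H r, sub_self]
  have key : Integrable (fun x : ℝ => (indicator (Ici (-r)) 1 x - indicator (Ici 0) 1 x : ℝ)) ∧
      ∫ x : ℝ, (indicator (Ici (-r)) 1 x - indicator (Ici 0) 1 x : ℝ) = r := by
    rcases le_total 0 r with hr | hr
    · have : (fun x : ℝ => (indicator (Ici (-r)) 1 x - indicator (Ici 0) 1 x : ℝ)) =
          indicator (Ico (-r) 0) 1 := by
        funext x
        simp only [indicator, mem_Ici, mem_Ico, Pi.one_apply]
        split_ifs <;> grind
      rw [this]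
      refine ⟨(integrable_indicator_iff measurableSet_Ico).2 (integrableOn_const (C := (1:ℝ)) (by simp)), ?_⟩
      rw [integral_indicator_one measurableSet_Ico]; simp [hr]
    · have : (fun x : ℝ => (indicator (Ici (-r)) 1 x - indicator (Ici 0) 1 x : ℝ)) =
          fun x => - indicator (Ico 0 (-r)) (1 : ℝ → ℝ) x := by
        funext x
        simp only [indicator, mem_Ici, mem_Ico, Pi.one_apply]
        split_ifs <;> grind
      rw [this]
      refine ⟨((integrable_indicator_iff measurableSet_Ico).2 (integrableOn_const (C := (1:ℝ)) (by simp))).neg, ?_⟩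
      rw [integral_neg, integral_indicator_one measurableSet_Ico]; simp [hr]
  simp_rw [e]
  rw [integral_add (isub hHi' hHi) key.1, h1, key.2, zero_add]

theorem integral_abs_pw (h : IsCdf A F) (r : ℝ) : ∫ x, |pw F r x| = |r| := by
  rcases le_total 0 r with hr | hr
  · rw [abs_of_nonneg hr]
    refine Eq.trans ?_ (h.integral_pw r)
    apply integral_congr_ae
    exact Eventually.of_forall fun x => abs_of_nonneg (h.pw_nonneg hr x)
  · have h2 := h.integral_pw r
    rw [abs_of_nonpos hr]
    have : (fun x => |pw F r x|) = fun x => - pw F r x := by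
      funext x
      apply abs_of_nonpos
      exact sub_nonpos.2 (h.mono (by linarith))
    rw [this, integral_neg, h2]

theorem integrable_sub (h : IsCdf A F) (h' : IsCdf A G) : Integrable (fun x => F x - G x) := by
  refine integrable_of_bdd_supp (h.meas.sub h'.meas) (C := 1) (M := A) (fun x => ?_)
    (fun x hx => h.sub_zero' h' hx)
  rw [abs_le]; constructor <;> linarith [h.nonneg x, h.le_one x, h'.nonneg x, h'.le_one x]

end IsCdf

/-- L¹ distance -/
def W1 (F G : ℝ → ℝ) : ℝ := ∫ x, |F x - G x|

theorem W1_nonneg (F G : ℝ → ℝ) : 0 ≤ W1 F G := integral_nonneg fun _ => abs_nonneg _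

theorem W1_shift {A : ℝ} {F : ℝ → ℝ} (h : IsCdf A F) (a : ℝ) :
    W1 (fun x => F (x + a)) F = |a| := h.integral_abs_pw a

theorem W1_triangle {A : ℝ} {F G H : ℝ → ℝ} (hF : IsCdf A F) (hG : IsCdf A G) (hH : IsCdf A H) :
    W1 F H ≤ W1 F G + W1 G H := by
  unfold W1
  rw [← integral_add (hF.integrable_sub hG).abs (hG.integrable_sub hH).abs]
  exact integral_mono (hF.integrable_sub hH).abs
    ((hF.integrable_sub hG).abs.add (hG.integrable_sub hH).abs)
    (fun x => abs_sub_le _ _ _)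

theorem W1_le_of_close {A e : ℝ} {F G : ℝ → ℝ} (hF : IsCdf A F) (hG : IsCdf A G) (he : 0 ≤ e)
    (h1 : ∀ x, F x ≤ G (x + e)) (h2 : ∀ x, G x ≤ F (x + e)) : W1 F G ≤ 2 * e := by
  have : W1 F G ≤ ∫ x, (pw F e x + pw G e x) := by
    apply integral_mono (hF.integrable_sub hG).abs (iadd hF.integrable_pw hG.integrable_pw)
    intro x
    simp only [pw]
    have a1 := hF.pw_nonneg he x
    have a2 := hG.pw_nonneg he x
    simp only [pw] at a1 a2
    rw [abs_le]; constructor <;> linarith [h1 x, h2 x]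
  rw [integral_add hF.integrable_pw hG.integrable_pw, hF.integral_pw, hG.integral_pw] at this
  linarith

theorem integral_abs_pw_sub_le {A : ℝ} {F G : ℝ → ℝ} (hF : IsCdf A F) (hG : IsCdf A G) (r : ℝ) :
    ∫ x, |pw F r x - pw G r x| ≤ 2 * W1 F G := by
  have i1 := (hF.integrable_sub hG).abs
  have i2 : Integrable (fun x => |F (x + r) - G (x + r)|) := i1.comp_add_right r
  calc ∫ x, |pw F r x - pw G r x| ≤ ∫ x, (|F (x + r) - G (x + r)| + |F x - G x|) := by
        apply integral_mono (isub hF.integrable_pw hG.integrable_pw).abs (iadd i2 i1)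
        intro x
        simp only [pw]
        have : F (x + r) - F x - (G (x + r) - G x) = (F (x + r) - G (x + r)) - (F x - G x) := by
          ring
        rw [this]
        exact abs_sub _ _
    _ = 2 * W1 F G := by
        rw [integral_add i2 i1, integral_add_right_eq_self (fun x => |F x - G x|) r]
        unfold W1; ring

theorem integral_abs_pw_sub_r_le {A : ℝ} {F : ℝ → ℝ} (hF : IsCdf A F) (r r' : ℝ) :
    ∫ x, |pw F r x - pw F r' x| = |r - r'| := by
  have : ∀ x, |pw F r x - pw F r' x| = (fun y => |pw F (r - r') y|) (x + r') := by
    intro x; simp only [pw]; congr 1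
    have : x + r' + (r - r') = x + r := by ring
    rw [this]; ring
  simp_rw [this]
  rw [integral_add_right_eq_self (fun y => |pw F (r - r') y|) r', hF.integral_abs_pw]

/-- joint modulus -/
theorem integral_negMulLog_modulus {A R ε : ℝ} (hε : 0 < ε) (hR : 0 ≤ R) : ∃ C : ℝ, 0 ≤ C ∧
    ∀ F G : ℝ → ℝ, IsCdf A F → IsCdf A G → ∀ r ∈ Icc 0 R, ∀ r' ∈ Icc 0 R,
    |(∫ x, Real.negMulLog (pw F r x)) - ∫ x, Real.negMulLog (pw G r' x)| ≤
      ε + C * (W1 F G + |r - r'|) := by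
  by_cases hA : 0 < A
  swap
  · exact ⟨0, le_rfl, fun F G hF => absurd hF.pos hA⟩
  obtain ⟨C, hC0, hC⟩ := negMulLog_modulus (ε := ε / (2 * (A + R))) (by positivity)
  refine ⟨2 * C, by positivity, fun F G hF hG r hr r' hr' => ?_⟩
  have iF := hF.integrable_phi Real.continuous_negMulLog (by simp) (r := r)
  have iG := hG.integrable_phi Real.continuous_negMulLog (by simp) (r := r')
  have iFG : Integrable (fun x => |pw F r x - pw G r x|) :=
    (isub hF.integrable_pw hG.integrable_pw).abs
  have iGG : Integrable (fun x => |pw G r x - pw G r' x|) :=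
    (isub hG.integrable_pw hG.integrable_pw).abs
  have iI : Integrable (fun x => indicator (Icc (-(A+R)) (A+R)) (fun _ => ε / (2 * (A + R))) x) :=
    (integrable_indicator_iff measurableSet_Icc).2 (by simp)
  rw [← integral_sub iF iG]
  refine (abs_integral_le_integral_abs).trans ?_
  calc ∫ x, |Real.negMulLog (pw F r x) - Real.negMulLog (pw G r' x)|
      ≤ ∫ x, (indicator (Icc (-(A+R)) (A+R)) (fun _ => ε / (2 * (A + R))) x +
          C * (|pw F r x - pw G r x| + |pw G r x - pw G r' x|)) := by
        apply integral_mono (isub iF iG).abs (iadd iI ((iadd iFG iGG).const_mul C))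
        intro x
        simp only
        by_cases hx : x ∈ Icc (-(A+R)) (A+R)
        · rw [indicator_of_mem hx]
          have := hC (pw F r x) ⟨hF.pw_nonneg hr.1 x, hF.pw_le_one x⟩ (pw G r' x)
            ⟨hG.pw_nonneg hr'.1 x, hG.pw_le_one x⟩
          have h2 := abs_sub_le (pw F r x) (pw G r x) (pw G r' x)
          have h3 := mul_le_mul_of_nonneg_left h2 hC0
          linarith
        · rw [indicator_of_notMem hx]
          have hx' : A + R < |x| := by
            by_contra hc; push Not at hc; exact hx (abs_le.1 hc)
          rw [hF.pw_zero (by rw [abs_of_nonneg hr.1]; linarith [hr.2]),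
            hG.pw_zero (r := r') (by rw [abs_of_nonneg hr'.1]; linarith [hr'.2])]
          simp; positivity
    _ ≤ ε + 2 * C * (W1 F G + |r - r'|) := by
        rw [integral_add iI ((iadd iFG iGG).const_mul C), integral_const_mul,
          integral_add iFG iGG, integral_abs_pw_sub_r_le hG, integral_indicator measurableSet_Icc]
        simp only [integral_const, MeasurableSet.univ, measureReal_restrict_apply, univ_inter,
          smul_eq_mul, Real.volume_real_Icc]
        rw [max_eq_left (by linarith)]
        have e1 : (A + R - -(A + R)) * (ε / (2 * (A + R))) = ε := by field_simp; ring
        rw [e1]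
        have := integral_abs_pw_sub_le hF hG r
        have h3 := mul_le_mul_of_nonneg_left this hC0
        have h4 : 0 ≤ C * |r - r'| := by positivity
        linarith

end
end

section
open MeasureTheory Filter Set Topology
open scoped ENNReal
noncomputable section

/-! ### Entropy functionals -/

def Phi (r : ℝ) (F : ℝ → ℝ) : ℝ := r⁻¹ * ∫ x, Real.negMulLog (pw F r x)

def Ent (r : ℝ) (F : ℝ → ℝ) : ℝ := Phi (r / 2) F - Phi r F

def JJ (r : ℝ) (F G : ℝ → ℝ) : ℝ :=
  Phi r (fun x => (F x + G x) / 2) - (Phi r F + Phi r G) / 2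

def NN (r : ℝ) (F : ℝ → ℝ) (a : ℝ) : ℝ := r⁻¹ * ∫ x, |pw F r x - pw F r (x + a)|

def aff (ρ t : ℝ) (F : ℝ → ℝ) : ℝ → ℝ := fun x => F ((x - t) / ρ)

theorem IsCdf.aff {A ρ : ℝ} {F : ℝ → ℝ} (h : IsCdf A F) (hρ : 0 < ρ) (t : ℝ) :
    IsCdf (ρ * A + |t|) (aff ρ t F) where
  mono := fun x y hxy => h.mono (by gcongr)
  left := fun x hx => h.left _ (by
    rw [div_le_iff₀ hρ]; linarith [neg_abs_le t])
  right := fun x hx => h.right _ (by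
    rw [le_div_iff₀ hρ]; linarith [le_abs_self t])

theorem integral_comp_aff (f : ℝ → ℝ) {ρ : ℝ} (hρ : 0 < ρ) (t : ℝ) :
    ∫ x, f ((x - t) / ρ) = ρ * ∫ x, f x := by
  have h1 : ∫ x, f ((x - t) / ρ) = ∫ x, f (x / ρ) := integral_sub_right_eq_self (fun x => f (x / ρ)) t
  rw [h1, Measure.integral_comp_div, abs_of_pos hρ, smul_eq_mul]

theorem pw_aff (F : ℝ → ℝ) {ρ : ℝ} (hρ : 0 < ρ) (t r x : ℝ) :
    pw (aff ρ t F) r x = pw F (r / ρ) ((x - t) / ρ) := by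
  unfold pw aff
  have : (x + r - t) / ρ = (x - t) / ρ + r / ρ := by field_simp; ring
  rw [this]

theorem Phi_aff (F : ℝ → ℝ) {ρ r : ℝ} (hρ : 0 < ρ) (t : ℝ) :
    Phi r (aff ρ t F) = Phi (r / ρ) F := by
  unfold Phi
  simp_rw [pw_aff F hρ]
  rw [integral_comp_aff (fun y => Real.negMulLog (pw F (r / ρ) y)) hρ, inv_div]
  ring

theorem Ent_aff (F : ℝ → ℝ) {ρ r : ℝ} (hρ : 0 < ρ) (t : ℝ) :
    Ent r (aff ρ t F) = Ent (r / ρ) F := by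
  unfold Ent; rw [Phi_aff F hρ, Phi_aff F hρ]; congr 2; ring

theorem pw_mix {ι : Type*} (s : Finset ι) (l : ι → ℝ) (f : ι → ℝ → ℝ) (r x : ℝ) :
    pw (fun x => ∑ i ∈ s, l i * f i x) r x = ∑ i ∈ s, l i * pw (f i) r x := by
  simp only [pw, mul_sub, Finset.sum_sub_distrib]

theorem pw_half (F G : ℝ → ℝ) (r x : ℝ) :
    pw (fun x => (F x + G x) / 2) r x = (pw F r x + pw G r x) / 2 := by
  simp only [pw]; ring

theorem pw_two (F : ℝ → ℝ) (r x : ℝ) : pw F (r / 2) x + pw F (r / 2) (x + r / 2) = pw F r x := by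
  simp only [pw]
  have : x + r / 2 + r / 2 = x + r := by ring
  rw [this]; ring

section
variable {A : ℝ} {F G : ℝ → ℝ}

theorem IsCdf.int_nml (h : IsCdf A F) (r : ℝ) :
    Integrable (fun x => Real.negMulLog (pw F r x)) :=
  h.integrable_phi Real.continuous_negMulLog (by simp)

theorem IsCdf.int_psiE (h : IsCdf A F) (r : ℝ) :
    Integrable (fun x => psiE (pw F (r / 2) x) (pw F (r / 2) (x + r / 2))) := by
  unfold psiE
  simp_rw [pw_two]
  exact isub (iadd (h.int_nml _) ((h.int_nml (r / 2)).comp_add_right (r / 2))) (h.int_nml _)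

theorem Ent_eq (h : IsCdf A F) (r : ℝ) :
    Ent r F = r⁻¹ * ∫ x, psiE (pw F (r / 2) x) (pw F (r / 2) (x + r / 2)) := by
  unfold psiE
  simp_rw [pw_two]
  have i2 : Integrable (fun x => Real.negMulLog (pw F (r / 2) (x + r / 2))) :=
    (h.int_nml (r / 2)).comp_add_right (r / 2)
  rw [integral_sub (iadd (h.int_nml _) i2) (h.int_nml _), integral_add (h.int_nml _) i2,
    integral_add_right_eq_self (fun x => Real.negMulLog (pw F (r / 2) x)) (r / 2)]
  unfold Ent Phi
  rw [inv_div]; ring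

theorem Ent_nonneg (h : IsCdf A F) {r : ℝ} (hr : 0 < r) : 0 ≤ Ent r F := by
  rw [Ent_eq h]
  exact mul_nonneg (by positivity) (integral_nonneg fun x =>
    psiE_nonneg (h.pw_nonneg (by positivity) _) (h.pw_nonneg (by positivity) _))

theorem log_two_sub_Ent_le (h : IsCdf A F) {r : ℝ} (hr : 0 < r) :
    Real.log 2 - Ent r F ≤ Real.log 2 / 2 * NN (r / 2) F (r / 2) := by
  have e1 : Real.log 2 = r⁻¹ * ∫ x, pw F r x * Real.log 2 := by
    rw [integral_mul_const, h.integral_pw]; field_simp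
  have ii : Integrable (fun x => pw F r x * Real.log 2) := h.integrable_pw.mul_const _
  rw [Ent_eq h]
  nth_rw 1 [e1]
  rw [← mul_sub, ← integral_sub ii (h.int_psiE r)]
  unfold NN
  have e2 : Real.log 2 / 2 * ((r / 2)⁻¹ * ∫ x, |pw F (r / 2) x - pw F (r / 2) (x + r / 2)|) =
      r⁻¹ * ∫ x, Real.log 2 * |pw F (r / 2) x - pw F (r / 2) (x + r / 2)| := by
    rw [integral_const_mul, inv_div]; ring
  rw [e2]
  apply mul_le_mul_of_nonneg_left _ (by positivity)
  have i3 : Integrable (fun x => pw F (r / 2) (x + r / 2)) :=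
    (h.integrable_pw (r := r / 2)).comp_add_right (r / 2)
  apply integral_mono (isub ii (h.int_psiE r)) ((isub h.integrable_pw i3).abs.const_mul _)
  intro x
  simp only
  rw [← pw_two, ← two_jsE]
  have := jsE_le (h.pw_nonneg (r := r / 2) (by positivity) x)
    (h.pw_nonneg (r := r / 2) (by positivity) (x + r / 2))
  linarith

theorem Ent_le (h : IsCdf A F) {r : ℝ} (hr : 0 < r) : Ent r F ≤ Real.log 2 := by
  have e1 : Real.log 2 = r⁻¹ * ∫ x, pw F r x * Real.log 2 := by
    rw [integral_mul_const, h.integral_pw]; field_simp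
  rw [Ent_eq h, e1]
  apply mul_le_mul_of_nonneg_left _ (by positivity)
  apply integral_mono (h.int_psiE r) (h.integrable_pw.mul_const _)
  intro x
  simp only
  rw [← pw_two F r]
  exact psiE_le_log_two (h.pw_nonneg (by positivity) _) (h.pw_nonneg (by positivity) _)

theorem Ent_concave {ι : Type*} (s : Finset ι) {l : ι → ℝ} {f : ι → ℝ → ℝ}
    (hl : ∀ i ∈ s, 0 ≤ l i) (hl1 : ∑ i ∈ s, l i = 1) (hf : ∀ i ∈ s, IsCdf A (f i))
    {r : ℝ} (hr : 0 < r) :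
    ∑ i ∈ s, l i * Ent r (f i) ≤ Ent r (fun x => ∑ i ∈ s, l i * f i x) := by
  have hm := IsCdf.mix s hl hl1 hf
  rw [Ent_eq hm]
  have e1 : ∑ i ∈ s, l i * Ent r (f i) = r⁻¹ * ∫ x, ∑ i ∈ s,
      l i * psiE (pw (f i) (r / 2) x) (pw (f i) (r / 2) (x + r / 2)) := by
    rw [integral_finsetSum s (fun i hi => ((hf i hi).int_psiE r).const_mul _), Finset.mul_sum]
    apply Finset.sum_congr rfl
    intro i hi
    rw [Ent_eq (hf i hi), integral_const_mul]; ring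
  rw [e1]
  apply mul_le_mul_of_nonneg_left _ (by positivity)
  apply integral_mono (integrable_finsetSum s (fun i hi => ((hf i hi).int_psiE r).const_mul _))
    (hm.int_psiE r)
  intro x
  simp only
  rw [pw_mix, pw_mix]
  exact psiE_superadd s l _ _ hl (fun i hi => (hf i hi).pw_nonneg (by positivity) _)
    (fun i hi => (hf i hi).pw_nonneg (by positivity) _)

theorem Ent_half_sub (r : ℝ) (F G : ℝ → ℝ) :
    Ent r (fun x => (F x + G x) / 2) = (Ent r F + Ent r G) / 2 + (JJ (r / 2) F G - JJ r F G) := by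
  unfold Ent JJ; ring

theorem half_eq_mix (F G : ℝ → ℝ) : (fun x => (F x + G x) / 2) =
    fun x => ∑ i : Fin 2, (fun _ => (1/2 : ℝ)) i * (![F, G] i) x := by
  funext x; simp [Fin.sum_univ_two]; ring

theorem JJ_half_le (hF : IsCdf A F) (hG : IsCdf A G) {r : ℝ} (hr : 0 < r) :
    JJ r F G ≤ JJ (r / 2) F G := by
  have h := Ent_concave (A := A) (Finset.univ : Finset (Fin 2)) (l := fun _ => (1/2 : ℝ))
    (f := ![F, G]) (by intros; norm_num) (by simp)
    (by intro i _; fin_cases i <;> simp [hF, hG]) hr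
  rw [← half_eq_mix, Ent_half_sub] at h
  simp [Fin.sum_univ_two] at h
  linarith

theorem int_jsE (hF : IsCdf A F) (hG : IsCdf A G) (r : ℝ) :
    Integrable (fun x => jsE (pw F r x) (pw G r x)) := by
  unfold jsE
  have := (hF.half hG).int_nml r
  simp_rw [pw_half] at this
  exact isub this ((iadd (hF.int_nml r) (hG.int_nml r)).div_const 2)

theorem JJ_eq (hF : IsCdf A F) (hG : IsCdf A G) (r : ℝ) :
    JJ r F G = r⁻¹ * ∫ x, jsE (pw F r x) (pw G r x) := by
  unfold jsE
  have := (hF.half hG).int_nml r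
  simp_rw [pw_half] at this
  rw [integral_sub this ((iadd (hF.int_nml r) (hG.int_nml r)).div_const 2),
    integral_div, integral_add (hF.int_nml r) (hG.int_nml r)]
  unfold JJ Phi
  simp_rw [pw_half]; ring

theorem JJ_nonneg (hF : IsCdf A F) (hG : IsCdf A G) {r : ℝ} (hr : 0 < r) : 0 ≤ JJ r F G := by
  rw [JJ_eq hF hG]
  exact mul_nonneg (by positivity) (integral_nonneg fun x =>
    jsE_nonneg (hF.pw_nonneg hr.le _) (hG.pw_nonneg hr.le _))

theorem JJ_le (hF : IsCdf A F) (hG : IsCdf A G) {r : ℝ} (hr : 0 < r) :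
    JJ r F G ≤ Real.log 2 * (W1 F G / r) := by
  rw [JJ_eq hF hG]
  have h1 : ∫ x, jsE (pw F r x) (pw G r x) ≤ ∫ x, Real.log 2 / 2 * |pw F r x - pw G r x| := by
    apply integral_mono (int_jsE hF hG r)
      ((isub hF.integrable_pw hG.integrable_pw).abs.const_mul _)
    intro x
    exact jsE_le (hF.pw_nonneg hr.le _) (hG.pw_nonneg hr.le _)
  rw [integral_const_mul] at h1
  have h2 := integral_abs_pw_sub_le hF hG r
  have hl : 0 ≤ Real.log 2 / 2 := by positivity
  have h3 := mul_le_mul_of_nonneg_left h2 hl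
  calc r⁻¹ * ∫ x, jsE (pw F r x) (pw G r x) ≤ r⁻¹ * (Real.log 2 * W1 F G) :=
        mul_le_mul_of_nonneg_left (by linarith) (by positivity)
    _ = _ := by ring

theorem abs_pw_sub_le_JJ (hF : IsCdf A F) (hG : IsCdf A G) {r θ : ℝ} (hr : 0 < r) (hθ : 0 < θ) :
    r⁻¹ * ∫ x, |pw F r x - pw G r x| ≤ θ + 6 / θ * JJ r F G := by
  rw [JJ_eq hF hG]
  have iI := iadd (hF.integrable_pw (r := r)) (hG.integrable_pw (r := r))
  have h1 : ∫ x, |pw F r x - pw G r x| ≤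
      ∫ x, (θ * ((pw F r x + pw G r x) / 2) + 6 / θ * jsE (pw F r x) (pw G r x)) := by
    apply integral_mono (isub hF.integrable_pw hG.integrable_pw).abs
      (iadd ((iI.div_const 2).const_mul θ) ((int_jsE hF hG r).const_mul _))
    intro x
    exact abs_sub_le_jsE (hF.pw_nonneg hr.le _) (hG.pw_nonneg hr.le _) hθ
  rw [integral_add ((iI.div_const 2).const_mul θ) ((int_jsE hF hG r).const_mul _),
    integral_const_mul, integral_const_mul, integral_div,
    integral_add hF.integrable_pw hG.integrable_pw, hF.integral_pw, hG.integral_pw] at h1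
  calc r⁻¹ * ∫ x, |pw F r x - pw G r x| ≤ _ := mul_le_mul_of_nonneg_left h1 (by positivity)
    _ = _ := by field_simp; ring

/-! #### the translation functional `NN` -/

theorem int_NN (h : IsCdf A F) (r a : ℝ) : Integrable (fun x => pw F r x - pw F r (x + a)) :=
  isub h.integrable_pw ((h.integrable_pw (r := r)).comp_add_right a)

theorem NN_nonneg {r : ℝ} (hr : 0 < r) (F : ℝ → ℝ) (a : ℝ) : 0 ≤ NN r F a :=
  mul_nonneg (by positivity) (integral_nonneg fun _ => abs_nonneg _)

theorem NN_neg (r : ℝ) (F : ℝ → ℝ) (a : ℝ) : NN r F (-a) = NN r F a := by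
  unfold NN
  congr 1
  rw [← integral_add_right_eq_self (fun x => |pw F r x - pw F r (x + -a)|) a]
  apply integral_congr_ae
  refine Eventually.of_forall fun x => ?_
  simp only [add_neg_cancel_right]
  exact abs_sub_comm _ _

theorem NN_add_le (h : IsCdf A F) {r : ℝ} (hr : 0 < r) (a a' : ℝ) :
    NN r F (a + a') ≤ NN r F a + NN r F a' := by
  unfold NN
  rw [← mul_add]
  apply mul_le_mul_of_nonneg_left _ (by positivity)
  have i2 : Integrable (fun x => |pw F r (x + a) - pw F r (x + a + a')|) :=
    ((int_NN h r a').abs).comp_add_right a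
  have e : ∫ x, |pw F r x - pw F r (x + a')| = ∫ x, |pw F r (x + a) - pw F r (x + a + a')| :=
    (integral_add_right_eq_self (fun x => |pw F r x - pw F r (x + a')|) a).symm
  rw [e, ← integral_add (int_NN h r a).abs i2]
  apply integral_mono (int_NN h r _).abs (iadd (int_NN h r a).abs i2)
  intro x
  simp only
  rw [← add_assoc]
  exact abs_sub_le _ _ _

theorem NN_nsmul_le (h : IsCdf A F) {r : ℝ} (hr : 0 < r) (s : ℝ) (k : ℕ) :
    NN r F (k * s) ≤ k * NN r F s := by
  induction k with
  | zero => simp [NN]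
  | succ k ih =>
    push_cast
    rw [add_mul, one_mul]
    have := NN_add_le h hr (k * s) s
    linarith

theorem NN_le (h : IsCdf A F) {r : ℝ} (hr : 0 < r) (a : ℝ) : NN r F a ≤ 2 * |a| / r := by
  unfold NN
  have e : ∀ x, |pw F r x - pw F r (x + a)| ≤ |pw F a x| + |pw F a (x + r)| := by
    intro x
    simp only [pw]
    have : F (x + r) - F x - (F (x + a + r) - F (x + a)) =
      (F (x + a) - F x) - (F (x + r + a) - F (x + r)) := by
        rw [show x + a + r = x + r + a by ring]; ring
    rw [this]; exact abs_sub _ _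
  have i1 := (h.integrable_pw (r := a)).abs
  have i2 : Integrable (fun x => |pw F a (x + r)|) := i1.comp_add_right r
  have h1 : ∫ x, |pw F r x - pw F r (x + a)| ≤ ∫ x, (|pw F a x| + |pw F a (x + r)|) :=
    integral_mono (int_NN h r a).abs (iadd i1 i2) e
  rw [integral_add i1 i2, integral_add_right_eq_self (fun x => |pw F a x|) r,
    h.integral_abs_pw] at h1
  calc r⁻¹ * _ ≤ r⁻¹ * (|a| + |a|) := mul_le_mul_of_nonneg_left h1 (by positivity)
    _ = _ := by ring

theorem pw_add (F : ℝ → ℝ) (r s x : ℝ) : pw F (r + s) x = pw F r x + pw F s (x + r) := by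
  simp only [pw]; rw [add_assoc]; ring

/-- unnormalised translation functional subadditive in the scale -/
theorem int_NN_add (h : IsCdf A F) (r s a : ℝ) :
    ∫ x, |pw F (r + s) x - pw F (r + s) (x + a)| ≤
      (∫ x, |pw F r x - pw F r (x + a)|) + ∫ x, |pw F s x - pw F s (x + a)| := by
  have i2 : Integrable (fun x => |pw F s (x + r) - pw F s (x + r + a)|) :=
    ((int_NN h s a).abs).comp_add_right r
  have e : ∫ x, |pw F s x - pw F s (x + a)| = ∫ x, |pw F s (x + r) - pw F s (x + r + a)| :=
    (integral_add_right_eq_self (fun x => |pw F s x - pw F s (x + a)|) r).symm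
  rw [e, ← integral_add (int_NN h r a).abs i2]
  apply integral_mono (int_NN h _ a).abs (iadd (int_NN h r a).abs i2)
  intro x
  simp only
  rw [pw_add, pw_add, show x + a + r = x + r + a by ring]
  rw [show pw F r x + pw F s (x + r) - (pw F r (x + a) + pw F s (x + r + a)) =
    (pw F r x - pw F r (x + a)) + (pw F s (x + r) - pw F s (x + r + a)) by ring]
  exact abs_add_le _ _

theorem int_NN_nsmul (h : IsCdf A F) (r a : ℝ) (k : ℕ) :
    ∫ x, |pw F (k * r) x - pw F (k * r) (x + a)| ≤ k * ∫ x, |pw F r x - pw F r (x + a)| := by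
  induction k with
  | zero => simp [pw]
  | succ k ih =>
    push_cast
    rw [add_mul, add_mul, one_mul, one_mul]
    have := int_NN_add h (k * r) r a
    linarith

theorem NN_scale_le (h : IsCdf A F) {r s : ℝ} (hr : 0 < r) (hrs : r ≤ s) (a : ℝ) :
    NN s F a ≤ NN r F a + 2 * r / s := by
  have hs : 0 < s := by linarith
  set k := ⌊s / r⌋₊ with hk
  have hk1 : k * r ≤ s := by
    have := Nat.floor_le (a := s / r) (by positivity)
    rwa [le_div_iff₀ hr] at this
  have hk2 : s - k * r ≤ r := by
    have := Nat.lt_floor_add_one (s / r)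
    rw [div_lt_iff₀ hr] at this
    rw [hk]; linarith
  have h1 := int_NN_add h (k * r) (s - k * r) a
  rw [add_sub_cancel] at h1
  have h2 := int_NN_nsmul h r a k
  have h3 : ∫ x, |pw F (s - k * r) x - pw F (s - k * r) (x + a)| ≤ 2 * r := by
    have i1 := (h.integrable_pw (r := s - k * r))
    have i2 : Integrable (fun x => pw F (s - k * r) (x + a)) := i1.comp_add_right a
    calc _ ≤ ∫ x, (pw F (s - k * r) x + pw F (s - k * r) (x + a)) := by
          apply integral_mono (int_NN h _ a).abs (iadd i1 i2)
          intro x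
          simp only
          have a1 := h.pw_nonneg (r := s - k * r) (by linarith) x
          have a2 := h.pw_nonneg (r := s - k * r) (by linarith) (x + a)
          rw [abs_le]; constructor <;> linarith
      _ ≤ _ := by
          rw [integral_add i1 i2, integral_add_right_eq_self (fun x => pw F (s - k * r) x) a,
            h.integral_pw]; linarith
  have hI : 0 ≤ ∫ x, |pw F r x - pw F r (x + a)| := integral_nonneg fun _ => abs_nonneg _
  unfold NN
  set I := ∫ x, |pw F r x - pw F r (x + a)| with hIdef
  calc s⁻¹ * _ ≤ s⁻¹ * (k * I + 2 * r) := mul_le_mul_of_nonneg_left (by linarith) (by positivity)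
    _ = (k * r / s) * (r⁻¹ * I) + 2 * r / s := by field_simp
    _ ≤ 1 * (r⁻¹ * I) + 2 * r / s := by
        gcongr
        rw [div_le_one hs]; exact hk1
    _ = _ := by ring

/-- Key spreading estimate: from near-invariance under translation by `s` at scale `r`
to near invariance under translation by `h` at scale `h`. -/
theorem NN_spread (hF : IsCdf A F) {r s h : ℝ} (hr : 0 < r) (hrh : r ≤ h) (hs : s ≠ 0) :
    NN h F h ≤ h / |s| * NN r F s + 2 * r / h + 2 * |s| / h := by
  have hh : 0 < h := by linarith
  have hs' : 0 < |s| := abs_pos.2 hs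
  have e0 : NN r F |s| = NN r F s := by
    rcases abs_choice s with h1 | h1 <;> rw [h1]
    exact NN_neg _ _ _
  set k := ⌊h / |s|⌋₊ with hk
  have hk1 : k * |s| ≤ h := by
    have := Nat.floor_le (a := h / |s|) (by positivity)
    rwa [le_div_iff₀ hs'] at this
  have hk2 : h - k * |s| ≤ |s| := by
    have := Nat.lt_floor_add_one (h / |s|)
    rw [div_lt_iff₀ hs'] at this
    rw [hk]; linarith
  have h1 := NN_add_le hF hh (k * |s|) (h - k * |s|)
  rw [add_sub_cancel] at h1
  have h2 := NN_le hF hh (h - k * |s|)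
  rw [abs_of_nonneg (show 0 ≤ h - k * |s| by linarith)] at h2
  have h3 : 2 * (h - k * |s|) / h ≤ 2 * |s| / h := by gcongr
  have h4 := NN_scale_le hF hr hrh (k * |s|)
  have h5 := NN_nsmul_le hF hr |s| k
  rw [e0] at h5
  have h6 : (k : ℝ) * NN r F s ≤ h / |s| * NN r F s := by
    apply mul_le_mul_of_nonneg_right _ (NN_nonneg hr _ _)
    rw [le_div_iff₀ hs']; exact hk1
  linarith

end
end
end

section
open MeasureTheory Filter Set Topology
open scoped ENNReal
noncomputable section

/-! ### Integrated entropy -/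

def Dint (T1 T2 : ℝ) (F : ℝ → ℝ) : ℝ := ∫ τ in T1..T2, Ent (Real.exp (-τ)) F

def Bf (T : ℝ) (F : ℝ → ℝ) : ℝ := ∫ τ in T..(T + Real.log 2), Phi (Real.exp (-τ)) F

def JB (T : ℝ) (F G : ℝ → ℝ) : ℝ := ∫ τ in T..(T + Real.log 2), JJ (Real.exp (-τ)) F G

section
variable {A : ℝ} {F G : ℝ → ℝ}

theorem continuousOn_Phi (h : IsCdf A F) : ContinuousOn (fun r => Phi r F) (Ioi 0) := by
  unfold Phi
  apply ContinuousOn.mul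
  · exact continuousOn_inv₀.mono fun x hx => ne_of_gt hx
  · intro r hr
    have hr : 0 < r := hr
    rw [Metric.continuousWithinAt_iff]
    intro ε hε
    obtain ⟨C, hC0, hC⟩ := integral_negMulLog_modulus (A := A) (R := r + 1) (half_pos hε)
      (by positivity)
    refine ⟨min 1 (ε / (2 * (C + 1))), by positivity, fun {r'} hr' hd => ?_⟩
    rw [Real.dist_eq] at hd ⊢
    have hr'0 : 0 < r' := hr'
    have h1 := lt_of_lt_of_le hd (min_le_left _ _)
    have h2 := lt_of_lt_of_le hd (min_le_right _ _)
    have h3 := hC F F h h r' ⟨hr'0.le, by linarith [(abs_lt.1 h1).2]⟩ r ⟨hr.le, by linarith⟩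
    have h4 : W1 F F = 0 := by simp [W1]
    rw [h4, zero_add] at h3
    rw [lt_div_iff₀ (by positivity)] at h2
    have : 0 ≤ |r' - r| := abs_nonneg _
    nlinarith

theorem continuous_Phi_exp (h : IsCdf A F) : Continuous (fun τ => Phi (Real.exp (-τ)) F) :=
  (continuousOn_Phi h).comp_continuous (by fun_prop) (fun τ => Real.exp_pos _)

theorem exp_half (τ : ℝ) : Real.exp (-τ) / 2 = Real.exp (-(τ + Real.log 2)) := by
  rw [neg_add, Real.exp_add, Real.exp_neg (Real.log 2), Real.exp_log (by norm_num)]; rfl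

theorem Ent_exp (τ : ℝ) (F : ℝ → ℝ) : Ent (Real.exp (-τ)) F =
    Phi (Real.exp (-(τ + Real.log 2))) F - Phi (Real.exp (-τ)) F := by
  unfold Ent; rw [exp_half]

theorem continuous_Ent_exp (h : IsCdf A F) : Continuous (fun τ => Ent (Real.exp (-τ)) F) := by
  simp_rw [Ent_exp]
  have := continuous_Phi_exp h
  exact (this.comp (continuous_add_const (Real.log 2))).sub this

theorem continuous_JJ_exp (hF : IsCdf A F) (hG : IsCdf A G) :
    Continuous (fun τ => JJ (Real.exp (-τ)) F G) := by
  unfold JJ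
  exact (continuous_Phi_exp (hF.half hG)).sub
    (((continuous_Phi_exp hF).add (continuous_Phi_exp hG)).div_const 2)

theorem shift_integral {g : ℝ → ℝ} (hg : Continuous g) (T1 T2 l : ℝ) :
    ∫ τ in T1..T2, (g (τ + l) - g τ) = (∫ τ in T2..(T2 + l), g τ) - ∫ τ in T1..(T1 + l), g τ := by
  have i : ∀ a b, IntervalIntegrable g volume a b := fun a b => hg.intervalIntegrable a b
  have i' : IntervalIntegrable (fun τ => g (τ + l)) volume T1 T2 :=
    (hg.comp (continuous_add_const l)).intervalIntegrable _ _
  rw [intervalIntegral.integral_sub i' (i _ _), intervalIntegral.integral_comp_add_right]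
  rw [← intervalIntegral.integral_add_adjacent_intervals (i (T1 + l) T2) (i T2 (T2 + l)),
    ← intervalIntegral.integral_add_adjacent_intervals (i T1 (T1 + l)) (i (T1 + l) T2)]
  ring

theorem Dint_eq_Bf (h : IsCdf A F) (T1 T2 : ℝ) : Dint T1 T2 F = Bf T2 F - Bf T1 F := by
  unfold Dint Bf
  simp_rw [Ent_exp]
  exact shift_integral (continuous_Phi_exp h) T1 T2 (Real.log 2)

theorem Dint_add (h : IsCdf A F) (T1 T2 T3 : ℝ) : Dint T1 T2 F + Dint T2 T3 F = Dint T1 T3 F := by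
  rw [Dint_eq_Bf h, Dint_eq_Bf h, Dint_eq_Bf h]; ring

theorem Dint_nonneg (h : IsCdf A F) {T1 T2 : ℝ} (hT : T1 ≤ T2) : 0 ≤ Dint T1 T2 F :=
  intervalIntegral.integral_nonneg hT fun _ _ => Ent_nonneg h (Real.exp_pos _)

theorem Dint_le (h : IsCdf A F) {T1 T2 : ℝ} (hT : T1 ≤ T2) :
    Dint T1 T2 F ≤ (T2 - T1) * Real.log 2 := by
  have : Dint T1 T2 F ≤ ∫ _ in T1..T2, Real.log 2 :=
    intervalIntegral.integral_mono_on hT ((continuous_Ent_exp h).intervalIntegrable _ _)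
      (by simp) (fun _ _ => Ent_le h (Real.exp_pos _))
  simpa using this

theorem Dint_ge_of (h : IsCdf A F) {T1 T2 C : ℝ} (hT : T1 ≤ T2)
    (hC : ∀ τ ∈ Icc T1 T2, C ≤ Ent (Real.exp (-τ)) F) :
    (T2 - T1) * C ≤ Dint T1 T2 F := by
  have : ∫ _ in T1..T2, C ≤ Dint T1 T2 F :=
    intervalIntegral.integral_mono_on hT (by simp) ((continuous_Ent_exp h).intervalIntegrable _ _)
      hC
  simpa using this

theorem Dint_aff (F : ℝ → ℝ) {ρ : ℝ} (hρ : 0 < ρ) (t T1 T2 : ℝ) :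
    Dint T1 T2 (aff ρ t F) = Dint (T1 + Real.log ρ) (T2 + Real.log ρ) F := by
  unfold Dint
  rw [← intervalIntegral.integral_comp_add_right (fun τ => Ent (Real.exp (-τ)) F)]
  congr 1
  funext τ
  rw [Ent_aff F hρ, neg_add, Real.exp_add, Real.exp_neg (Real.log ρ), Real.exp_log hρ]
  rfl

theorem Bf_aff (F : ℝ → ℝ) {ρ : ℝ} (hρ : 0 < ρ) (t T : ℝ) :
    Bf T (aff ρ t F) = Bf (T + Real.log ρ) F := by
  unfold Bf
  rw [show T + Real.log ρ + Real.log 2 = T + Real.log 2 + Real.log ρ by ring,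
    ← intervalIntegral.integral_comp_add_right (fun τ => Phi (Real.exp (-τ)) F)]
  congr 1
  funext τ
  rw [Phi_aff F hρ, neg_add, Real.exp_add, Real.exp_neg (Real.log ρ), Real.exp_log hρ]
  rfl

theorem Dint_concave {ι : Type*} (s : Finset ι) {l : ι → ℝ} {f : ι → ℝ → ℝ}
    (hl : ∀ i ∈ s, 0 ≤ l i) (hl1 : ∑ i ∈ s, l i = 1) (hf : ∀ i ∈ s, IsCdf A (f i))
    {T1 T2 : ℝ} (hT : T1 ≤ T2) :
    ∑ i ∈ s, l i * Dint T1 T2 (f i) ≤ Dint T1 T2 (fun x => ∑ i ∈ s, l i * f i x) := by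
  unfold Dint
  simp_rw [← intervalIntegral.integral_const_mul]
  have hi : ∀ i ∈ s, Continuous (fun τ => l i * Ent (Real.exp (-τ)) (f i)) := fun i hi =>
    (continuous_Ent_exp (hf i hi)).const_mul (l i) 
  rw [← intervalIntegral.integral_finsetSum (fun i h => (hi i h).intervalIntegrable _ _)]
  apply intervalIntegral.integral_mono_on hT
  · exact (continuous_finsetSum s hi).intervalIntegrable _ _
  · exact (continuous_Ent_exp (IsCdf.mix s hl hl1 hf)).intervalIntegrable _ _
  · intro τ _
    exact Ent_concave s hl hl1 hf (Real.exp_pos _)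

theorem Dint_half (hF : IsCdf A F) (hG : IsCdf A G) (T1 T2 : ℝ) :
    Dint T1 T2 (fun x => (F x + G x) / 2) =
      (Dint T1 T2 F + Dint T1 T2 G) / 2 + (JB T2 F G - JB T1 F G) := by
  have h1 := shift_integral (continuous_JJ_exp hF hG) T1 T2 (Real.log 2)
  unfold JB
  rw [← h1]
  unfold Dint
  have iF := (continuous_Ent_exp hF).intervalIntegrable (μ := volume) T1 T2
  have iG := (continuous_Ent_exp hG).intervalIntegrable (μ := volume) T1 T2
  have hJ := continuous_JJ_exp hF hG
  have iJ : IntervalIntegrable (fun τ => JJ (Real.exp (-(τ + Real.log 2))) F G -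
      JJ (Real.exp (-τ)) F G) volume T1 T2 :=
    ((hJ.comp (continuous_add_const (Real.log 2))).sub hJ).intervalIntegrable _ _
  rw [← intervalIntegral.integral_add iF iG, ← intervalIntegral.integral_div,
    ← intervalIntegral.integral_add ((iF.add iG).div_const 2) iJ]
  congr 1
  funext τ
  rw [Ent_half_sub, exp_half]

theorem JB_mono (hF : IsCdf A F) (hG : IsCdf A G) {T1 T2 : ℝ} (hT : T1 ≤ T2) :
    JB T1 F G ≤ JB T2 F G := by
  have h1 := shift_integral (continuous_JJ_exp hF hG) T1 T2 (Real.log 2)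
  have h2 : 0 ≤ ∫ τ in T1..T2, (JJ (Real.exp (-(τ + Real.log 2))) F G -
      JJ (Real.exp (-τ)) F G) := by
    apply intervalIntegral.integral_nonneg hT
    intro τ _
    rw [← exp_half]
    exact sub_nonneg.2 (JJ_half_le hF hG (Real.exp_pos _))
  unfold JB; linarith

theorem JB_le (hF : IsCdf A F) (hG : IsCdf A G) {T C : ℝ}
    (hC : ∀ τ ∈ Icc T (T + Real.log 2), JJ (Real.exp (-τ)) F G ≤ C) :
    JB T F G ≤ Real.log 2 * C := by
  have : JB T F G ≤ ∫ _ in T..(T + Real.log 2), C :=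
    intervalIntegral.integral_mono_on (by linarith [Real.log_pos one_lt_two])
      ((continuous_JJ_exp hF hG).intervalIntegrable _ _) (by simp) hC
  simpa using this

theorem JJ_exp_mono (hF : IsCdf A F) (hG : IsCdf A G) (r : ℝ) (hr : 0 < r) (i : ℕ) :
    JJ (2 ^ i * r) F G ≤ JJ r F G := by
  induction i with
  | zero => simp
  | succ i ih =>
    have := JJ_half_le hF hG (r := 2 ^ (i + 1) * r) (by positivity)
    rw [show (2:ℝ) ^ (i + 1) * r / 2 = 2 ^ i * r by ring] at this
    linarith

theorem Bf_nonneg (hF : IsCdf A F) (T : ℝ) : 0 ≤ Bf T F := by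
  unfold Bf
  apply intervalIntegral.integral_nonneg (by linarith [Real.log_pos one_lt_two])
  intro τ _
  unfold Phi
  exact mul_nonneg (by positivity) (integral_nonneg fun x =>
    Real.negMulLog_nonneg (hF.pw_nonneg (Real.exp_pos _).le _) (hF.pw_le_one _))

/-- uniform bound of `Bf 0` -/
theorem Bf_zero_le (hF : IsCdf A F) : Bf 0 F ≤ Real.log 2 * (2 * 2 * (A + 1)) := by
  have hA := hF.pos
  have : Bf 0 F ≤ ∫ _ in (0:ℝ)..(0 + Real.log 2), (2 * 2 * (A + 1)) := by
    apply intervalIntegral.integral_mono_on (by linarith [Real.log_pos one_lt_two])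
      ((continuous_Phi_exp hF).intervalIntegrable _ _) (by simp)
    intro τ hτ
    rw [zero_add] at hτ
    unfold Phi
    have e1 : (Real.exp (-τ))⁻¹ ≤ 2 := by
      rw [← Real.exp_neg, neg_neg]
      calc Real.exp τ ≤ Real.exp (Real.log 2) := Real.exp_le_exp.2 hτ.2
        _ = 2 := Real.exp_log (by norm_num)
    have e2 : Real.exp (-τ) ≤ 1 := by rw [Real.exp_le_one_iff]; linarith [hτ.1]
    have e3 : ∫ x, Real.negMulLog (pw F (Real.exp (-τ)) x) ≤ 2 * (A + 1) := by
      calc _ ≤ ∫ x, indicator (Icc (-(A+1)) (A+1)) (fun _ => (1:ℝ)) x := by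
            apply integral_mono (hF.int_nml _)
              ((integrable_indicator_iff measurableSet_Icc).2 (by simp))
            intro x
            simp only
            by_cases hx : x ∈ Icc (-(A+1)) (A+1)
            · rw [indicator_of_mem hx]
              have := negMulLog_le_gibbs (a := 1) (hF.pw_nonneg (Real.exp_pos (-τ)).le x) one_pos
              have h2 := hF.pw_nonneg (Real.exp_pos (-τ)).le x
              simp at this; linarith
            · rw [indicator_of_notMem hx, hF.pw_zero]; simp
              rw [abs_of_pos (Real.exp_pos _)]
              by_contra hc; push Not at hc; exact hx (abs_le.1 (by linarith))
        _ = _ := by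
            rw [integral_indicator measurableSet_Icc]
            simp; rw [max_eq_left (by linarith)]; ring
    have e4 : 0 ≤ ∫ x, Real.negMulLog (pw F (Real.exp (-τ)) x) := integral_nonneg fun x =>
      Real.negMulLog_nonneg (hF.pw_nonneg (Real.exp_pos _).le _) (hF.pw_le_one _)
    have e5 : 0 < (Real.exp (-τ))⁻¹ := by positivity
    nlinarith
  rw [intervalIntegral.integral_const, add_sub_cancel_left, smul_eq_mul] at this
  linarith

theorem Dint_modulus {A T1 T2 ε : ℝ} (hT : T1 ≤ T2) (hε : 0 < ε) : ∃ δ > 0, ∀ F G : ℝ → ℝ,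
    IsCdf A F → IsCdf A G → W1 F G ≤ δ → |Dint T1 T2 F - Dint T1 T2 G| ≤ ε := by
  have l2 := Real.log_pos one_lt_two
  -- modulus for Phi on the range
  set R := Real.exp (-T1) with hR
  set r0 := Real.exp (-(T2 + Real.log 2)) with hr0
  set L := T2 - T1 + 1 with hL
  have hL0 : 0 < L := by linarith
  have hr00 : 0 < r0 := Real.exp_pos _
  obtain ⟨C, hC0, hC⟩ := integral_negMulLog_modulus (A := A) (R := R)
    (ε := ε * r0 / (4 * L)) (by positivity) (Real.exp_pos _).le
  refine ⟨ε * r0 / (4 * L * (C + 1)), by positivity, fun F G hF hG hW => ?_⟩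
  have hP : ∀ τ ∈ Icc T1 (T2 + Real.log 2),
      |Phi (Real.exp (-τ)) F - Phi (Real.exp (-τ)) G| ≤ ε / (2 * L) := by
    intro τ hτ
    have h1 : Real.exp (-τ) ≤ R := Real.exp_le_exp.2 (by linarith [hτ.1])
    have h2 : r0 ≤ Real.exp (-τ) := Real.exp_le_exp.2 (by linarith [hτ.2])
    have h3 := hC F G hF hG _ ⟨(Real.exp_pos _).le, h1⟩ _ ⟨(Real.exp_pos _).le, h1⟩
    rw [sub_self, abs_zero, add_zero] at h3
    unfold Phi
    rw [← mul_sub, abs_mul, abs_of_pos (by positivity)]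
    have h4 : C * W1 F G ≤ ε * r0 / (4 * L) := by
      calc C * W1 F G ≤ (C + 1) * (ε * r0 / (4 * L * (C + 1))) := by
            apply mul_le_mul (by linarith) hW (W1_nonneg _ _) (by positivity)
        _ = _ := by field_simp
    rw [inv_mul_le_iff₀ (Real.exp_pos _)]
    calc _ ≤ ε * r0 / (4 * L) + ε * r0 / (4 * L) := by linarith
      _ = r0 * (ε / (2 * L)) := by field_simp; ring
      _ ≤ _ := by gcongr
  have hE : ∀ τ ∈ Icc T1 T2, |Ent (Real.exp (-τ)) F - Ent (Real.exp (-τ)) G| ≤ ε / L := by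
    intro τ hτ
    have h1 := hP τ ⟨hτ.1, by linarith [hτ.2]⟩
    have h2 := hP (τ + Real.log 2) ⟨by linarith [hτ.1], by linarith [hτ.2]⟩
    rw [Ent_exp, Ent_exp]
    have e : ε / L = ε / (2 * L) + ε / (2 * L) := by field_simp; ring
    rw [e]
    rw [abs_le] at h1 h2 ⊢
    constructor <;> linarith [h1.1, h1.2, h2.1, h2.2]
  unfold Dint
  rw [← intervalIntegral.integral_sub ((continuous_Ent_exp hF).intervalIntegrable _ _)
    ((continuous_Ent_exp hG).intervalIntegrable _ _), ← Real.norm_eq_abs]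
  have := intervalIntegral.norm_integral_le_of_norm_le_const (a := T1) (b := T2) (C := ε / L)
    (f := fun τ => Ent (Real.exp (-τ)) F - Ent (Real.exp (-τ)) G) (fun τ hτ => by
      rw [uIoc_of_le hT] at hτ
      exact hE τ ⟨hτ.1.le, hτ.2⟩)
  refine this.trans ?_
  rw [abs_of_nonneg (by linarith), div_mul_eq_mul_div, div_le_iff₀ hL0]
  apply mul_le_mul_of_nonneg_left _ hε.le
  linarith

end
end
end

section
open MeasureTheory Filter Set Topology
open scoped ENNReal
noncomputable section

/-! ### Word averages -/

def wavg {N : ℕ} (n : ℕ) (f : (Fin n → Fin N) → ℝ) : ℝ := (∑ w, f w) / (N : ℝ) ^ n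

theorem sum_cons {N n : ℕ} (f : (Fin (n + 1) → Fin N) → ℝ) :
    ∑ w, f w = ∑ i, ∑ w : Fin n → Fin N, f (Fin.cons i w) := by
  rw [← Fintype.sum_prod_type']
  exact (Fintype.sum_equiv (Fin.consEquiv (fun _ => Fin N)) _ _ (fun p => rfl)).symm

section wavg
variable {N n : ℕ}

theorem wavg_zero (f : (Fin 0 → Fin N) → ℝ) : wavg 0 f = f Fin.elim0 := by
  unfold wavg
  rw [Fintype.sum_unique, pow_zero, div_one]
  congr 1

theorem wavg_succ (f : (Fin (n + 1) → Fin N) → ℝ) :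
    wavg (n + 1) f = (∑ i, wavg n (fun w => f (Fin.cons i w))) / N := by
  unfold wavg
  rw [sum_cons, ← Finset.sum_div, pow_succ, div_div]

theorem wavg_mono {f g : (Fin n → Fin N) → ℝ} (h : ∀ w, f w ≤ g w) : wavg n f ≤ wavg n g := by
  unfold wavg
  exact div_le_div_of_nonneg_right (Finset.sum_le_sum fun w _ => h w) (by positivity)

theorem wavg_const (hN : 0 < N) (a : ℝ) : wavg n (fun _ : Fin n → Fin N => a) = a := by
  unfold wavg
  have : (N : ℝ) ≠ 0 := by positivity
  simp; field_simp

theorem wavg_add (f g : (Fin n → Fin N) → ℝ) :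
    wavg n (fun w => f w + g w) = wavg n f + wavg n g := by
  unfold wavg; rw [Finset.sum_add_distrib, add_div]

theorem wavg_sub (f g : (Fin n → Fin N) → ℝ) :
    wavg n (fun w => f w - g w) = wavg n f - wavg n g := by
  unfold wavg; rw [Finset.sum_sub_distrib, sub_div]

theorem wavg_mul (a : ℝ) (f : (Fin n → Fin N) → ℝ) :
    wavg n (fun w => a * f w) = a * wavg n f := by
  unfold wavg; rw [← Finset.mul_sum, mul_div_assoc]

theorem wavg_nonneg {f : (Fin n → Fin N) → ℝ} (h : ∀ w, 0 ≤ f w) : 0 ≤ wavg n f := by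
  unfold wavg; exact div_nonneg (Finset.sum_nonneg fun w _ => h w) (by positivity)

theorem wavg_sum {ι : Type*} (s : Finset ι) (f : ι → (Fin n → Fin N) → ℝ) :
    wavg n (fun w => ∑ i ∈ s, f i w) = ∑ i ∈ s, wavg n (f i) := by
  unfold wavg; rw [Finset.sum_comm, Finset.sum_div]

theorem wavg_eq_sum (f : (Fin n → Fin N) → ℝ) :
    wavg n f = ∑ w, (1 / (N : ℝ) ^ n) * f w := by
  unfold wavg; rw [← Finset.mul_sum]; ring

theorem wavg_weight (hN : 0 < N) : ∑ _w : Fin n → Fin N, (1 / (N : ℝ) ^ n) = 1 := by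
  have := wavg_const (n := n) hN 1
  rw [wavg_eq_sum] at this
  simpa using this

end wavg

/-! ### The abstract framework -/

structure Fam (N : ℕ) where
  b : ℝ
  c : ℝ
  A : ℝ
  u : Fin N → ℝ
  v : Fin N → ℝ
  d : Fin N → ℝ
  F : ℝ → ℝ → ℝ
  K : Set ℝ
  hN : 2 ≤ N
  hc : 0 < c
  hcb : c < b
  hb : b < 1
  hKne : K.Nonempty
  hKA : ∀ z ∈ K, |z| ≤ A
  hgK : ∀ i, ∀ z ∈ K, (c * z - d i) / b ∈ K
  hF : ∀ z ∈ K, IsCdf A (F z)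
  hself : ∀ z ∈ K, ∀ x, F z x = (∑ i, F ((c * z - d i) / b) ((x - (v i - z * u i)) / b)) / N
  hlip : ∀ z ∈ K, ∀ z' ∈ K, W1 (F z) (F z') ≤ A * |z - z'|
  hu : ∀ i, |u i| ≤ A * (1 - c)
  ht : ∀ i, ∀ z ∈ K, |v i - z * u i| ≤ A * (1 - b)

namespace Fam
variable {N : ℕ} (S : Fam N)

def g (i : Fin N) (z : ℝ) : ℝ := (S.c * z - S.d i) / S.b

def zw : (n : ℕ) → (Fin n → Fin N) → ℝ → ℝ
  | 0, _, z => z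
  | n + 1, w, z => zw n (Fin.tail w) (S.g (w 0) z)

def tw : (n : ℕ) → (Fin n → Fin N) → ℝ → ℝ
  | 0, _, _ => 0
  | n + 1, w, z => (S.v (w 0) - z * S.u (w 0)) + S.b * tw n (Fin.tail w) (S.g (w 0) z)

def hw : (n : ℕ) → (Fin n → Fin N) → ℝ
  | 0, _ => 0
  | n + 1, w => S.u (w 0) + S.c * hw n (Fin.tail w)

def chi : ℝ := - Real.log S.b

theorem hb0 : 0 < S.b := S.hc.trans S.hcb
theorem hN0 (S : Fam N) : 0 < N := lt_of_lt_of_le two_pos S.hN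
theorem hA0 : 0 < S.A := by
  obtain ⟨z, hz⟩ := S.hKne
  exact (S.hF z hz).pos
theorem chi_pos : 0 < S.chi := neg_pos.2 (Real.log_neg S.hb0 S.hb)
theorem hc1 : S.c < 1 := S.hcb.trans S.hb
theorem ratio_lt : S.c / S.b < 1 := (div_lt_one S.hb0).2 S.hcb
theorem ratio_pos : 0 < S.c / S.b := div_pos S.hc S.hb0

theorem zw_cons (n : ℕ) (i : Fin N) (w : Fin n → Fin N) (z : ℝ) :
    S.zw (n + 1) (Fin.cons i w) z = S.zw n w (S.g i z) := by
  simp [zw]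

theorem tw_cons (n : ℕ) (i : Fin N) (w : Fin n → Fin N) (z : ℝ) :
    S.tw (n + 1) (Fin.cons i w) z = (S.v i - z * S.u i) + S.b * S.tw n w (S.g i z) := by
  simp [tw]

theorem zw_mem (n : ℕ) (w : Fin n → Fin N) {z : ℝ} (hz : z ∈ S.K) : S.zw n w z ∈ S.K := by
  induction n generalizing z with
  | zero => exact hz
  | succ n ih => exact ih _ (S.hgK _ z hz)

theorem zw_affine (n : ℕ) (w : Fin n → Fin N) (z : ℝ) :
    S.zw n w z = (S.c / S.b) ^ n * z + S.zw n w 0 := by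
  induction n generalizing z with
  | zero => simp [zw]
  | succ n ih =>
    simp only [zw]
    rw [ih _ (S.g (w 0) z), ih _ (S.g (w 0) 0)]
    unfold g; ring

theorem zw_sub (n : ℕ) (w : Fin n → Fin N) (z z' : ℝ) :
    S.zw n w z - S.zw n w z' = (S.c / S.b) ^ n * (z - z') := by
  rw [S.zw_affine n w z, S.zw_affine n w z']; ring

theorem tw_affine (n : ℕ) (w : Fin n → Fin N) (z : ℝ) :
    S.tw n w z = S.tw n w 0 - z * S.hw n w := by
  induction n generalizing z with
  | zero => simp [tw, hw]
  | succ n ih =>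
    simp only [tw, hw]
    rw [ih _ (S.g (w 0) z), ih _ (S.g (w 0) 0)]
    unfold g
    have := S.hb0.ne'
    field_simp; ring

theorem hw_le (n : ℕ) (w : Fin n → Fin N) : |S.hw n w| ≤ S.A := by
  induction n with
  | zero => simp [hw, S.hA0.le]
  | succ n ih =>
    simp only [hw]
    have h1 := S.hu (w 0)
    have h2 := ih (Fin.tail w)
    calc _ ≤ |S.u (w 0)| + |S.c * S.hw n (Fin.tail w)| := abs_add_le _ _
      _ ≤ S.A * (1 - S.c) + S.c * S.A := by
          rw [abs_mul, abs_of_pos S.hc]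
          have := mul_le_mul_of_nonneg_left h2 S.hc.le
          linarith
      _ = S.A := by ring

theorem tw_le (n : ℕ) (w : Fin n → Fin N) {z : ℝ} (hz : z ∈ S.K) : |S.tw n w z| ≤ S.A := by
  induction n generalizing z with
  | zero => simp [tw, S.hA0.le]
  | succ n ih =>
    simp only [tw]
    have h1 := S.ht (w 0) z hz
    have h2 := ih (Fin.tail w) (S.hgK (w 0) z hz)
    calc _ ≤ |S.v (w 0) - z * S.u (w 0)| + |S.b * S.tw n (Fin.tail w) (S.g (w 0) z)| :=
          abs_add_le _ _
      _ ≤ S.A * (1 - S.b) + S.b * S.A := by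
          rw [abs_mul, abs_of_pos S.hb0]
          have := mul_le_mul_of_nonneg_left h2 S.hb0.le
          unfold g at *
          linarith
      _ = S.A := by ring

/-- the cylinder cdf -/
def sig (n : ℕ) (z : ℝ) (w : Fin n → Fin N) : ℝ → ℝ :=
  aff (S.b ^ n) (S.tw n w z) (S.F (S.zw n w z))

theorem bpow_pos (n : ℕ) : 0 < S.b ^ n := pow_pos S.hb0 n
theorem bpow_le (n : ℕ) : S.b ^ n ≤ 1 := pow_le_one₀ S.hb0.le S.hb.le

theorem sig_cdf (n : ℕ) {z : ℝ} (hz : z ∈ S.K) (w : Fin n → Fin N) :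
    IsCdf (2 * S.A) (S.sig n z w) := by
  refine ((S.hF _ (S.zw_mem n w hz)).aff (S.bpow_pos n) _).enlarge ?_
  have h1 := S.tw_le n w hz
  have h2 := mul_le_mul_of_nonneg_right (S.bpow_le n) S.hA0.le
  linarith

theorem self_sim (n : ℕ) {z : ℝ} (hz : z ∈ S.K) (x : ℝ) :
    S.F z x = wavg n (fun w => S.sig n z w x) := by
  induction n generalizing z x with
  | zero => rw [wavg_zero]; simp [sig, aff, tw, zw]
  | succ n ih =>
    rw [wavg_succ, S.hself z hz]
    congr 1
    apply Finset.sum_congr rfl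
    intro i _
    rw [ih (S.hgK i z hz)]
    congr 1
    funext w
    unfold sig aff
    rw [zw_cons, tw_cons]
    unfold g
    congr 1
    have := S.hb0.ne'
    field_simp
    ring

theorem self_sim' (n : ℕ) {z : ℝ} (hz : z ∈ S.K) :
    S.F z = fun x => ∑ w : Fin n → Fin N, (1 / (N : ℝ) ^ n) * S.sig n z w x := by
  funext x
  rw [S.self_sim n hz, wavg_eq_sum]

/-- transfer operator -/
def Pop (n : ℕ) (f : ℝ → ℝ) (z : ℝ) : ℝ := wavg n (fun w => f (S.zw n w z))

theorem Pop_zero (f : ℝ → ℝ) (z : ℝ) : S.Pop 0 f z = f z := by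
  unfold Pop; rw [wavg_zero]; rfl

theorem Pop_succ (n : ℕ) (f : ℝ → ℝ) (z : ℝ) :
    S.Pop (n + 1) f z = (∑ i, S.Pop n f (S.g i z)) / N := by
  unfold Pop; rw [wavg_succ]; simp_rw [zw_cons]

theorem Pop_add (n m : ℕ) (f : ℝ → ℝ) (z : ℝ) :
    S.Pop (n + m) f z = S.Pop n (S.Pop m f) z := by
  induction n generalizing z with
  | zero => rw [zero_add, Pop_zero]
  | succ n ih => rw [show n + 1 + m = (n + m) + 1 by ring, Pop_succ, Pop_succ]; simp_rw [ih]

theorem Pop_mono (n : ℕ) {f g : ℝ → ℝ} (h : ∀ z ∈ S.K, f z ≤ g z) {z : ℝ} (hz : z ∈ S.K) :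
    S.Pop n f z ≤ S.Pop n g z := wavg_mono fun w => h _ (S.zw_mem n w hz)

theorem Pop_const (n : ℕ) (a z : ℝ) : S.Pop n (fun _ => a) z = a := wavg_const S.hN0 a

theorem Pop_sum {ι : Type*} (s : Finset ι) (n : ℕ) (f : ι → ℝ → ℝ) (z : ℝ) :
    S.Pop n (fun z => ∑ i ∈ s, f i z) z = ∑ i ∈ s, S.Pop n (f i) z := wavg_sum s _

theorem exists_ergodic (f : ℝ → ℝ) (hf : ∀ ε > 0, ∃ δ > 0, ∀ z ∈ S.K, ∀ z' ∈ S.K,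
    |z - z'| ≤ δ → |f z - f z'| ≤ ε) :
    ∃ β : ℝ, ∀ ε > 0, ∃ l0 : ℕ, ∀ l ≥ l0, ∀ z ∈ S.K, |S.Pop l f z - β| ≤ ε := by
  have hosc : ∀ ε > 0, ∃ l0 : ℕ, ∀ z ∈ S.K, ∀ z' ∈ S.K, |S.Pop l0 f z - S.Pop l0 f z'| ≤ ε := by
    intro ε hε
    obtain ⟨δ, hδ, h⟩ := hf ε hε
    obtain ⟨l0, hl0⟩ := exists_pow_lt_of_lt_one (y := S.c / S.b) (x := δ / (2 * S.A))
      (div_pos hδ (by linarith [S.hA0])) S.ratio_lt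
    refine ⟨l0, fun z hz z' hz' => ?_⟩
    have hpt : ∀ w, |f (S.zw l0 w z) - f (S.zw l0 w z')| ≤ ε := by
      intro w
      apply h _ (S.zw_mem _ _ hz) _ (S.zw_mem _ _ hz')
      rw [zw_sub, abs_mul, abs_of_pos (pow_pos S.ratio_pos _)]
      have h1 : |z - z'| ≤ 2 * S.A := by
        have := abs_sub z z'
        linarith [S.hKA z hz, S.hKA z' hz']
      have hA := S.hA0
      rw [lt_div_iff₀ (by positivity)] at hl0
      have := mul_le_mul_of_nonneg_left h1 (pow_pos S.ratio_pos l0).le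
      linarith
    unfold Pop
    rw [← wavg_sub, abs_le]
    constructor
    · rw [← wavg_const (n := l0) S.hN0 (-ε)]
      exact wavg_mono fun w => (abs_le.1 (hpt w)).1
    · rw [← wavg_const (n := l0) S.hN0 ε]
      exact wavg_mono fun w => (abs_le.1 (hpt w)).2
  have hstab : ∀ ε > 0, ∃ l0 : ℕ, ∀ l ≥ l0, ∀ z ∈ S.K, ∀ z' ∈ S.K,
      |S.Pop l f z - S.Pop l0 f z'| ≤ ε := by
    intro ε hε
    obtain ⟨l0, h⟩ := hosc ε hε
    refine ⟨l0, fun l hl z hz z' hz' => ?_⟩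
    obtain ⟨m, rfl⟩ := Nat.exists_eq_add_of_le hl
    rw [add_comm, Pop_add, abs_le]
    have hl : S.Pop l0 f z' - ε ≤ S.Pop m (S.Pop l0 f) z := by
      rw [← S.Pop_const m (S.Pop l0 f z' - ε) z]
      exact S.Pop_mono m (fun y hy => by linarith [(abs_le.1 (h y hy z' hz')).1]) hz
    have hu : S.Pop m (S.Pop l0 f) z ≤ S.Pop l0 f z' + ε := by
      rw [← S.Pop_const m (S.Pop l0 f z' + ε) z]
      exact S.Pop_mono m (fun y hy => by linarith [(abs_le.1 (h y hy z' hz')).2]) hz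
    constructor <;> linarith
  obtain ⟨z0, hz0⟩ := S.hKne
  have hc : CauchySeq (fun l => S.Pop l f z0) := by
    rw [Metric.cauchySeq_iff']
    intro ε hε
    obtain ⟨l0, h⟩ := hstab (ε / 2) (half_pos hε)
    refine ⟨l0, fun l hl => ?_⟩
    rw [Real.dist_eq]
    have := h l hl z0 hz0 z0 hz0
    linarith
  obtain ⟨β, hβ⟩ := cauchySeq_tendsto_of_complete hc
  refine ⟨β, fun ε hε => ?_⟩
  obtain ⟨l0, h⟩ := hstab (ε / 2) (half_pos hε)
  have h0 : |β - S.Pop l0 f z0| ≤ ε / 2 := by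
    have ht : Tendsto (fun l => |S.Pop l f z0 - S.Pop l0 f z0|) atTop
        (𝓝 |β - S.Pop l0 f z0|) := (hβ.sub_const _).abs
    refine le_of_tendsto ht ?_
    filter_upwards [eventually_ge_atTop l0] with l hl
    exact h l hl z0 hz0 z0 hz0
  refine ⟨l0, fun l hl z hz => ?_⟩
  have h1 := h l hl z hz z0 hz0
  rw [abs_le] at *
  constructor <;> linarith [h0.1, h0.2, h1.1, h1.2]

/-- window entropy -/
def win (k : ℕ) (z : ℝ) : ℝ := Dint (k * S.chi) ((k + 1 : ℕ) * S.chi) (S.F z)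

theorem kchi_le {j k : ℕ} (h : j ≤ k) : (j : ℝ) * S.chi ≤ k * S.chi :=
  mul_le_mul_of_nonneg_right (by exact_mod_cast h) S.chi_pos.le

theorem win_modulus (k : ℕ) : ∀ ε > 0, ∃ δ > 0, ∀ z ∈ S.K, ∀ z' ∈ S.K,
    |z - z'| ≤ δ → |S.win k z - S.win k z'| ≤ ε := by
  intro ε hε
  obtain ⟨δ, hδ, h⟩ := Dint_modulus (A := S.A) (S.kchi_le (Nat.le_succ k)) hε
  refine ⟨δ / S.A, div_pos hδ S.hA0, fun z hz z' hz' hd => ?_⟩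
  apply h _ _ (S.hF z hz) (S.hF z' hz')
  refine (S.hlip z hz z' hz').trans ?_
  rw [le_div_iff₀ S.hA0] at hd
  linarith

def beta (k : ℕ) : ℝ := (S.exists_ergodic (S.win k) (S.win_modulus k)).choose

theorem beta_spec (k : ℕ) : ∀ ε > 0, ∃ l0 : ℕ, ∀ l ≥ l0, ∀ z ∈ S.K,
    |S.Pop l (S.win k) z - S.beta k| ≤ ε :=
  (S.exists_ergodic (S.win k) (S.win_modulus k)).choose_spec

/-- uniform over finitely many `k` -/
theorem beta_spec_fin (m : ℕ) : ∀ ε > 0, ∃ l0 : ℕ, ∀ k < m, ∀ l ≥ l0, ∀ z ∈ S.K,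
    |S.Pop l (S.win k) z - S.beta k| ≤ ε := by
  intro ε hε
  choose l0 h using fun k => S.beta_spec k ε hε
  refine ⟨(Finset.range m).sup l0, fun k hk l hl z hz => h k l ?_ z hz⟩
  exact (Finset.le_sup (f := l0) (Finset.mem_range.2 hk)).trans hl

theorem log_bpow (n : ℕ) : Real.log (S.b ^ n) = -(n * S.chi) := by
  rw [Real.log_pow]; unfold chi; ring

theorem Dint_sig (n : ℕ) (z : ℝ) (w : Fin n → Fin N) (T1 T2 : ℝ) :
    Dint T1 T2 (S.sig n z w) = Dint (T1 - n * S.chi) (T2 - n * S.chi) (S.F (S.zw n w z)) := by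
  unfold sig
  rw [Dint_aff _ (S.bpow_pos n), log_bpow]
  simp only [← sub_eq_add_neg]

theorem Dint_ge_wavg (n : ℕ) {z : ℝ} (hz : z ∈ S.K) {T1 T2 : ℝ} (hT : T1 ≤ T2) :
    wavg n (fun w => Dint T1 T2 (S.sig n z w)) ≤ Dint T1 T2 (S.F z) := by
  rw [S.self_sim' n hz, wavg_eq_sum]
  exact Dint_concave (A := 2 * S.A) Finset.univ (fun _ _ => by positivity) (wavg_weight S.hN0)
    (fun w _ => S.sig_cdf n hz w) hT

/-- `D((k+n)χ, (k'+n)χ)F_z ≥ P^n D(kχ,k'χ)F (z)` -/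
theorem Dint_ge_Pop (n : ℕ) {j k : ℕ} (hjk : j ≤ k) {z : ℝ} (hz : z ∈ S.K) :
    S.Pop n (fun z => Dint (j * S.chi) (k * S.chi) (S.F z)) z ≤
      Dint ((n + j : ℕ) * S.chi) ((n + k : ℕ) * S.chi) (S.F z) := by
  refine le_trans (le_of_eq ?_) (S.Dint_ge_wavg n hz (S.kchi_le (by omega)))
  unfold Pop
  congr 1
  funext w
  rw [Dint_sig]
  have e : ∀ i : ℕ, ((n + i : ℕ) : ℝ) * S.chi - n * S.chi = i * S.chi := by
    intro i; push_cast; ring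
  rw [e, e]

theorem beta_succ (k : ℕ) : S.beta k ≤ S.beta (k + 1) := by
  apply le_of_forall_pos_le_add
  intro ε hε
  obtain ⟨z0, hz0⟩ := S.hKne
  obtain ⟨l1, h1⟩ := S.beta_spec k (ε / 2) (half_pos hε)
  obtain ⟨l2, h2⟩ := S.beta_spec (k + 1) (ε / 2) (half_pos hε)
  set l := max l1 l2
  have a1 := h1 (l + 1) (by have := le_max_left l1 l2; omega) z0 hz0
  have a2 := h2 l (le_max_right l1 l2) z0 hz0
  have a3 : S.Pop (l + 1) (S.win k) z0 ≤ S.Pop l (S.win (k + 1)) z0 := by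
    rw [Pop_add]
    apply S.Pop_mono l _ hz0
    intro z hz
    have := S.Dint_ge_Pop 1 (Nat.le_succ k) hz
    rw [add_comm 1 k, Nat.add_comm 1 k.succ] at this
    exact this
  rw [abs_le] at a1 a2
  linarith [a1.1, a2.2]

theorem beta_mono : Monotone S.beta := monotone_nat_of_le_succ S.beta_succ

theorem win_le (k : ℕ) {z : ℝ} (hz : z ∈ S.K) : S.win k z ≤ S.chi * Real.log 2 := by
  have := Dint_le (S.hF z hz) (S.kchi_le (Nat.le_succ k))
  unfold win
  refine this.trans (le_of_eq ?_)
  push_cast; ring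

theorem beta_le (k : ℕ) : S.beta k ≤ S.chi * Real.log 2 := by
  apply le_of_forall_pos_le_add
  intro ε hε
  obtain ⟨z0, hz0⟩ := S.hKne
  obtain ⟨l1, h1⟩ := S.beta_spec k ε hε
  have a1 := h1 l1 le_rfl z0 hz0
  have a2 : S.Pop l1 (S.win k) z0 ≤ S.chi * Real.log 2 := by
    rw [← S.Pop_const l1 (S.chi * Real.log 2) z0]
    exact S.Pop_mono _ (fun z hz => S.win_le k hz) hz0
  rw [abs_le] at a1
  linarith [a1.1]

def Lam : ℝ := ⨆ k, S.beta k

theorem beta_bdd : BddAbove (range S.beta) := ⟨_, by rintro _ ⟨k, rfl⟩; exact S.beta_le k⟩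

theorem beta_le_Lam (k : ℕ) : S.beta k ≤ S.Lam := le_ciSup S.beta_bdd k

theorem exists_beta_gt {η : ℝ} (hη : 0 < η) : ∃ k0, ∀ k ≥ k0, S.Lam - η ≤ S.beta k := by
  obtain ⟨k0, h⟩ := exists_lt_of_lt_ciSup (show S.Lam - η < ⨆ k, S.beta k by
    unfold Lam; linarith)
  exact ⟨k0, fun k hk => h.le.trans (S.beta_mono hk)⟩

theorem Dint_sum_win {z : ℝ} (hz : z ∈ S.K) (j m : ℕ) :
    Dint (j * S.chi) ((j + m : ℕ) * S.chi) (S.F z) = ∑ k ∈ Finset.range m, S.win (j + k) z := by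
  induction m with
  | zero => simp [Dint]
  | succ m ih =>
    rw [Finset.sum_range_succ, ← ih]
    exact (Dint_add (S.hF z hz) _ _ _).symm

end Fam
end
end

section
open MeasureTheory Filter Set Topology
open scoped ENNReal
noncomputable section

/-! ### Finite entropy combinatorics -/

section comb
variable {Ω γ : Type*} [Fintype Ω] [DecidableEq γ]

def cellF (a : Ω → γ) (w : Ω) : Finset Ω := Finset.univ.filter (fun w' => a w' = a w)

def cn (a : Ω → γ) (w : Ω) : ℝ := ((cellF a w).card : ℝ)

def uavg (f : Ω → ℝ) : ℝ := (∑ w, f w) / (Fintype.card Ω : ℝ)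

def Hent (a : Ω → γ) : ℝ := uavg (fun w => Real.log ((Fintype.card Ω : ℝ) / cn a w))

/-- average over coupled pairs -/
def pavg (a : Ω → γ) (G : Ω → Ω → ℝ) : ℝ :=
  uavg (fun w => (∑ w' ∈ cellF a w, G w w') / cn a w)

theorem mem_cellF {a : Ω → γ} {w w' : Ω} : w' ∈ cellF a w ↔ a w' = a w := by simp [cellF]

theorem cn_pos (a : Ω → γ) (w : Ω) : 0 < cn a w := by
  unfold cn; exact_mod_cast Finset.card_pos.2 ⟨w, mem_cellF.2 rfl⟩

theorem cn_congr {a : Ω → γ} {w w' : Ω} (h : a w' = a w) : cn a w' = cn a w := by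
  unfold cn cellF; rw [h]

theorem uavg_mono {f g : Ω → ℝ} (h : ∀ w, f w ≤ g w) : uavg f ≤ uavg g :=
  div_le_div_of_nonneg_right (Finset.sum_le_sum fun w _ => h w) (by positivity)

theorem uavg_add (f g : Ω → ℝ) : uavg (fun w => f w + g w) = uavg f + uavg g := by
  unfold uavg; rw [Finset.sum_add_distrib, add_div]

theorem uavg_sub (f g : Ω → ℝ) : uavg (fun w => f w - g w) = uavg f - uavg g := by
  unfold uavg; rw [Finset.sum_sub_distrib, sub_div]

theorem uavg_mul (k : ℝ) (f : Ω → ℝ) : uavg (fun w => k * f w) = k * uavg f := by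
  unfold uavg; rw [← Finset.mul_sum, mul_div_assoc]

theorem uavg_const [Nonempty Ω] (k : ℝ) : uavg (fun _ : Ω => k) = k := by
  unfold uavg; simp

theorem uavg_nonneg {f : Ω → ℝ} (h : ∀ w, 0 ≤ f w) : 0 ≤ uavg f :=
  div_nonneg (Finset.sum_nonneg fun w _ => h w) (by positivity)

theorem sum_inv_cn_le (f : Ω → γ) (s : Finset Ω) :
    ∑ w ∈ s, 1 / cn f w ≤ ((s.image f).card : ℝ) := by
  rw [← Finset.sum_fiberwise_of_maps_to (fun w hw => Finset.mem_image_of_mem f hw)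
    (fun w => 1 / cn f w)]
  rw [Finset.card_eq_sum_ones, Nat.cast_sum]
  apply Finset.sum_le_sum
  intro y hy
  obtain ⟨w0, hw0, rfl⟩ := Finset.mem_image.1 hy
  have h1 : ∀ w ∈ s.filter (fun w => f w = f w0), 1 / cn f w = 1 / cn f w0 := by
    intro w hw; rw [cn_congr (Finset.mem_filter.1 hw).2]
  rw [Finset.sum_congr rfl h1, Finset.sum_const, nsmul_eq_mul, mul_one_div,
    div_le_iff₀ (cn_pos _ _)]
  simp only [Nat.cast_one, one_mul]
  unfold cn
  exact_mod_cast Finset.card_le_card fun w hw =>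
    mem_cellF.2 (Finset.mem_filter.1 hw).2

/-- swapping in coupled sums -/
theorem sum_cell_swap (a : Ω → γ) (G : Ω → Ω → ℝ) :
    ∑ w, ∑ w' ∈ cellF a w, G w w' = ∑ w', ∑ w ∈ cellF a w', G w w' := by
  apply Finset.sum_comm'
  intro w w'
  simp only [Finset.mem_univ, mem_cellF, true_and, and_true]
  exact eq_comm

theorem pavg_fst (a : Ω → γ) (f : Ω → ℝ) : pavg a (fun w _ => f w) = uavg f := by
  unfold pavg
  congr 1
  funext w
  rw [Finset.sum_const, nsmul_eq_mul]
  have := (cn_pos a w).ne'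
  unfold cn at *
  field_simp

theorem pavg_swap (a : Ω → γ) (G : Ω → Ω → ℝ) : pavg a (fun w w' => G w' w) = pavg a G := by
  unfold pavg uavg
  congr 1
  simp_rw [Finset.sum_div]
  rw [sum_cell_swap a (fun w w' => G w' w / cn a w)]
  apply Finset.sum_congr rfl
  intro w _
  apply Finset.sum_congr rfl
  intro w' hw'
  rw [cn_congr (mem_cellF.1 hw')]

theorem pavg_snd (a : Ω → γ) (f : Ω → ℝ) : pavg a (fun _ w => f w) = uavg f := by
  rw [← pavg_fst a f]; exact pavg_swap a (fun w _ => f w)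

theorem pavg_mono (a : Ω → γ) {G G' : Ω → Ω → ℝ} (h : ∀ w w', a w' = a w → G w w' ≤ G' w w') :
    pavg a G ≤ pavg a G' :=
  uavg_mono fun w => div_le_div_of_nonneg_right
    (Finset.sum_le_sum fun w' hw' => h w w' (mem_cellF.1 hw')) (cn_pos a w).le

theorem pavg_add (a : Ω → γ) (G G' : Ω → Ω → ℝ) :
    pavg a (fun w w' => G w w' + G' w w') = pavg a G + pavg a G' := by
  unfold pavg
  rw [← uavg_add]
  congr 1; funext w
  rw [Finset.sum_add_distrib, add_div]

theorem pavg_mul (a : Ω → γ) (k : ℝ) (G : Ω → Ω → ℝ) :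
    pavg a (fun w w' => k * G w w') = k * pavg a G := by
  unfold pavg
  rw [← uavg_mul]
  congr 1; funext w
  rw [← Finset.mul_sum, mul_div_assoc]

/-- Fano type inequality. -/
theorem fano [Nonempty Ω] (a a' : Ω → γ) (near : γ → γ → Prop) [DecidableRel near]
    (hsymm : ∀ x y, near x y → near y x) {m1 R1 : ℝ} (hm1 : 1 ≤ m1) (hR1 : 1 ≤ R1)
    (h1 : ∀ w, (((Finset.univ.filter (fun w' => a w' = a w ∧ near (a' w') (a' w))).image a').card
      : ℝ) ≤ m1)
    (h2 : ∀ w, (((cellF a w).image a').card : ℝ) ≤ R1) :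
    Hent a' - Hent a ≤ 2 + Real.log 2 + Real.log m1 +
      2 * Real.log R1 * pavg a (fun w w' => if near (a' w') (a' w) then 0 else 1) := by
  set f : Ω → γ × γ := fun w => (a w, a' w) with hf
  set Nr : Ω → ℝ := fun w => ((cellF a w).filter (fun w' => near (a' w') (a' w))).card with hNr
  have hNr0 : ∀ w, 0 ≤ Nr w := fun w => by simp [hNr]
  have hfa' : ∀ w, cn f w ≤ cn a' w := fun w => by
    unfold cn
    exact_mod_cast Finset.card_le_card fun w' hw' => by
      rw [mem_cellF] at *; exact (Prod.ext_iff.1 hw').2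
  have hNrle : ∀ w, Nr w ≤ cn a w := fun w => by
    unfold cn; simp only [hNr]
    exact_mod_cast Finset.card_le_card (Finset.filter_subset _ _)
  have hfar : ∀ w, (∑ w' ∈ cellF a w, (if near (a' w') (a' w) then (0:ℝ) else 1)) / cn a w =
      1 - Nr w / cn a w := by
    intro w
    have e : ∀ w', (if near (a' w') (a' w) then (0:ℝ) else 1) =
      1 - (if near (a' w') (a' w) then (1:ℝ) else 0) := by intro w'; split_ifs <;> norm_num
    simp_rw [e]
    rw [Finset.sum_sub_distrib, Finset.sum_const, nsmul_eq_mul, mul_one, Finset.sum_boole,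
      sub_div]
    congr 1
    exact div_self (cn_pos a w).ne'

  have hpt : ∀ w, Real.log ((Fintype.card Ω : ℝ) / cn a' w) -
      Real.log ((Fintype.card Ω : ℝ) / cn a w) ≤
      (1 / m1) * (Nr w / cn f w) + (1 / R1) * (cn a w / cn f w) + (Real.log 2 + Real.log m1) +
      2 * Real.log R1 * (1 - Nr w / cn a w) := by
    intro w
    have c1 := cn_pos a w
    have c2 := cn_pos a' w
    have c3 := cn_pos f w
    have hcard : (0:ℝ) < Fintype.card Ω := by exact_mod_cast Fintype.card_pos
    have hl : Real.log ((Fintype.card Ω : ℝ) / cn a' w) -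
      Real.log ((Fintype.card Ω : ℝ) / cn a w) ≤ Real.log (cn a w / cn f w) := by
      rw [Real.log_div hcard.ne' c2.ne', Real.log_div hcard.ne' c1.ne',
        Real.log_div c1.ne' c3.ne']
      have := Real.log_le_log c3 (hfa' w)
      linarith
    refine hl.trans ?_
    have hlR : 0 ≤ Real.log R1 := Real.log_nonneg hR1
    have hlm : 0 ≤ Real.log m1 := Real.log_nonneg hm1
    have l2 := Real.log_pos one_lt_two
    have q1 : 0 ≤ (1 / m1) * (Nr w / cn f w) := by have := hNr0 w; positivity
    have q2 : 0 ≤ (1 / R1) * (cn a w / cn f w) := by positivity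
    have q3 : Nr w / cn a w ≤ 1 := (div_le_one c1).2 (hNrle w)
    have q4 : 0 ≤ 2 * Real.log R1 * (1 - Nr w / cn a w) :=
      mul_nonneg (by positivity) (by linarith)
    rcases le_total (cn a w) (2 * Nr w) with h | h
    · have hNpos : 0 < Nr w := by linarith
      have : Real.log (cn a w / cn f w) ≤ Real.log (2 * (Nr w / cn f w)) := by
        apply Real.log_le_log (by positivity)
        rw [← mul_div_assoc]; gcongr
      rw [Real.log_mul (by norm_num) (by positivity)] at this
      have h3 := log_le_tangent (x := Nr w / cn f w) (M := m1) (by positivity) (by positivity)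
      have e3 : Nr w / cn f w / m1 = 1 / m1 * (Nr w / cn f w) := by ring
      rw [e3] at h3
      linarith
    · have h3 := log_le_tangent (x := cn a w / cn f w) (M := R1) (by positivity) (by positivity)
      have e3 : cn a w / cn f w / R1 = 1 / R1 * (cn a w / cn f w) := by ring
      rw [e3] at h3
      have h4 : Nr w / cn a w ≤ 1 / 2 := by rw [div_le_iff₀ c1]; linarith
      nlinarith
  have hA1 : uavg (fun w => Nr w / cn f w) ≤ m1 := by
    unfold uavg
    have hcard : (0:ℝ) < Fintype.card Ω := by exact_mod_cast Fintype.card_pos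
    rw [div_le_iff₀ hcard]
    have e1 : ∀ w, Nr w / cn f w = ∑ w' ∈ cellF a w,
        (if near (a' w') (a' w) then 1 / cn f w else 0) := by
      intro w
      rw [← Finset.sum_filter, Finset.sum_const, nsmul_eq_mul, mul_one_div]
    simp_rw [e1]
    rw [sum_cell_swap a (fun w w' => if near (a' w') (a' w) then 1 / cn f w else 0)]
    have e2 : ∀ w', ∑ w ∈ cellF a w', (if near (a' w') (a' w) then 1 / cn f w else 0) ≤ m1 := by
      intro w'
      rw [← Finset.sum_filter]
      refine (sum_inv_cn_le f _).trans ?_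
      refine le_trans ?_ (h1 w')
      norm_cast
      have hsub : ((cellF a w').filter (fun w => near (a' w') (a' w))).image f ⊆
          ((Finset.univ.filter (fun w => a w = a w' ∧ near (a' w) (a' w'))).image a').image
            (fun y => (a w', y)) := by
        intro y hy
        obtain ⟨w, hw, rfl⟩ := Finset.mem_image.1 hy
        obtain ⟨hw1, hw2⟩ := Finset.mem_filter.1 hw
        rw [mem_cellF] at hw1
        refine Finset.mem_image.2 ⟨a' w, Finset.mem_image.2 ⟨w, ?_, rfl⟩, ?_⟩
        · exact Finset.mem_filter.2 ⟨Finset.mem_univ _, hw1, hsymm _ _ hw2⟩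
        · simp [hf, hw1]
      exact (Finset.card_le_card hsub).trans Finset.card_image_le
    calc _ ≤ ∑ _w' : Ω, m1 := Finset.sum_le_sum fun w' _ => e2 w'
      _ = _ := by simp [mul_comm]
  have hA2 : uavg (fun w => cn a w / cn f w) ≤ R1 := by
    unfold uavg
    have hcard : (0:ℝ) < Fintype.card Ω := by exact_mod_cast Fintype.card_pos
    rw [div_le_iff₀ hcard]
    have e1 : ∀ w, cn a w / cn f w = ∑ w' ∈ cellF a w, 1 / cn f w := by
      intro w
      rw [Finset.sum_const, nsmul_eq_mul, mul_one_div]; rfl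
    simp_rw [e1]
    rw [sum_cell_swap a (fun w w' => 1 / cn f w)]
    have e2 : ∀ w', ∑ w ∈ cellF a w', 1 / cn f w ≤ R1 := by
      intro w'
      refine (sum_inv_cn_le f _).trans ?_
      refine le_trans ?_ (h2 w')
      norm_cast
      have hsub : (cellF a w').image f ⊆ ((cellF a w').image a').image (fun y => (a w', y)) := by
        intro y hy
        obtain ⟨w, hw, rfl⟩ := Finset.mem_image.1 hy
        refine Finset.mem_image.2 ⟨a' w, Finset.mem_image.2 ⟨w, hw, rfl⟩, ?_⟩
        rw [mem_cellF] at hw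
        simp [hf, hw]
      exact (Finset.card_le_card hsub).trans Finset.card_image_le
    calc _ ≤ ∑ _w' : Ω, R1 := Finset.sum_le_sum fun w' _ => e2 w'
      _ = _ := by simp [mul_comm]
  unfold Hent
  rw [← uavg_sub]
  refine (uavg_mono hpt).trans ?_
  rw [uavg_add, uavg_add, uavg_add, uavg_mul, uavg_mul, uavg_mul, uavg_const]
  unfold pavg
  simp_rw [hfar]
  have b1 : 1 / m1 * uavg (fun w => Nr w / cn f w) ≤ 1 := by
    rw [one_div_mul_eq_div, div_le_one (by linarith)]; exact hA1
  have b2 : 1 / R1 * uavg (fun w => cn a w / cn f w) ≤ 1 := by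
    rw [one_div_mul_eq_div, div_le_one (by linarith)]; exact hA2
  linarith

/-- injective partition has full entropy -/
theorem Hent_inj (a : Ω → γ) (h : Function.Injective a) :
    Hent a = uavg (fun _ : Ω => Real.log (Fintype.card Ω)) := by
  unfold Hent
  congr 1; funext w
  have : cellF a w = {w} := by
    ext w'; rw [mem_cellF, Finset.mem_singleton]; exact h.eq_iff
  unfold cn; rw [this]; simp

/-- Entropy of a partition adapted to scale `r` is bounded by `Phi`. -/
theorem Hent_le_Phi [Nonempty Ω] {A r m0 : ℝ} (a : Ω → γ) (σ : Ω → ℝ → ℝ)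
    (hσ : ∀ w, IsCdf A (σ w)) (hr : 0 < r) (hm0 : 0 < m0)
    (h : ∀ x, ∑ w ∈ Finset.univ.filter (fun w => pw (σ w) r x ≠ 0), 1 / cn a w ≤ m0) :
    Hent a ≤ Phi r (fun x => ∑ w, (1 / (Fintype.card Ω : ℝ)) * σ w x) + Real.log m0 + 1 := by
  have hcard : (0:ℝ) < Fintype.card Ω := by exact_mod_cast Fintype.card_pos
  set n : ℝ := (Fintype.card Ω : ℝ) with hn
  have hsum : ∑ _w : Ω, (1 / n) = 1 := by simp [hn]
  set F : ℝ → ℝ := fun x => ∑ w, (1 / n) * σ w x with hF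
  have hFc : IsCdf A F := IsCdf.mix Finset.univ (fun _ _ => by positivity) hsum (fun w _ => hσ w)
  have hpw : ∀ x, pw F r x = ∑ w, (1 / n) * pw (σ w) r x := fun x => pw_mix _ _ _ _ _
  have hpt : ∀ x, ∑ w, ((1 / n) * Real.log (n / cn a w)) * pw (σ w) r x ≤
      Real.negMulLog (pw F r x) + (Real.log m0 + 1) * pw F r x := by
    intro x
    have hp0 := hFc.pw_nonneg hr.le x
    have hw0 : ∀ w, 0 ≤ pw (σ w) r x := fun w => (hσ w).pw_nonneg hr.le x
    rcases hp0.eq_or_lt with h0 | h0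
    · have hz : ∀ w, pw (σ w) r x = 0 := by
        intro w
        have := (Finset.sum_eq_zero_iff_of_nonneg (fun w _ =>
          mul_nonneg (by positivity : (0:ℝ) ≤ 1 / n) (hw0 w))).1 ((hpw x).symm.trans h0.symm) w
          (Finset.mem_univ _)
        rcases mul_eq_zero.1 this with h1 | h1
        · exact absurd h1 (by positivity)
        · exact h1
      rw [← h0]
      simp [hz]
    · set p := pw F r x with hp
      have hterm : ∀ w, ((1 / n) * Real.log (n / cn a w)) * pw (σ w) r x ≤
          (p / m0) * (if pw (σ w) r x ≠ 0 then 1 / cn a w else 0) +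
          (Real.log m0 - Real.log p) * ((1 / n) * pw (σ w) r x) := by
        intro w
        have c1 := cn_pos a w
        by_cases hz : pw (σ w) r x = 0
        · simp [hz]
        · rw [if_pos hz]
          have h1 := log_le_tangent (x := n * p / cn a w) (M := m0) (by positivity) hm0
          have h2 : Real.log (n * p / cn a w) = Real.log (n / cn a w) + Real.log p := by
            rw [mul_div_right_comm, Real.log_mul (by positivity) h0.ne']
          rw [h2] at h1
          have h3 : Real.log (n / cn a w) ≤ n * p / cn a w / m0 + (Real.log m0 - Real.log p) := by
            linarith
          have h4 := mul_le_mul_of_nonneg_left h3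
            (mul_nonneg (by positivity : (0:ℝ) ≤ 1 / n) (hw0 w))
          have h5 : 1 / n * pw (σ w) r x * (n * p / cn a w / m0) ≤ p / m0 * (1 / cn a w) := by
            have e : 1 / n * pw (σ w) r x * (n * p / cn a w / m0) =
              pw (σ w) r x * (p / m0 * (1 / cn a w)) := by field_simp
            rw [e]
            exact mul_le_of_le_one_left (by positivity) ((hσ w).pw_le_one x)
          calc _ = 1 / n * pw (σ w) r x * Real.log (n / cn a w) := by ring
            _ ≤ _ := h4
            _ ≤ _ := by rw [mul_add]; linarith
      refine (Finset.sum_le_sum fun w _ => hterm w).trans ?_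
      rw [Finset.sum_add_distrib, ← Finset.mul_sum, ← Finset.mul_sum, ← hpw, ← Finset.sum_filter]
      have h6 : p / m0 * ∑ w ∈ Finset.univ.filter (fun w => pw (σ w) r x ≠ 0), 1 / cn a w ≤ p := by
        calc _ ≤ p / m0 * m0 := mul_le_mul_of_nonneg_left (h x) (by positivity)
          _ = p := by field_simp
      rw [← hp]
      simp only [Real.negMulLog]
      nlinarith
  have hintg : ∀ w, Integrable (fun x => ((1 / n) * Real.log (n / cn a w)) * pw (σ w) r x) :=
    fun w => (hσ w).integrable_pw.const_mul _
  have hI := integral_mono (integrable_finsetSum Finset.univ fun w _ => hintg w)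
    (iadd (hFc.int_nml r) ((hFc.integrable_pw (r := r)).const_mul (Real.log m0 + 1))) hpt
  rw [integral_finsetSum _ (fun w _ => hintg w), integral_add (hFc.int_nml r)
    ((hFc.integrable_pw (r := r)).const_mul (Real.log m0 + 1)), integral_const_mul,
    hFc.integral_pw] at hI
  simp_rw [integral_const_mul, fun w => (hσ w).integral_pw r] at hI
  rw [← Finset.sum_mul] at hI
  have hH : Hent a = ∑ w, 1 / n * Real.log (n / cn a w) := by
    unfold Hent uavg; rw [← Finset.mul_sum]; ring
  rw [← hH] at hI
  unfold Phi
  have := mul_le_mul_of_nonneg_left hI (inv_nonneg.2 hr.le)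
  have e1 : r⁻¹ * (Hent a * r) = Hent a := by field_simp
  have e2 : r⁻¹ * ((∫ x, Real.negMulLog (pw F r x)) + (Real.log m0 + 1) * r) =
    r⁻¹ * (∫ x, Real.negMulLog (pw F r x)) + (Real.log m0 + 1) := by field_simp
  rw [e1, e2] at this
  linarith

end comb
end
end

section
open MeasureTheory Filter Set Topology
open scoped ENNReal
noncomputable section

/-! ### Quantitative gain for pairs -/

theorem W1_aff (F G : ℝ → ℝ) {ρ : ℝ} (hρ : 0 < ρ) (t : ℝ) :
    W1 (aff ρ t F) (aff ρ t G) = ρ * W1 F G := by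
  unfold W1 aff
  exact integral_comp_aff (fun x => |F x - G x|) hρ t

theorem NN_le_JJ {A : ℝ} {F G : ℝ → ℝ} (hF : IsCdf A F) (hG : IsCdf A G) {r θ : ℝ} (hr : 0 < r)
    (hθ : 0 < θ) (s : ℝ) :
    NN r F s ≤ θ + 6 / θ * JJ r F G + 2 * W1 (fun x => F (x - s)) G / r := by
  rw [← NN_neg]
  have hFs : IsCdf (A + |-s|) (fun x => F (x - s)) := by
    simpa [sub_eq_add_neg] using hF.comp_add (-s)
  have hF' := hF.enlarge (B := A + |-s|) (by linarith [abs_nonneg (-s)])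
  have hG' := hG.enlarge (B := A + |-s|) (by linarith [abs_nonneg (-s)])
  have h1 := abs_pw_sub_le_JJ hF hG hr hθ
  have h2 := integral_abs_pw_sub_le hFs hG' r
  have e : ∀ x, pw F r (x + -s) = pw (fun x => F (x - s)) r x := by
    intro x; unfold pw; congr 2; ring
  have h3 : ∫ x, |pw F r x - pw F r (x + -s)| ≤
      (∫ x, |pw F r x - pw G r x|) + ∫ x, |pw (fun x => F (x - s)) r x - pw G r x| := by
    rw [← integral_add (isub hF'.integrable_pw hG'.integrable_pw).abs
      (isub hFs.integrable_pw hG'.integrable_pw).abs]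
    apply integral_mono (int_NN hF r (-s)).abs
      (iadd (isub hF'.integrable_pw hG'.integrable_pw).abs
      (isub hFs.integrable_pw hG'.integrable_pw).abs)
    intro x
    simp only
    rw [e]
    have := abs_sub_le (pw F r x) (pw G r x) (pw (fun x => F (x - s)) r x)
    rw [abs_sub_comm (pw G r x)] at this
    exact this
  unfold NN
  have h4 : r⁻¹ * ∫ x, |pw F r x - pw F r (x + -s)| ≤ r⁻¹ * (∫ x, |pw F r x - pw G r x|) +
      r⁻¹ * (2 * W1 (fun x => F (x - s)) G) := by
    rw [← mul_add]
    exact mul_le_mul_of_nonneg_left (by linarith) (inv_nonneg.2 hr.le)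
  have e2 : r⁻¹ * (2 * W1 (fun x => F (x - s)) G) = 2 * W1 (fun x => F (x - s)) G / r := by
    field_simp
  rw [e2] at h4
  linarith

theorem JB_ge_wavg {A : ℝ} {N n : ℕ} {F G : (Fin n → Fin N) → ℝ → ℝ}
    (hF : ∀ w, IsCdf A (F w)) (hG : ∀ w, IsCdf A (G w)) {T C : ℝ}
    (hC : ∀ τ ∈ Icc T (T + Real.log 2), C ≤ wavg n (fun w => JJ (Real.exp (-τ)) (F w) (G w))) :
    Real.log 2 * C ≤ wavg n (fun w => JB T (F w) (G w)) := by
  have l2 := Real.log_pos one_lt_two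
  have e : wavg n (fun w => JB T (F w) (G w)) =
      ∫ τ in T..(T + Real.log 2), wavg n (fun w => JJ (Real.exp (-τ)) (F w) (G w)) := by
    unfold wavg JB
    rw [intervalIntegral.integral_div, intervalIntegral.integral_finsetSum]
    intro w _
    exact (continuous_JJ_exp (hF w) (hG w)).intervalIntegrable _ _
  rw [e]
  have h0 : ∫ _τ in T..(T + Real.log 2), C = Real.log 2 * C := by simp
  rw [← h0]
  apply intervalIntegral.integral_mono_on (by linarith) (by simp)
  · have : Continuous (fun τ => wavg n (fun w => JJ (Real.exp (-τ)) (F w) (G w))) := by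
      unfold wavg
      exact (continuous_finsetSum _ fun w _ => continuous_JJ_exp (hF w) (hG w)).div_const _
    exact this.intervalIntegrable _ _
  · exact hC

/-- dyadic scale -/
theorem exists_dyadic {r ρ : ℝ} (hr : 0 < r) (hrρ : r ≤ ρ) :
    ∃ i : ℕ, ρ / 2 < 2 ^ i * r ∧ 2 ^ i * r ≤ ρ := by
  obtain ⟨i, h1, h2⟩ := exists_nat_pow_near (x := ρ / r) (y := 2) ((one_le_div hr).2 hrρ)
    one_lt_two
  refine ⟨i, ?_, ?_⟩
  · rw [div_lt_iff₀ hr, pow_succ] at h2; linarith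
  · rwa [le_div_iff₀ hr] at h1

namespace Fam
variable {N : ℕ} (S : Fam N)

def sg (l : ℕ) (z δ : ℝ) (u : Fin l → Fin N) : ℝ → ℝ :=
  aff (S.b ^ l) (S.tw l u z + δ) (S.F (S.zw l u z))

theorem sg_cdf (l : ℕ) {z : ℝ} (hz : z ∈ S.K) {δ R : ℝ} (hδ : |δ| ≤ R) (u : Fin l → Fin N) :
    IsCdf (2 * S.A + R) (S.sg l z δ u) := by
  refine ((S.hF _ (S.zw_mem l u hz)).aff (S.bpow_pos l) _).enlarge ?_
  have h1 := S.tw_le l u hz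
  have h2 := mul_le_mul_of_nonneg_right (S.bpow_le l) S.hA0.le
  have h3 := abs_add_le (S.tw l u z) δ
  linarith

def su (l : ℕ) (z1 z2 δ1 δ2 : ℝ) (u : Fin l → Fin N) : ℝ := (δ2 - δ1) - (z2 - z1) * S.hw l u

theorem su_eq (l : ℕ) (z1 z2 δ1 δ2 : ℝ) (u : Fin l → Fin N) :
    S.su l z1 z2 δ1 δ2 u = (S.tw l u z2 + δ2) - (S.tw l u z1 + δ1) := by
  unfold su; rw [S.tw_affine l u z2, S.tw_affine l u z1]; ring

theorem su_le (l : ℕ) (z1 z2 δ1 δ2 : ℝ) (u : Fin l → Fin N) :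
    |S.su l z1 z2 δ1 δ2 u| ≤ (1 + S.A) * max |z2 - z1| |δ2 - δ1| := by
  unfold su
  refine (abs_sub _ _).trans ?_
  rw [abs_mul]
  have h1 := S.hw_le l u
  have h2 := mul_le_mul (le_max_left |z2 - z1| |δ2 - δ1|) h1 (abs_nonneg _)
    ((abs_nonneg _).trans (le_max_left _ _))
  have h3 := le_max_right |z2 - z1| |δ2 - δ1|
  linarith

theorem W1_sg_shift (l : ℕ) {z1 z2 : ℝ} (h1 : z1 ∈ S.K) (h2 : z2 ∈ S.K) (δ1 δ2 : ℝ)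
    (u : Fin l → Fin N) :
    W1 (fun x => S.sg l z1 δ1 u (x - S.su l z1 z2 δ1 δ2 u)) (S.sg l z2 δ2 u) ≤
      S.A * S.c ^ l * |z2 - z1| := by
  have e : (fun x => S.sg l z1 δ1 u (x - S.su l z1 z2 δ1 δ2 u)) =
      aff (S.b ^ l) (S.tw l u z2 + δ2) (S.F (S.zw l u z1)) := by
    funext x
    unfold sg aff
    rw [su_eq]; congr 2; ring
  rw [e]
  unfold sg
  rw [W1_aff _ _ (S.bpow_pos l)]
  have h := S.hlip _ (S.zw_mem l u h1) _ (S.zw_mem l u h2)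
  rw [zw_sub, abs_mul, abs_of_pos (pow_pos S.ratio_pos _), abs_sub_comm] at h
  refine (mul_le_mul_of_nonneg_left h (S.bpow_pos l).le).trans (le_of_eq ?_)
  rw [div_pow]
  have := (S.bpow_pos l).ne'
  field_simp

theorem W1_sg (l : ℕ) {z1 z2 : ℝ} (h1 : z1 ∈ S.K) (h2 : z2 ∈ S.K) (δ1 δ2 : ℝ)
    (u : Fin l → Fin N) :
    W1 (S.sg l z1 δ1 u) (S.sg l z2 δ2 u) ≤ (1 + 2 * S.A) * max |z2 - z1| |δ2 - δ1| := by
  set s := S.su l z1 z2 δ1 δ2 u with hs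
  set R := max |δ1| |δ2| with hR
  have c1 := S.sg_cdf l h1 (le_max_left |δ1| |δ2|) u
  have c2 := S.sg_cdf l h2 (le_max_right |δ1| |δ2|) u
  have c3 : IsCdf (2 * S.A + R + |-s|) (fun x => S.sg l z1 δ1 u (x - s)) := by
    simpa [sub_eq_add_neg] using c1.comp_add (-s)
  have hp : 2 * S.A + R ≤ 2 * S.A + R + |-s| := by linarith [abs_nonneg (-s)]
  have t := W1_triangle (c1.enlarge hp) c3 (c2.enlarge hp)
  have w1 : W1 (S.sg l z1 δ1 u) (fun x => S.sg l z1 δ1 u (x - s)) = |s| := by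
    have := W1_shift c1 (-s)
    rw [abs_neg] at this
    rw [← this]
    unfold W1
    congr 1; funext x; rw [abs_sub_comm]; simp only [sub_eq_add_neg]
  have w2 := S.W1_sg_shift l h1 h2 δ1 δ2 u
  rw [← hs] at w2
  have w3 := S.su_le l z1 z2 δ1 δ2 u
  have hcl : S.c ^ l ≤ 1 := pow_le_one₀ S.hc.le S.hc1.le
  have hA := S.hA0
  have w4 : S.A * S.c ^ l * |z2 - z1| ≤ S.A * max |z2 - z1| |δ2 - δ1| := by
    apply mul_le_mul _ (le_max_left _ _) (abs_nonneg _) hA.le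
    nlinarith
  rw [w1] at t
  rw [← hs] at w3
  linarith

/-- Non-atomicity. -/
def NA : Prop := ∀ p > (0:ℝ), ∃ κ > (0:ℝ), ∃ l0 : ℕ, ∀ l ≥ l0, ∀ z1 ∈ S.K, ∀ z2 ∈ S.K,
  ∀ δ : ℝ, wavg l (fun u => if |δ - (z2 - z1) * S.hw l u| < κ * max |z2 - z1| |δ| then (1:ℝ) else 0)
    ≤ p

theorem exp_chi (n : ℕ) : Real.exp (-(n * S.chi)) = S.b ^ n := by
  rw [← S.log_bpow, Real.exp_log (S.bpow_pos n)]

/-- lower bound for a single good `u` -/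
theorem Ent_lower (l : ℕ) {z1 z2 : ℝ} (h1 : z1 ∈ S.K) (h2 : z2 ∈ S.K) (δ1 δ2 : ℝ)
    (u : Fin l → Fin N) {ρ κ B θ r h : ℝ} (hρ : ρ = max |z2 - z1| |δ2 - δ1|) (hρ0 : 0 < ρ)
    (hκ : 0 < κ) (hB : 1 ≤ B) (hθ : 0 < θ) (hr1 : ρ / 2 < r) (hr2 : r ≤ ρ)
    (hs : κ * ρ ≤ |S.su l z1 z2 δ1 δ2 u|) (hh1 : B * ρ ≤ h) (hh2 : h ≤ B * ρ / S.b ^ 2) :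
    NN h (S.sg l z1 δ1 u) h ≤ B / (S.b ^ 2 * κ) *
      (θ + 6 / θ * JJ r (S.sg l z1 δ1 u) (S.sg l z2 δ2 u) + 4 * S.A * S.c ^ l)
      + (2 + 2 * (1 + S.A)) / B := by
  have hb := S.hb0
  have hA := S.hA0
  have c1 := S.sg_cdf l h1 (le_max_left |δ1| |δ2|) u
  have c2 := S.sg_cdf l h2 (le_max_right |δ1| |δ2|) u
  set s := S.su l z1 z2 δ1 δ2 u with hsd
  have hr0 : 0 < r := by linarith
  have hs0 : 0 < |s| := lt_of_lt_of_le (by positivity) hs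
  have hrh : r ≤ h := by nlinarith
  have hh0 : 0 < h := by linarith
  have m1 := NN_spread c1 hr0 hrh (abs_pos.1 hs0)
  have m2 := NN_le_JJ c1 c2 hr0 hθ s
  have w2 := S.W1_sg_shift l h1 h2 δ1 δ2 u
  rw [← hsd] at w2
  have w3 := S.su_le l z1 z2 δ1 δ2 u
  rw [← hsd, ← hρ] at w3
  have hcl := pow_pos S.hc l
  have m3 : 2 * W1 (fun x => S.sg l z1 δ1 u (x - s)) (S.sg l z2 δ2 u) / r ≤ 4 * S.A * S.c ^ l := by
    rw [div_le_iff₀ hr0]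
    have : |z2 - z1| ≤ ρ := hρ ▸ le_max_left _ _
    have h5 : S.A * S.c ^ l * |z2 - z1| ≤ S.A * S.c ^ l * (2 * r) :=
      mul_le_mul_of_nonneg_left (by linarith) (by positivity)
    linarith
  have m4 : h / |s| ≤ B / (S.b ^ 2 * κ) := by
    rw [div_le_div_iff₀ hs0 (by positivity)]
    rw [le_div_iff₀ (by positivity)] at hh2
    calc h * (S.b ^ 2 * κ) = (h * S.b ^ 2) * κ := by ring
      _ ≤ B * ρ * κ := by gcongr
      _ = B * (κ * ρ) := by ring
      _ ≤ B * |s| := by gcongr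
  have hJ := JJ_nonneg c1 c2 hr0
  have m5 : h / |s| * NN r (S.sg l z1 δ1 u) s ≤ B / (S.b ^ 2 * κ) *
      (θ + 6 / θ * JJ r (S.sg l z1 δ1 u) (S.sg l z2 δ2 u) + 4 * S.A * S.c ^ l) :=
    mul_le_mul m4 (by linarith) (NN_nonneg hr0 _ _) (by positivity)
  have m6 : 2 * r / h + 2 * |s| / h ≤ (2 + 2 * (1 + S.A)) / B := by
    rw [← add_div, div_le_div_iff₀ hh0 (by linarith)]
    calc (2 * r + 2 * |s|) * B ≤ (2 * ρ + 2 * ((1 + S.A) * ρ)) * B := by gcongr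
      _ = (2 + 2 * (1 + S.A)) * (B * ρ) := by ring
      _ ≤ _ := by gcongr
  linarith

theorem JJ_lower (hNA : S.NA) (hLam : S.Lam < S.chi * Real.log 2) :
    ∃ δ0 > (0:ℝ), ∃ M0 : ℕ, ∀ M ≥ M0, ∀ L : ℕ, ∃ l0 : ℕ, ∀ l ≥ l0, ∀ z1 ∈ S.K, ∀ z2 ∈ S.K,
      ∀ δ1 δ2 ρ r : ℝ, ρ = max |z2 - z1| |δ2 - δ1| → S.b ^ (l + M + L) < ρ → ρ ≤ S.b ^ (l + M) →
      ρ / 2 < r → r ≤ ρ →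
      δ0 ≤ wavg l (fun u => JJ r (S.sg l z1 δ1 u) (S.sg l z2 δ2 u)) := by
  have hb := S.hb0
  have hA := S.hA0
  have hχ := S.chi_pos
  have l2 := Real.log_pos one_lt_two
  set E := S.chi * Real.log 2 with hE
  have hE0 : 0 < E := by positivity
  set g := 1 - S.Lam / E with hg
  have hg0 : 0 < g := by rw [hg, sub_pos, div_lt_one hE0]; exact hLam
  obtain ⟨κ, hκ, l1, hNA'⟩ := hNA (g / 8) (by positivity)
  -- choose B
  set B := 1 + (2 + 2 * (1 + S.A)) * 8 / g with hB
  have hB1 : 1 ≤ B := by rw [hB]; have : 0 ≤ (2 + 2 * (1 + S.A)) * 8 / g := by positivity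
                         linarith
  have hB0 : 0 < B := by linarith
  have hBg : (2 + 2 * (1 + S.A)) / B ≤ g / 8 := by
    rw [div_le_iff₀ hB0, hB]
    have : g / 8 * (1 + (2 + 2 * (1 + S.A)) * 8 / g) = g / 8 + (2 + 2 * (1 + S.A)) := by field_simp
    rw [this]; linarith
  set Q := B / (S.b ^ 2 * κ) with hQ
  have hQ0 : 0 < Q := by positivity
  set θ := g / (8 * Q) with hθ
  have hθ0 : 0 < θ := by positivity
  have hQθ : Q * θ = g / 8 := by rw [hθ]; field_simp
  obtain ⟨l2', hl2'⟩ := exists_pow_lt_of_lt_one (y := S.c) (x := g / (8 * Q * (4 * S.A)))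
    (by positivity) S.hc1
  obtain ⟨M0, hM0⟩ := exists_pow_lt_of_lt_one (y := S.b) (x := S.b / (2 * B))
    (by positivity) S.hb
  refine ⟨g * θ / (12 * Q), by positivity, M0, fun M hM L => ?_⟩
  obtain ⟨l3, hl3⟩ := S.beta_spec_fin (L + M) (g * E / 8) (by positivity)
  refine ⟨max l1 (max l2' l3), fun l hl z1 h1 z2 h2 δ1 δ2 ρ r hρ hρ1 hρ2 hr1 hr2 => ?_⟩
  have hll1 : l1 ≤ l := (le_max_left _ _).trans hl
  have hll2 : l2' ≤ l := (le_max_left _ _).trans ((le_max_right _ _).trans hl)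
  have hll3 : l3 ≤ l := (le_max_right _ _).trans ((le_max_right _ _).trans hl)
  have hρ0 : 0 < ρ := (S.bpow_pos _).trans hρ1
  have hr0 : 0 < r := by linarith
  -- the window
  have hex : ∃ j : ℕ, S.b ^ (j + 2) < 2 * B * ρ ∧ 2 * B * ρ ≤ S.b ^ (j + 1) ∧ l ≤ j := by
    have hstart : 2 * B * ρ ≤ S.b ^ (l + 1) := by
      have h3 : S.b ^ M ≤ S.b / (2 * B) :=
        (pow_le_pow_of_le_one hb.le S.hb.le hM).trans hM0.le
      rw [le_div_iff₀ (by positivity)] at h3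
      calc 2 * B * ρ ≤ 2 * B * S.b ^ (l + M) := by gcongr
        _ = S.b ^ l * (S.b ^ M * (2 * B)) := by rw [pow_add]; ring
        _ ≤ S.b ^ l * S.b := by gcongr
        _ = _ := by rw [pow_succ]
    have hend : ∃ m : ℕ, S.b ^ (l + m + 2) < 2 * B * ρ := by
      obtain ⟨m, hm⟩ := exists_pow_lt_of_lt_one (y := S.b) (x := 2 * B * ρ) (by positivity) S.hb
      exact ⟨m, (pow_le_pow_of_le_one hb.le S.hb.le (by omega)).trans_lt hm⟩
    classical
    refine ⟨l + Nat.find hend, Nat.find_spec hend, ?_, Nat.le_add_right _ _⟩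
    by_cases h0 : Nat.find hend = 0
    · rw [h0]; exact hstart
    · obtain ⟨m, hm⟩ := Nat.exists_eq_succ_of_ne_zero h0
      have := Nat.find_min hend (m := m) (by omega)
      rw [hm]
      rw [not_lt] at this
      refine this.trans (le_of_eq ?_)
      congr 1
  obtain ⟨j, hj1, hj2, hlj⟩ := hex
  have hjup : j < l + M + L := by
    by_contra hcon
    rw [not_lt] at hcon
    have : S.b ^ (j + 1) ≤ S.b ^ (l + M + L) := pow_le_pow_of_le_one hb.le S.hb.le (by omega)
    nlinarith
  obtain ⟨k, rfl⟩ := Nat.exists_eq_add_of_le hlj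
  have hk : k < L + M := by omega

  set J : (Fin l → Fin N) → ℝ := fun u => JJ r (S.sg l z1 δ1 u) (S.sg l z2 δ2 u) with hJ
  have c1 := fun u => S.sg_cdf l h1 (le_max_left |δ1| |δ2|) u
  have c2 := fun u => S.sg_cdf l h2 (le_max_right |δ1| |δ2|) u
  have hJ0 : ∀ u, 0 ≤ J u := fun u => JJ_nonneg (c1 u) (c2 u) hr0
  set bad : (Fin l → Fin N) → ℝ := fun u =>
    if |(δ2 - δ1) - (z2 - z1) * S.hw l u| < κ * max |z2 - z1| |δ2 - δ1| then (1:ℝ) else 0 with hbad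
  have hDint : ∀ u, Dint ((l + k : ℕ) * S.chi) ((l + k + 1 : ℕ) * S.chi) (S.sg l z1 δ1 u) =
      S.win k (S.zw l u z1) := by
    intro u
    unfold sg
    rw [Dint_aff _ (S.bpow_pos l), log_bpow]
    unfold win
    congr 1 <;> push_cast <;> ring
  have hcl : 4 * S.A * S.c ^ l * Q ≤ g / 8 := by
    have : S.c ^ l ≤ g / (8 * Q * (4 * S.A)) :=
      (pow_le_pow_of_le_one S.hc.le S.hc1.le hll2).trans hl2'.le
    rw [le_div_iff₀ (by positivity)] at this
    linarith
  have hpt : ∀ u, E * (1 - 3 * g / 16) - E / 2 * (Q * (6 / θ)) * J u - E * bad u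
      ≤ S.win k (S.zw l u z1) := by
    intro u
    rw [← hDint u]
    have hnn : 0 ≤ E / 2 * (Q * (6 / θ)) * J u := mul_nonneg (by positivity) (hJ0 u)
    by_cases hb' : |(δ2 - δ1) - (z2 - z1) * S.hw l u| < κ * max |z2 - z1| |δ2 - δ1|
    · have : bad u = 1 := if_pos hb'
      rw [this]
      have := Dint_nonneg (c1 u) (S.kchi_le (Nat.le_succ (l + k)))
      have : 0 ≤ E * (3 * g / 16) := by positivity
      linarith
    · have : bad u = 0 := if_neg hb'
      rw [this]
      rw [not_lt, ← hρ] at hb'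
      have key := Dint_ge_of (c1 u) (S.kchi_le (Nat.le_succ (l + k)))
        (C := Real.log 2 - Real.log 2 / 2 * (3 * g / 8 + Q * (6 / θ) * J u)) (by
          intro τ hτ
          have e1 : Real.exp (-τ) ≤ S.b ^ (l + k) := by
            rw [← S.exp_chi]; exact Real.exp_le_exp.2 (by linarith [hτ.1])
          have e2 : S.b ^ (l + k + 1) ≤ Real.exp (-τ) := by
            rw [← S.exp_chi]; exact Real.exp_le_exp.2 (by linarith [hτ.2])
          have hx := log_two_sub_Ent_le (c1 u) (Real.exp_pos (-τ))
          have hy := S.Ent_lower l h1 h2 δ1 δ2 u hρ hρ0 hκ hB1 hθ0 hr1 hr2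
            (h := Real.exp (-τ) / 2) hb' (by linarith) (by
              rw [le_div_iff₀ (by positivity)]
              rw [pow_add] at hj1
              have := mul_le_mul_of_nonneg_right e1 (pow_pos hb 2).le
              linarith)
          have hz : NN (Real.exp (-τ) / 2) (S.sg l z1 δ1 u) (Real.exp (-τ) / 2) ≤
              3 * g / 8 + Q * (6 / θ) * J u := by
            refine hy.trans ?_
            rw [← hQ]
            have : Q * (θ + 6 / θ * J u + 4 * S.A * S.c ^ l) =
              Q * θ + Q * (6 / θ) * J u + 4 * S.A * S.c ^ l * Q := by ring
            simp only [hJ] at this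
            rw [this, hQθ]
            simp only [hJ]
            linarith
          have hw := mul_le_mul_of_nonneg_left hz (by positivity : 0 ≤ Real.log 2 / 2)
          linarith)
      refine le_trans (le_of_eq ?_) key
      rw [hE]; push_cast; ring
  have havg := wavg_mono hpt
  rw [wavg_sub, wavg_sub, wavg_const S.hN0, wavg_mul, wavg_mul] at havg
  have hup : wavg l (fun u => S.win k (S.zw l u z1)) ≤ S.Lam + g * E / 8 := by
    have h5 := hl3 k hk l hll3 z1 h1
    have h6 := S.beta_le_Lam k
    rw [abs_le] at h5
    have := h5.2
    unfold Pop at this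
    linarith
  have hbadle : wavg l bad ≤ g / 8 := hNA' l hll1 z1 h1 z2 h2 (δ2 - δ1)
  have hLamE : S.Lam = E * (1 - g) := by rw [hg]; field_simp; ring
  have h7 : E * wavg l bad ≤ E * (g / 8) := mul_le_mul_of_nonneg_left hbadle hE0.le
  have h8 : E * (g / 4) ≤ E * ((Q * (6 / θ)) / 2 * wavg l J) := by
    have : 0 < E * g := by positivity
    nlinarith
  have h9 := le_of_mul_le_mul_left h8 hE0
  have h10 : (Q * (6 / θ)) / 2 = 3 * Q / θ := by field_simp; ring
  rw [h10, div_mul_eq_mul_div, le_div_iff₀ hθ0] at h9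
  rw [div_le_iff₀ (by positivity)]
  linarith

theorem JB_gain (hNA : S.NA) (hLam : S.Lam < S.chi * Real.log 2) :
    ∃ δ0 > (0:ℝ), ∃ L0 M0 : ℕ, ∀ M ≥ M0, ∀ L : ℕ, ∃ l0 : ℕ, ∀ l ≥ l0, ∀ z1 ∈ S.K, ∀ z2 ∈ S.K,
      ∀ δ1 δ2 : ℝ, S.b ^ (l + M + L) < max |z2 - z1| |δ2 - δ1| →
      max |z2 - z1| |δ2 - δ1| ≤ S.b ^ (l + M + L0) →
      δ0 ≤ wavg l (fun u => JB ((l + M + L : ℕ) * S.chi) (S.sg l z1 δ1 u) (S.sg l z2 δ2 u) -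
        JB ((l + M : ℕ) * S.chi) (S.sg l z1 δ1 u) (S.sg l z2 δ2 u)) := by
  obtain ⟨δ0, hδ0, M0, hmain⟩ := S.JJ_lower hNA hLam
  have hb := S.hb0
  have hA := S.hA0
  have l2 := Real.log_pos one_lt_two
  obtain ⟨L0, hL0⟩ := exists_pow_lt_of_lt_one (y := S.b)
    (x := δ0 / 2 / (Real.log 2 * ((1 + 2 * S.A) * 2))) (by positivity) S.hb
  rw [lt_div_iff₀ (by positivity)] at hL0
  refine ⟨Real.log 2 * (δ0 / 2), by positivity, L0, M0, fun M hM L => ?_⟩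
  obtain ⟨l0, hl0⟩ := hmain M hM L
  refine ⟨l0, fun l hl z1 h1 z2 h2 δ1 δ2 hρ1 hρ2 => ?_⟩
  set ρ := max |z2 - z1| |δ2 - δ1| with hρ
  have c1 := fun u => S.sg_cdf l h1 (le_max_left |δ1| |δ2|) u
  have c2 := fun u => S.sg_cdf l h2 (le_max_right |δ1| |δ2|) u
  rw [wavg_sub]
  have hend : Real.log 2 * δ0 ≤ wavg l (fun u =>
      JB ((l + M + L : ℕ) * S.chi) (S.sg l z1 δ1 u) (S.sg l z2 δ2 u)) := by
    apply JB_ge_wavg c1 c2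
    intro τ hτ
    have hr0 := Real.exp_pos (-τ)
    have hrρ : Real.exp (-τ) ≤ ρ := by
      refine le_trans ?_ hρ1.le
      rw [← S.exp_chi]; exact Real.exp_le_exp.2 (by linarith [hτ.1])
    obtain ⟨i, hi1, hi2⟩ := exists_dyadic hr0 hrρ
    refine (hl0 l hl z1 h1 z2 h2 δ1 δ2 ρ (2 ^ i * Real.exp (-τ)) hρ hρ1
      (hρ2.trans (pow_le_pow_of_le_one hb.le S.hb.le (by omega))) hi1 hi2).trans ?_
    exact wavg_mono fun u => JJ_exp_mono (c1 u) (c2 u) _ hr0 i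
  have hstart : wavg l (fun u =>
      JB ((l + M : ℕ) * S.chi) (S.sg l z1 δ1 u) (S.sg l z2 δ2 u)) ≤ Real.log 2 * (δ0 / 2) := by
    rw [← wavg_const (n := l) S.hN0 (Real.log 2 * (δ0 / 2))]
    apply wavg_mono
    intro u
    apply JB_le (c1 u) (c2 u)
    intro τ hτ
    have hr0 := Real.exp_pos (-τ)
    have hr : S.b ^ (l + M) / 2 ≤ Real.exp (-τ) := by
      rw [← S.exp_chi, exp_half]; exact Real.exp_le_exp.2 (by linarith [hτ.2])
    refine (JJ_le (c1 u) (c2 u) hr0).trans ?_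
    have hW := S.W1_sg l h1 h2 δ1 δ2 u
    rw [← hρ] at hW
    rw [← mul_div_assoc, div_le_iff₀ hr0]
    have hp := S.bpow_pos (l + M)
    calc Real.log 2 * W1 (S.sg l z1 δ1 u) (S.sg l z2 δ2 u)
        ≤ Real.log 2 * ((1 + 2 * S.A) * S.b ^ (l + M + L0)) := by
          gcongr; exact hW.trans (by gcongr)
      _ = S.b ^ L0 * (Real.log 2 * ((1 + 2 * S.A) * 2)) * (S.b ^ (l + M) / 2) := by
          rw [pow_add]; ring
      _ ≤ δ0 / 2 * (S.b ^ (l + M) / 2) := by gcongr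
      _ ≤ _ := by gcongr
  linarith

end Fam
end
end

section
open MeasureTheory Filter Set Topology
open scoped ENNReal
noncomputable section
set_option linter.all false

/-! ### The block inequality -/

section pairs
variable {Ω γ : Type*} [Fintype Ω] [DecidableEq γ]

def lw (a : Ω → γ) (p : Ω × Ω) : ℝ :=
  if a p.2 = a p.1 then 1 / (cn a p.1 * (Fintype.card Ω : ℝ)) else 0

theorem lw_nonneg (a : Ω → γ) (p : Ω × Ω) : 0 ≤ lw a p := by
  unfold lw
  have := cn_pos a p.1
  split_ifs <;> positivity

theorem pavg_eq (a : Ω → γ) (H : Ω → Ω → ℝ) : pavg a H = ∑ p : Ω × Ω, lw a p * H p.1 p.2 := by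
  unfold pavg uavg lw
  rw [Fintype.sum_prod_type, Finset.sum_div]
  apply Finset.sum_congr rfl
  intro w _
  simp only [ite_mul, zero_mul]
  rw [← Finset.sum_filter, ← Finset.mul_sum]
  unfold cellF
  rw [div_div]; ring

theorem lw_sum [Nonempty Ω] (a : Ω → γ) : ∑ p : Ω × Ω, lw a p = 1 := by
  have := pavg_eq a (fun _ _ => (1:ℝ))
  simp only [mul_one] at this
  rw [← this, pavg_fst a (fun _ => (1:ℝ)), uavg_const]

theorem pavg_sub (a : Ω → γ) (G G' : Ω → Ω → ℝ) :
    pavg a (fun w w' => G w w' - G' w w') = pavg a G - pavg a G' := by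
  rw [pavg_eq, pavg_eq, pavg_eq, ← Finset.sum_sub_distrib]
  exact Finset.sum_congr rfl fun p _ => by ring

theorem uavg_eq_pavg_half (a : Ω → γ) (f : Ω → ℝ) :
    uavg f = pavg a (fun w w' => (f w + f w') / 2) := by
  have e : (fun w w' => (f w + f w') / 2) = fun w w' => (1/2) * (f w + f w') := by
    funext w w'; ring
  rw [e, pavg_mul a (1/2) (fun w w' => f w + f w'), pavg_add a (fun w _ => f w) (fun _ w => f w),
    pavg_fst, pavg_snd]
  ring

theorem Dint_wavg_ge {A : ℝ} {N l : ℕ} (hN : 0 < N) {G : (Fin l → Fin N) → ℝ → ℝ}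
    (hG : ∀ u, IsCdf A (G u)) {T1 T2 : ℝ} (hT : T1 ≤ T2) :
    wavg l (fun u => Dint T1 T2 (G u)) ≤ Dint T1 T2 (fun x => wavg l fun u => G u x) := by
  have e : (fun x => wavg l fun u => G u x) = fun x => ∑ u, (1 / (N:ℝ) ^ l) * G u x := by
    funext x; rw [wavg_eq_sum]
  rw [e, wavg_eq_sum]
  exact Dint_concave Finset.univ (fun _ _ => by positivity) (wavg_weight hN) (fun u _ => hG u) hT

theorem wavg_cdf {A : ℝ} {N l : ℕ} (hN : 0 < N) {G : (Fin l → Fin N) → ℝ → ℝ}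
    (hG : ∀ u, IsCdf A (G u)) : IsCdf A (fun x => wavg l fun u => G u x) := by
  have e : (fun x => wavg l fun u => G u x) = fun x => ∑ u, (1 / (N:ℝ) ^ l) * G u x := by
    funext x; rw [wavg_eq_sum]
  rw [e]
  exact IsCdf.mix Finset.univ (fun _ _ => by positivity) (wavg_weight hN) (fun u _ => hG u)

theorem Dint_block [Nonempty Ω] {A : ℝ} {N l : ℕ} (hN : 0 < N) (a : Ω → γ)
    {G : Ω → (Fin l → Fin N) → ℝ → ℝ}
    (hG : ∀ w u, IsCdf A (G w u)) {T1 T2 : ℝ} (hT : T1 ≤ T2) :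
    uavg (fun w => wavg l fun u => Dint T1 T2 (G w u)) +
      pavg a (fun w w' => wavg l fun u => JB T2 (G w u) (G w' u) - JB T1 (G w u) (G w' u)) ≤
    Dint T1 T2 (fun x => uavg fun w => wavg l fun u => G w u x) := by
  have e : (fun x => uavg fun w => wavg l fun u => G w u x) =
      fun x => ∑ p : Ω × Ω, lw a p * (fun x => wavg l fun u => (G p.1 u x + G p.2 u x) / 2) x := by
    funext x
    rw [uavg_eq_pavg_half a, pavg_eq]
    apply Finset.sum_congr rfl
    intro p _
    congr 1
    have : (fun u => (G p.1 u x + G p.2 u x) / 2) = fun u => (1/2) * (G p.1 u x + G p.2 u x) := by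
      funext u; ring
    simp only
    rw [this, wavg_mul, wavg_add]; ring
  rw [e]
  have h1 := Dint_concave (A := A) Finset.univ (l := lw a)
    (f := fun p : Ω × Ω => fun x => wavg l fun u => (G p.1 u x + G p.2 u x) / 2)
    (fun p _ => lw_nonneg a p) (lw_sum a)
    (fun p _ => wavg_cdf hN fun u => (hG p.1 u).half (hG p.2 u)) hT
  refine le_trans ?_ h1
  have h2 : ∀ p : Ω × Ω, wavg l (fun u => Dint T1 T2 (fun x => (G p.1 u x + G p.2 u x) / 2)) ≤
      Dint T1 T2 (fun x => wavg l fun u => (G p.1 u x + G p.2 u x) / 2) := fun p =>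
    Dint_wavg_ge hN (fun u => (hG p.1 u).half (hG p.2 u)) hT
  refine le_trans (le_of_eq ?_) (Finset.sum_le_sum fun p _ =>
    mul_le_mul_of_nonneg_left (h2 p) (lw_nonneg a p))
  rw [← pavg_eq a (fun w w' => wavg l (fun u => Dint T1 T2 (fun x => (G w u x + G w' u x) / 2))),
    uavg_eq_pavg_half a, ← pavg_add]
  congr 1
  funext w w'
  rw [← wavg_add, div_eq_mul_one_div, mul_comm, ← wavg_mul, ← wavg_add]
  congr 1
  funext u
  rw [Dint_half (hG w u) (hG w' u)]
  ring

theorem card_image_box (s : Finset Ω) (f : Ω → ℤ × ℤ) (p : ℤ × ℤ) {R : ℤ} (hR : 0 ≤ R)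
    (h : ∀ w ∈ s, |(f w).1 - p.1| ≤ R ∧ |(f w).2 - p.2| ≤ R) :
    ((s.image f).card : ℝ) ≤ (2 * R + 1) ^ 2 := by
  have hsub : s.image f ⊆ Finset.Icc (p.1 - R) (p.1 + R) ×ˢ Finset.Icc (p.2 - R) (p.2 + R) := by
    intro y hy
    obtain ⟨w, hw, rfl⟩ := Finset.mem_image.1 hy
    obtain ⟨h1, h2⟩ := h w hw
    rw [abs_le] at h1 h2
    rw [Finset.mem_product, Finset.mem_Icc, Finset.mem_Icc]
    refine ⟨⟨?_, ?_⟩, ?_, ?_⟩ <;> linarith [h1.1, h1.2, h2.1, h2.2]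
  have hc := Finset.card_le_card hsub
  rw [Finset.card_product, Int.card_Icc, Int.card_Icc] at hc
  have e1 : (p.1 + R + 1 - (p.1 - R)).toNat = (2 * R + 1).toNat := by congr 1; ring
  have e2 : (p.2 + R + 1 - (p.2 - R)).toNat = (2 * R + 1).toNat := by congr 1; ring
  rw [e1, e2, ← sq] at hc
  have e3 : (((2 * R + 1).toNat : ℕ) : ℝ) = 2 * R + 1 := by
    have : (((2 * R + 1).toNat : ℤ)) = 2 * R + 1 := Int.toNat_of_nonneg (by omega)
    exact_mod_cast this
  calc ((s.image f).card : ℝ) ≤ (((2 * R + 1).toNat ^ 2 : ℕ) : ℝ) := by exact_mod_cast hc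
    _ = _ := by push_cast [e3]; rfl
end pairs

theorem floor_near {p q D : ℝ} {R : ℤ} (h : |p - q| ≤ D) (hR : D + 1 ≤ R) : |⌊p⌋ - ⌊q⌋| ≤ R := by
  have h1 := Int.floor_le p
  have h2 := Int.lt_floor_add_one p
  have h3 := Int.floor_le q
  have h4 := Int.lt_floor_add_one q
  rw [abs_le] at *
  constructor
  · have : (-(R:ℝ)) ≤ ⌊p⌋ - ⌊q⌋ := by linarith [h.1]
    exact_mod_cast this
  · have : ((⌊p⌋ : ℝ) - ⌊q⌋) ≤ R := by linarith [h.2]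
    exact_mod_cast this

theorem floor_far {p q : ℝ} {J : ℤ} (h : ¬ |⌊p⌋ - ⌊q⌋| ≤ J) : (J:ℝ) < |p - q| := by
  by_contra hcon
  apply h
  rw [not_lt] at hcon
  have h1 := Int.floor_le p
  have h2 := Int.lt_floor_add_one p
  have h3 := Int.floor_le q
  have h4 := Int.lt_floor_add_one q
  rw [abs_le] at *
  constructor
  · have : (-(J:ℝ)) - 1 < ⌊p⌋ - ⌊q⌋ := by linarith [hcon.1]
    have : -J - 1 < ⌊p⌋ - ⌊q⌋ := by exact_mod_cast this
    omega
  · have : ((⌊p⌋ : ℝ) - ⌊q⌋) < J + 1 := by linarith [hcon.2]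
    have : ⌊p⌋ - ⌊q⌋ < J + 1 := by exact_mod_cast this
    omega

theorem floor_eq {p q : ℝ} (h : ⌊p⌋ = ⌊q⌋) : |p - q| ≤ 1 := (Int.abs_sub_lt_one_of_floor_eq_floor h).le

def nearB (J : ℤ) (x y : ℤ × ℤ) : Prop := |x.1 - y.1| ≤ J ∧ |x.2 - y.2| ≤ J

instance (J : ℤ) : DecidableRel (nearB J) := fun _ _ => inferInstanceAs (Decidable (_ ∧ _))

theorem uavg_eq_wavg {N n : ℕ} (f : (Fin n → Fin N) → ℝ) : uavg f = wavg n f := by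
  unfold uavg wavg; simp

namespace Fam
variable {N : ℕ} (S : Fam N)

def cel (e n : ℕ) (z : ℝ) (w : Fin n → Fin N) : ℤ × ℤ :=
  (⌊S.zw n w z / S.b ^ e⌋, ⌊S.tw n w z / S.b ^ n / S.b ^ e⌋)

/-- distance of two cylinders -/
def rr (n : ℕ) (z : ℝ) (w w' : Fin n → Fin N) : ℝ :=
  max |S.zw n w' z - S.zw n w z| |S.tw n w' z / S.b ^ n - S.tw n w z / S.b ^ n|

theorem self_sim2 (n l : ℕ) {z : ℝ} (hz : z ∈ S.K) :
    S.F z = aff (S.b ^ n) 0 (fun x => uavg fun w : Fin n → Fin N => wavg l fun u =>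
      S.sg l (S.zw n w z) (S.tw n w z / S.b ^ n) u x) := by
  funext x
  rw [S.self_sim n hz]
  unfold aff
  beta_reduce
  rw [uavg_eq_wavg]
  congr 1
  funext w
  unfold sig aff
  rw [S.self_sim l (S.zw_mem n w hz)]
  congr 1
  funext u
  unfold sig sg aff
  congr 1
  have := (S.bpow_pos n).ne'
  field_simp
  ring

theorem nonempty_words (S : Fam N) (n : ℕ) : Nonempty (Fin n → Fin N) :=
  ⟨fun _ => ⟨0, S.hN0⟩⟩

theorem cel_eq {e n : ℕ} {z : ℝ} {w w' : Fin n → Fin N} (h : S.cel e n z w' = S.cel e n z w) :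
    S.rr n z w w' ≤ S.b ^ e := by
  have hp := S.bpow_pos e
  obtain ⟨h1, h2⟩ := Prod.ext_iff.1 h
  have h1 := floor_eq h1
  have h2 := floor_eq h2
  rw [← sub_div, abs_div, abs_of_pos hp, div_le_one hp] at h1 h2
  exact max_le h1 h2

theorem cel_far {e n : ℕ} {z : ℝ} {w w' : Fin n → Fin N} {J : ℤ}
    (h : ¬ nearB J (S.cel e n z w') (S.cel e n z w)) :
    J * S.b ^ e < S.rr n z w w' := by
  have hp := S.bpow_pos e
  unfold nearB at h
  rw [not_and_or] at h
  rcases h with h | h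
  · have := floor_far h
    rw [← sub_div, abs_div, abs_of_pos hp, lt_div_iff₀ hp] at this
    exact this.trans_le (le_max_left _ _)
  · have := floor_far h
    rw [← sub_div, abs_div, abs_of_pos hp, lt_div_iff₀ hp] at this
    exact this.trans_le (le_max_right _ _)

theorem block {l M L L0 n : ℕ} {δ0 : ℝ} (hδ0 : 0 < δ0)
    (hgain : ∀ z1 ∈ S.K, ∀ z2 ∈ S.K,
      ∀ δ1 δ2 : ℝ, S.b ^ (l + M + L) < max |z2 - z1| |δ2 - δ1| →
      max |z2 - z1| |δ2 - δ1| ≤ S.b ^ (l + M + L0) →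
      δ0 ≤ wavg l (fun u => JB ((l + M + L : ℕ) * S.chi) (S.sg l z1 δ1 u) (S.sg l z2 δ2 u) -
        JB ((l + M : ℕ) * S.chi) (S.sg l z1 δ1 u) (S.sg l z2 δ2 u)))
    {J : ℤ} (hJ : 1 ≤ J * S.b ^ L0) {z : ℝ} (hz : z ∈ S.K) :
    S.Pop (n + l) (fun z => Dint (M * S.chi) ((M + L : ℕ) * S.chi) (S.F z)) z +
      δ0 * pavg (S.cel (l + M + L0) n z) (fun w w' =>
        if nearB J (S.cel (l + M + L0 + L) n z w') (S.cel (l + M + L0 + L) n z w) then 0 else 1) ≤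
    Dint ((n + (l + M) : ℕ) * S.chi) ((n + (l + M + L) : ℕ) * S.chi) (S.F z) := by
  have hb := S.hb0
  have := S.nonempty_words n
  set R := S.A / S.b ^ n with hR
  have hδR : ∀ w : Fin n → Fin N, |S.tw n w z / S.b ^ n| ≤ R := by
    intro w
    rw [abs_div, abs_of_pos (S.bpow_pos n), hR]
    exact div_le_div_of_nonneg_right (S.tw_le n w hz) (S.bpow_pos n).le
  have hcdf : ∀ (w : Fin n → Fin N) (u : Fin l → Fin N),
      IsCdf (2 * S.A + R) (S.sg l (S.zw n w z) (S.tw n w z / S.b ^ n) u) := fun w u =>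
    S.sg_cdf l (S.zw_mem n w hz) (hδR w) u
  have hT : ((l + M : ℕ) : ℝ) * S.chi ≤ (l + M + L : ℕ) * S.chi := S.kchi_le (by omega)
  have hblk := Dint_block S.hN0 (S.cel (l + M + L0) n z) hcdf hT
  have hD : Dint ((n + (l + M) : ℕ) * S.chi) ((n + (l + M + L) : ℕ) * S.chi) (S.F z) =
      Dint ((l + M : ℕ) * S.chi) ((l + M + L : ℕ) * S.chi)
        (fun x => uavg fun w : Fin n → Fin N => wavg l fun u =>
          S.sg l (S.zw n w z) (S.tw n w z / S.b ^ n) u x) := by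
    conv_lhs => rw [S.self_sim2 n l hz]
    rw [Dint_aff _ (S.bpow_pos n), log_bpow]
    congr 1 <;> push_cast <;> ring
  rw [hD]
  refine le_trans (add_le_add (le_of_eq ?_) ?_) hblk
  · rw [Pop_add, uavg_eq_wavg]
    unfold Pop
    congr 1
    funext w
    congr 1
    funext u
    unfold sg
    rw [Dint_aff _ (S.bpow_pos l), log_bpow]
    congr 1 <;> push_cast <;> ring
  · rw [← pavg_mul]
    apply pavg_mono
    intro w w' hww'
    split_ifs with hn
    · rw [mul_zero]
      exact wavg_nonneg fun u => sub_nonneg.2 (JB_mono (hcdf w u) (hcdf w' u) hT)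
    · rw [mul_one]
      apply hgain _ (S.zw_mem n w hz) _ (S.zw_mem n w' hz)
      · have h1 := S.cel_far hn
        refine lt_of_le_of_lt ?_ h1
        have : (J:ℝ) * S.b ^ (l + M + L0 + L) = J * S.b ^ L0 * S.b ^ (l + M + L) := by
          rw [show l + M + L0 + L = L0 + (l + M + L) by ring, pow_add]; ring
        rw [this]
        exact le_mul_of_one_le_left (S.bpow_pos _).le hJ
      · exact S.cel_eq hww'

theorem ent_step {e L n : ℕ} {J : ℤ} (hJ : 0 ≤ J) (z : ℝ) :
    Hent (S.cel (e + L) n z) - Hent (S.cel e n z) ≤ 2 + Real.log 2 + Real.log ((2 * J + 1) ^ 2) +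
      4 * (Real.log 7 + L * S.chi) * pavg (S.cel e n z) (fun w w' =>
        if nearB J (S.cel (e + L) n z w') (S.cel (e + L) n z w) then 0 else 1) := by
  have hb := S.hb0
  have := S.nonempty_words n
  have hL := S.bpow_pos L
  have hJ' : (0:ℝ) ≤ J := by exact_mod_cast hJ
  have h7 : 1 ≤ 1 / S.b ^ L := by rw [le_div_iff₀ hL]; linarith [S.bpow_le L]
  have hlog : Real.log ((7 / S.b ^ L) ^ 2) = 2 * (Real.log 7 + L * S.chi) := by
    rw [Real.log_pow, Real.log_div (by norm_num) hL.ne', log_bpow]; push_cast; ring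
  have hR1 : (1:ℝ) ≤ (7 / S.b ^ L) ^ 2 := by
    apply one_le_pow₀
    rw [div_eq_mul_one_div]; linarith
  have := fano (S.cel e n z) (S.cel (e + L) n z) (nearB J) (by
    intro x y h
    unfold nearB at *
    rwa [abs_sub_comm, abs_sub_comm y.2]) (m1 := (2 * J + 1) ^ 2) (R1 := (7 / S.b ^ L) ^ 2)
    (one_le_pow₀ (by linarith)) hR1
    (fun w => card_image_box _ _ (S.cel (e + L) n z w) hJ (by
      intro w' hw'
      exact (Finset.mem_filter.1 hw').2.2))
    (fun w => by
      set R : ℤ := ⌈1 / S.b ^ L⌉ + 1 with hR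
      have hRc := Int.le_ceil (1 / S.b ^ L)
      have hRc2 := Int.ceil_lt_add_one (1 / S.b ^ L)
      have hRr : (R : ℝ) = ⌈1 / S.b ^ L⌉ + 1 := by rw [hR]; push_cast; rfl
      have hR0 : 0 ≤ R := by
        have : (0:ℝ) ≤ R := by rw [hRr]; linarith
        exact_mod_cast this
      have hkey : ∀ x y : ℝ, ⌊x / S.b ^ e⌋ = ⌊y / S.b ^ e⌋ →
          |⌊x / S.b ^ (e + L)⌋ - ⌊y / S.b ^ (e + L)⌋| ≤ R := by
        intro x y hxy
        apply floor_near (D := 1 / S.b ^ L) _ (by rw [hRr]; linarith)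
        have h1 := floor_eq hxy
        have e1 : x / S.b ^ (e + L) - y / S.b ^ (e + L) = (x / S.b ^ e - y / S.b ^ e) / S.b ^ L := by
          rw [pow_add, ← div_div, ← div_div, sub_div]
        rw [e1, abs_div, abs_of_pos hL]
        exact div_le_div_of_nonneg_right h1 hL.le
      refine (card_image_box _ _ (S.cel (e + L) n z w) hR0 (by
        intro w' hw'
        rw [mem_cellF] at hw'
        obtain ⟨h1, h2⟩ := Prod.ext_iff.1 hw'
        exact ⟨hkey _ _ h1, hkey _ _ h2⟩)).trans ?_
      apply pow_le_pow_left₀ (by rw [hRr]; linarith)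
      have e7 : 7 / S.b ^ L = 7 * (1 / S.b ^ L) := by ring
      rw [hRr, e7]
      linarith)
  rw [hlog] at this
  linarith

theorem ent_start (e : ℕ) : ∃ C : ℝ, ∀ (n : ℕ), ∀ z ∈ S.K,
    Real.log 2 * Hent (S.cel e n z) ≤ Dint 0 (n * S.chi) (S.F z) + C := by
  have hb := S.hb0
  have he := S.bpow_pos e
  have hA := S.hA0
  have l2 := Real.log_pos one_lt_two
  set R : ℤ := ⌈(S.A + 1) / S.b ^ e⌉ + 1 with hR
  have hRc := Int.le_ceil ((S.A + 1) / S.b ^ e)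
  have hRr : (R : ℝ) = ⌈(S.A + 1) / S.b ^ e⌉ + 1 := by rw [hR]; push_cast; rfl
  have hp : 0 < (S.A + 1) / S.b ^ e := by positivity
  have hR0' : (0:ℝ) ≤ R := by rw [hRr]; linarith
  have hR0 : 0 ≤ R := by exact_mod_cast hR0'
  set m0 : ℝ := (2 * R + 1) ^ 2 with hm0
  have hm0p : 0 < m0 := by positivity
  refine ⟨Real.log 2 * (2 * 2 * (S.A + 1)) + Real.log 2 * (Real.log m0 + 1), fun n z hz => ?_⟩
  have := S.nonempty_words n
  have hF := S.hF z hz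
  have hpt : ∀ τ ∈ Icc ((n:ℝ) * S.chi) (n * S.chi + Real.log 2),
      Hent (S.cel e n z) - (Real.log m0 + 1) ≤ Phi (Real.exp (-τ)) (S.F z) := by
    intro τ hτ
    have hr0 := Real.exp_pos (-τ)
    have hr : Real.exp (-τ) ≤ S.b ^ n := by
      rw [← S.exp_chi]; exact Real.exp_le_exp.2 (by linarith [hτ.1])
    have := Hent_le_Phi (S.cel e n z) (S.sig n z) (fun w => S.sig_cdf n hz w) hr0 hm0p (by
      intro x
      refine (sum_inv_cn_le _ _).trans ?_
      apply card_image_box _ _ (⌊0 / S.b ^ e⌋, ⌊x / S.b ^ n / S.b ^ e⌋) hR0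
      intro w hw
      have hw := (Finset.mem_filter.1 hw).2
      constructor
      · apply floor_near (D := (S.A + 1) / S.b ^ e) _ (by rw [hRr]; linarith)
        rw [← sub_div, abs_div, abs_of_pos he, sub_zero]
        apply div_le_div_of_nonneg_right _ he.le
        linarith [S.hKA _ (S.zw_mem n w hz)]
      · apply floor_near (D := (S.A + 1) / S.b ^ e) _ (by rw [hRr]; linarith)
        rw [← sub_div, abs_div, abs_of_pos he]
        apply div_le_div_of_nonneg_right _ he.le
        by_contra hcon
        rw [not_le] at hcon
        apply hw
        unfold sig
        rw [pw_aff _ (S.bpow_pos n)]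
        apply (S.hF _ (S.zw_mem n w hz)).pw_zero
        rw [abs_of_pos (div_pos hr0 (S.bpow_pos n)), sub_div, abs_sub_comm]
        have : Real.exp (-τ) / S.b ^ n ≤ 1 := (div_le_one (S.bpow_pos n)).2 hr
        linarith)
    have hcard : ((Fintype.card (Fin n → Fin N) : ℕ) : ℝ) = (N:ℝ) ^ n := by simp
    rw [hcard, ← S.self_sim' n hz] at this
    linarith
  have hB : Real.log 2 * (Hent (S.cel e n z) - (Real.log m0 + 1)) ≤ Bf (n * S.chi) (S.F z) := by
    unfold Bf
    have h0 : ∫ _τ in ((n:ℝ) * S.chi)..(n * S.chi + Real.log 2),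
      (Hent (S.cel e n z) - (Real.log m0 + 1)) =
      Real.log 2 * (Hent (S.cel e n z) - (Real.log m0 + 1)) := by
      rw [intervalIntegral.integral_const, smul_eq_mul]; ring
    rw [← h0]
    apply intervalIntegral.integral_mono_on (by linarith) (by simp)
      ((continuous_Phi_exp hF).intervalIntegrable _ _) hpt
  rw [Dint_eq_Bf hF]
  have := Bf_zero_le hF
  linarith

def Sep : Prop := ∃ q : ℕ, ∀ n0 : ℕ, ∃ n ≥ n0, ∀ z ∈ S.K, ∀ w w' : Fin n → Fin N, w ≠ w' →
  S.b ^ (q * n) ≤ max |S.zw n w' z - S.zw n w z| |S.tw n w' z - S.tw n w z|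

theorem ent_end {q n e : ℕ} {z : ℝ} (h : ∀ w w' : Fin n → Fin N, w ≠ w' →
    S.b ^ (q * n) ≤ max |S.zw n w' z - S.zw n w z| |S.tw n w' z - S.tw n w z|)
    (he : q * n < e) : Hent (S.cel e n z) = n * Real.log N := by
  have := S.nonempty_words n
  rw [Hent_inj, uavg_const]
  · rw [Fintype.card_fun, Fintype.card_fin, Fintype.card_fin]; push_cast; rw [Real.log_pow]
  · intro w' w hww
    by_contra hne
    have h1 := S.cel_eq hww
    have h2 := h w w' (Ne.symm hne)
    have h3 : max |S.zw n w' z - S.zw n w z| |S.tw n w' z - S.tw n w z| ≤ S.rr n z w w' := by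
      unfold rr
      apply max_le_max le_rfl
      rw [← sub_div, abs_div, abs_of_pos (S.bpow_pos n), le_div_iff₀ (S.bpow_pos n)]
      exact mul_le_of_le_one_right (abs_nonneg _) (S.bpow_le n)
    have h4 : S.b ^ e < S.b ^ (q * n) := pow_lt_pow_right_of_lt_one₀ S.hb0 S.hb he
    linarith

theorem Pop_Dint_le {j m l : ℕ} {ε : ℝ} (h : ∀ k < j + m, ∀ z ∈ S.K,
    |S.Pop l (S.win k) z - S.beta k| ≤ ε) {z : ℝ} (hz : z ∈ S.K) :
    S.Pop l (fun z => Dint (j * S.chi) ((j + m : ℕ) * S.chi) (S.F z)) z ≤ m * (S.Lam + ε) := by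
  have h1 : S.Pop l (fun z => Dint (j * S.chi) ((j + m : ℕ) * S.chi) (S.F z)) z ≤
      S.Pop l (fun z => ∑ k ∈ Finset.range m, S.win (j + k) z) z :=
    S.Pop_mono l (fun z hz => (S.Dint_sum_win hz j m).le) hz
  rw [Pop_sum] at h1
  refine h1.trans ?_
  calc _ ≤ ∑ k ∈ Finset.range m, (S.Lam + ε) := Finset.sum_le_sum fun k hk => by
        have := (abs_le.1 (h (j + k) (by have := Finset.mem_range.1 hk; omega) z hz)).2
        linarith [S.beta_le_Lam (j + k)]
    _ = _ := by rw [Finset.sum_const, Finset.card_range, nsmul_eq_mul]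

theorem Pop_Dint_ge {j m l : ℕ} {ε η : ℝ} (h : ∀ k < j + m, ∀ z ∈ S.K,
    |S.Pop l (S.win k) z - S.beta k| ≤ ε) (hη : ∀ k ≥ j, S.Lam - η ≤ S.beta k)
    {z : ℝ} (hz : z ∈ S.K) :
    m * (S.Lam - η - ε) ≤ S.Pop l (fun z => Dint (j * S.chi) ((j + m : ℕ) * S.chi) (S.F z)) z := by
  have h1 : S.Pop l (fun z => ∑ k ∈ Finset.range m, S.win (j + k) z) z ≤
      S.Pop l (fun z => Dint (j * S.chi) ((j + m : ℕ) * S.chi) (S.F z)) z :=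
    S.Pop_mono l (fun z hz => (S.Dint_sum_win hz j m).ge) hz
  rw [Pop_sum] at h1
  refine le_trans ?_ h1
  calc _ = ∑ k ∈ Finset.range m, (S.Lam - η - ε) := by rw [Finset.sum_const, Finset.card_range, nsmul_eq_mul]
    _ ≤ _ := Finset.sum_le_sum fun k hk => by
        have := (abs_le.1 (h (j + k) (by have := Finset.mem_range.1 hk; omega) z hz)).1
        linarith [hη (j + k) (by omega)]

end Fam
end
end

section
open MeasureTheory Filter Set Topology
open scoped ENNReal
noncomputable section

namespace Fam
variable {N : ℕ} (S : Fam N)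

theorem block_sum {M L L0 n k0 l1 : ℕ} {δ0 X C1 cL C2 : ℝ} (hδ0 : 0 < δ0) (hcL : 0 < cL)
    (hgain : ∀ l ≥ l1, ∀ z1 ∈ S.K, ∀ z2 ∈ S.K,
      ∀ δ1 δ2 : ℝ, S.b ^ (l + M + L) < max |z2 - z1| |δ2 - δ1| →
      max |z2 - z1| |δ2 - δ1| ≤ S.b ^ (l + M + L0) →
      δ0 ≤ wavg l (fun u => JB ((l + M + L : ℕ) * S.chi) (S.sg l z1 δ1 u) (S.sg l z2 δ2 u) -
        JB ((l + M : ℕ) * S.chi) (S.sg l z1 δ1 u) (S.sg l z2 δ2 u)))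
    (hX : ∀ l ≥ l1, ∀ z ∈ S.K,
      X ≤ S.Pop l (fun z => Dint (M * S.chi) ((M + L : ℕ) * S.chi) (S.F z)) z)
    {J : ℤ} (hJ0 : 0 ≤ J) (hJ : 1 ≤ J * S.b ^ L0)
    (hC1 : C1 = 2 + Real.log 2 + Real.log ((2 * J + 1) ^ 2))
    (hC2 : C2 = 4 * (Real.log 7 + L * S.chi)) (hcC : cL * C2 ≤ δ0)
    (hk0 : l1 + M ≤ k0 * L) {z : ℝ} (hz : z ∈ S.K) (j : ℕ) :
    j * X + cL * (Hent (S.cel ((k0 + j) * L + L0) n z) - Hent (S.cel (k0 * L + L0) n z) - j * C1) ≤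
      Dint ((n + k0 * L : ℕ) * S.chi) ((n + (k0 + j) * L : ℕ) * S.chi) (S.F z) := by
  induction j with
  | zero => 
    rw [Dint_eq_Bf (S.hF z hz)]; simp
  | succ j ih =>
    have hle : l1 + M ≤ (k0 + j) * L := hk0.trans (Nat.mul_le_mul_right _ (Nat.le_add_right _ _))
    obtain ⟨l, hl⟩ : ∃ l, (k0 + j) * L = l + M := ⟨(k0 + j) * L - M, by omega⟩
    have hl1 : l1 ≤ l := by omega
    have hb := S.block (n := n) hδ0 (hgain l hl1) hJ hz
    have he := S.ent_step (e := l + M + L0) (L := L) (n := n) hJ0 z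
    have hx := hX (n + l) (by omega) z hz
    have e1 : (k0 + (j + 1)) * L = l + M + L := by rw [← add_assoc, add_mul, hl, one_mul]
    have e2 : l + M + L + L0 = l + M + L0 + L := by ring
    rw [hl] at ih
    rw [e1, e2]
    set P := pavg (S.cel (l + M + L0) n z) (fun w w' =>
        if nearB J (S.cel (l + M + L0 + L) n z w') (S.cel (l + M + L0 + L) n z w) then (0:ℝ) else 1)
      with hP
    have hP0 : 0 ≤ P := by
      rw [hP]
      have : pavg (S.cel (l + M + L0) n z) (fun _ _ => (0:ℝ)) = 0 := by
        have := pavg_mul (S.cel (l + M + L0) n z) 0 (fun _ _ => (0:ℝ))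
        simpa using this
      refine this.symm.le.trans ?_
      apply pavg_mono
      intro w w' _
      split_ifs <;> norm_num
    have hD : Dint ((n + k0 * L : ℕ) * S.chi) ((n + (l + M + L) : ℕ) * S.chi) (S.F z) =
        Dint ((n + k0 * L : ℕ) * S.chi) ((n + (l + M) : ℕ) * S.chi) (S.F z) +
        Dint ((n + (l + M) : ℕ) * S.chi) ((n + (l + M + L) : ℕ) * S.chi) (S.F z) := by
      have h := S.hF z hz
      rw [Dint_eq_Bf h, Dint_eq_Bf h, Dint_eq_Bf h]; ring
    rw [hD]
    rw [← hC1, ← hC2] at he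
    have h3 := mul_le_mul_of_nonneg_left he hcL.le
    have h4 := mul_le_mul_of_nonneg_right hcC hP0
    rw [Nat.cast_succ]
    linarith

set_option maxHeartbeats 2000000 in
theorem thmE (hNA : S.NA) (hSep : S.Sep) : Real.log 2 * min S.chi (Real.log N) ≤ S.Lam := by
  by_contra hcon
  rw [not_le] at hcon
  have l2 := Real.log_pos one_lt_two
  have hchi := S.chi_pos
  have hN0 := S.hN0
  have hLam : S.Lam < S.chi * Real.log 2 := by
    have := mul_le_mul_of_nonneg_left (min_le_left S.chi (Real.log N)) l2.le
    linarith
  have hLamN : S.Lam < Real.log 2 * Real.log N :=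
    hcon.trans_le (mul_le_mul_of_nonneg_left (min_le_right _ _) l2.le)
  obtain ⟨δ0, hδ0, L0, M0, hgain⟩ := S.JB_gain hNA hLam
  obtain ⟨q, hq⟩ := hSep
  set J : ℤ := ⌈1 / S.b ^ L0⌉ with hJd
  have hbL0 := S.bpow_pos L0
  have hJ1 : 1 ≤ J * S.b ^ L0 := by
    have := Int.le_ceil (1 / S.b ^ L0)
    rwa [div_le_iff₀ hbL0] at this
  have hJ0 : 0 ≤ J := Int.ceil_nonneg (by positivity)
  have hJ0' : (0:ℝ) ≤ J := by exact_mod_cast hJ0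
  set C1 := 2 + Real.log 2 + Real.log ((2 * (J:ℝ) + 1) ^ 2) with hC1
  have hC10 : 0 < C1 := by
    have : 0 ≤ Real.log ((2 * (J:ℝ) + 1) ^ 2) := Real.log_nonneg (one_le_pow₀ (by linarith))
    linarith
  set g2 := Real.log N - S.Lam / Real.log 2 with hg2
  have hg2p : 0 < g2 := by
    rw [hg2, sub_pos, div_lt_iff₀ l2]; linarith
  -- L
  obtain ⟨L, hLb⟩ := exists_nat_ge (4 * q * C1 / g2 + 1)
  have hL1 : (1:ℝ) ≤ L := by
    have : 0 ≤ 4 * q * C1 / g2 := by positivity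
    linarith
  have hLp : (0:ℝ) < L := by linarith
  have hqL : q * C1 / L ≤ g2 / 4 := by
    rw [div_le_iff₀ hLp]
    have h : 4 * q * C1 / g2 ≤ L := by linarith
    rw [div_le_iff₀ hg2p] at h
    linarith
  set C2 := 4 * (Real.log 7 + L * S.chi) with hC2
  have l7 : 0 < Real.log 7 := Real.log_pos (by norm_num)
  have hC2p : 0 < C2 := by positivity
  set cL := δ0 / C2 with hcL
  have hcLp : 0 < cL := by positivity
  obtain ⟨η, hη, hη1, hη2⟩ : ∃ η > 0, η / Real.log 2 ≤ g2 / 4 ∧ 3 * η * q ≤ cL * g2 / 8 := by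
    refine ⟨min (g2 / 4 * Real.log 2) (cL * g2 / 8 / (3 * (q + 1))), by positivity, ?_, ?_⟩
    · rw [div_le_iff₀ l2]; exact min_le_left _ _
    · have h := min_le_right (g2 / 4 * Real.log 2) (cL * g2 / 8 / (3 * ((q:ℝ) + 1)))
      rw [le_div_iff₀ (by positivity)] at h
      have : 0 < min (g2 / 4 * Real.log 2) (cL * g2 / 8 / (3 * ((q:ℝ) + 1))) := by positivity
      linarith
  obtain ⟨M1, hM1⟩ := S.exists_beta_gt hη
  set M := max M0 M1 with hM
  obtain ⟨l0, hl0⟩ := hgain M (le_max_left _ _) L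
  obtain ⟨l0', hl0'⟩ := S.beta_spec_fin (M + L) η hη
  set l1 := max l0 l0' with hl1
  set k0 := l1 + M with hk0
  have hLn : 1 ≤ L := by exact_mod_cast hL1
  have hk0L : l1 + M ≤ k0 * L := Nat.le_mul_of_pos_right _ hLn
  obtain ⟨C', hC'⟩ := S.ent_start (k0 * L + L0)
  obtain ⟨n0, hn0⟩ := exists_nat_gt ((3 * η * L + cL * (C' / Real.log 2 + C1)) / (cL * g2 * (3 / 8)))
  obtain ⟨n, hn, hsep⟩ := hq n0
  set K1 := q * n / L + 1 with hK1
  have hK1a : K1 * L ≤ q * n + L := by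
    rw [hK1, add_mul, one_mul]; exact Nat.add_le_add_right (Nat.div_mul_le_self _ _) _
  have hK1b : q * n < K1 * L := by
    rw [hK1]; exact Nat.lt_mul_of_div_lt (Nat.lt_succ_self _) hLn
  obtain ⟨m, hm⟩ := S.beta_spec_fin (n + k0 * L + K1 * L) η hη
  obtain ⟨z, hz⟩ := S.hKne
  have hpt : ∀ z ∈ S.K, K1 * (L * (S.Lam - η - η)) + cL * (n * Real.log N - C' / Real.log 2 - K1 * C1)
      ≤ Dint ((n + k0 * L : ℕ) * S.chi) ((n + k0 * L + K1 * L : ℕ) * S.chi) (S.F z) +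
        cL / Real.log 2 * Dint (0:ℕ) ((0 + n : ℕ) * S.chi) (S.F z) := by
    intro z hz
    have h := S.block_sum (n := n) (k0 := k0) (l1 := l1) (X := L * (S.Lam - η - η)) hδ0 hcLp
      (fun l hl => hl0 l ((le_max_left _ _).trans hl))
      (fun l hl z hz => S.Pop_Dint_ge (fun k hk z hz => hl0' k hk l ((le_max_right _ _).trans hl) z hz)
        (fun k hk => hM1 k ((le_max_right _ _).trans hk)) hz)
      hJ0 hJ1 hC1 hC2 (by rw [hcL]; field_simp; rfl) hk0L hz K1
    have h1 := hC' n z hz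
    rw [S.ent_end (hsep z hz) (by rw [add_mul]; omega)] at h
    have e1 : n + (k0 + K1) * L = n + k0 * L + K1 * L := by ring
    rw [e1] at h
    have h2 : Hent (S.cel (k0 * L + L0) n z) ≤ (Dint 0 (n * S.chi) (S.F z) + C') / Real.log 2 := by
      rw [le_div_iff₀ l2]; linarith
    have h3 := mul_le_mul_of_nonneg_left h2 hcLp.le
    have e2 : cL * ((Dint 0 (n * S.chi) (S.F z) + C') / Real.log 2) =
      cL / Real.log 2 * Dint 0 (n * S.chi) (S.F z) + cL * (C' / Real.log 2) := by ring
    rw [e2] at h3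
    rw [zero_add]
    push_cast at h ⊢
    linarith
  have hP := S.Pop_mono m hpt hz
  rw [S.Pop_const] at hP
  have hPa : ∀ f g : ℝ → ℝ, ∀ a : ℝ, S.Pop m (fun z => f z + a * g z) z =
      S.Pop m f z + a * S.Pop m g z := by
    intro f g a
    unfold Pop
    rw [wavg_add, wavg_mul]
  rw [hPa] at hP
  have hu1 := S.Pop_Dint_le (j := n + k0 * L) (m := K1 * L) (l := m) (ε := η)
    (fun k hk z hz => hm k hk m le_rfl z hz) hz
  have hu2 := S.Pop_Dint_le (j := 0) (m := n) (l := m) (ε := η)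
    (fun k hk z hz => hm k (by omega) m le_rfl z hz) hz
  have e0 : ((0:ℕ):ℝ) * S.chi = ((0:ℕ):ℝ) := by simp
  rw [e0] at hu2
  have hu3 := mul_le_mul_of_nonneg_left hu2 (a := cL / Real.log 2) (by positivity)
  push_cast at hP hu1 hu3
  have hK1a' : (K1:ℝ) * L ≤ q * n + L := by exact_mod_cast hK1a
  have hn0' : (n0:ℝ) ≤ n := by exact_mod_cast hn
  rw [div_lt_iff₀ (by positivity)] at hn0
  have hnn : (0:ℝ) ≤ n := by positivity
  have hfin : cL * (n * (Real.log N - (S.Lam + η) / Real.log 2) - C' / Real.log 2 - K1 * C1) ≤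
      3 * η * (K1 * L) := by
    have : cL / Real.log 2 * (n * (S.Lam + η)) = cL * (n * ((S.Lam + η) / Real.log 2)) := by ring
    rw [this] at hu3
    linarith
  have hK1C : K1 * C1 ≤ n * (g2 / 4) + C1 := by
    have h1 : (K1:ℝ) ≤ q * n / L + 1 := by
      rw [← sub_le_iff_le_add, le_div_iff₀ hLp]; linarith
    have h2 := mul_le_mul_of_nonneg_right h1 hC10.le
    have h3 : (q * n / L + 1) * C1 = n * (q * C1 / L) + C1 := by ring
    have h4 := mul_le_mul_of_nonneg_left hqL hnn
    linarith
  have h5 : (S.Lam + η) / Real.log 2 ≤ Real.log N - g2 + g2 / 4 := by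
    rw [add_div, hg2]; linarith
  have h6 : n * (3 / 4 * g2) ≤ n * (Real.log N - (S.Lam + η) / Real.log 2) :=
    mul_le_mul_of_nonneg_left (by linarith) hnn
  have h7 : cL * (n * (g2 / 2) - C' / Real.log 2 - C1) ≤ 3 * η * (K1 * L) :=
    le_trans (mul_le_mul_of_nonneg_left (by linarith) hcLp.le) hfin
  have h8 : 3 * η * (K1 * L) ≤ 3 * η * (q * n + L) :=
    mul_le_mul_of_nonneg_left hK1a' (by positivity)
  have h9 : 3 * η * q * n ≤ cL * g2 / 8 * n := mul_le_mul_of_nonneg_right hη2 hnn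
  have h10 : n0 * (cL * g2 * (3 / 8)) ≤ n * (cL * g2 * (3 / 8)) :=
    mul_le_mul_of_nonneg_right hn0' (by positivity)
  linarith

/-- uniform entropy growth -/
theorem Bf_lower {ε : ℝ} (hε : 0 < ε) : ∃ m0 : ℕ, ∀ m ≥ m0, ∀ z ∈ S.K,
    m * (S.Lam - ε) ≤ Bf (m * S.chi) (S.F z) := by
  obtain ⟨j, hj⟩ := S.exists_beta_gt (half_pos (half_pos hε))
  obtain ⟨l0, hl0⟩ := S.beta_spec j (ε / 4) (by positivity)
  -- for l ≥ l0 : window l+j of F_z at least Lam - ε/2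
  have hw : ∀ k ≥ l0 + j, ∀ z ∈ S.K, S.Lam - ε / 2 ≤ S.win k z := by
    intro k hk z hz
    obtain ⟨l, rfl⟩ : ∃ l, k = l + j := ⟨k - j, by omega⟩
    have h1 := S.Dint_ge_Pop l (j := j) (k := j + 1) (by omega) hz
    have h2 := (abs_le.1 (hl0 l (by omega) z hz)).1
    have h3 := hj j le_rfl
    unfold win at h2 ⊢
    have e : l + j + 1 = l + (j + 1) := by ring
    rw [e]
    linarith
  set k1 := l0 + j with hk1
  obtain ⟨m1, hm1⟩ := exists_nat_ge (k1 * |S.Lam - ε / 2| / (ε / 2))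
  rw [div_le_iff₀ (by positivity)] at hm1
  refine ⟨max k1 m1, fun m hm z hz => ?_⟩
  have hmk : k1 ≤ m := (le_max_left _ _).trans hm
  have hmm : (m1:ℝ) ≤ m := by exact_mod_cast (le_max_right _ _).trans hm
  obtain ⟨p, rfl⟩ : ∃ p, m = k1 + p := ⟨m - k1, by omega⟩
  have h1 := S.Dint_sum_win hz k1 p
  have h2 : p * (S.Lam - ε / 2) ≤ ∑ k ∈ Finset.range p, S.win (k1 + k) z := by
    calc (p:ℝ) * (S.Lam - ε / 2) = ∑ k ∈ Finset.range p, (S.Lam - ε / 2) := by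
          rw [Finset.sum_const, Finset.card_range, nsmul_eq_mul]
      _ ≤ _ := Finset.sum_le_sum fun k _ => hw _ (by omega) z hz
  rw [Dint_eq_Bf (S.hF z hz)] at h1
  have h3 := Bf_nonneg (S.hF z hz) (k1 * S.chi)
  have h4 : k1 * (S.Lam - ε / 2) ≤ k1 * |S.Lam - ε / 2| :=
    mul_le_mul_of_nonneg_left (le_abs_self _) (by positivity)
  push_cast at *
  nlinarith

end Fam
end
end

section
open MeasureTheory Filter Set Topology
open scoped ENNReal
noncomputable section

theorem wavg_rpow_le {N n : ℕ} (hN : 0 < N) {p Y : (Fin n → Fin N) → ℝ} {s : ℝ} (hs : 0 < s)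
    (hp : ∀ w, 0 ≤ p w)
    (hY : ∀ w, p w ≠ 0 → wavg n (fun w' => if p w' ≠ 0 then (1:ℝ) else 0) ≤ Y w) :
    (wavg n p) ^ (1 + s) ≤ wavg n (fun w => Y w ^ s * p w ^ (1 + s)) := by
  have hT : (0:ℝ) < (N:ℝ) ^ n := by positivity
  set T := (N:ℝ) ^ n with hTd
  set W := Finset.univ.filter (fun w => p w ≠ 0) with hW
  have h1 : ∑ w, p w = ∑ w ∈ W, p w := by
    rw [hW, Finset.sum_filter]
    exact Finset.sum_congr rfl fun w _ => by split_ifs with h <;> [rfl; exact not_not.1 h]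
  have hcard : wavg n (fun w' => if p w' ≠ 0 then (1:ℝ) else 0) = W.card / T := by
    unfold wavg
    rw [Finset.sum_boole]
  have h2 := Real.rpow_sum_le_const_mul_sum_rpow_of_nonneg W (f := p) (p := 1 + s) (by linarith)
    (fun w _ => hp w)
  rw [add_sub_cancel_left] at h2
  have h3 : ∑ w, Y w ^ s * p w ^ (1 + s) = ∑ w ∈ W, Y w ^ s * p w ^ (1 + s) := by
    rw [hW, Finset.sum_filter]
    exact Finset.sum_congr rfl fun w _ => by
      split_ifs with h
      · rfl
      · rw [not_not.1 h, Real.zero_rpow (by linarith), mul_zero]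
  unfold wavg
  rw [h1, h3, ← hTd, Real.div_rpow (Finset.sum_nonneg fun w _ => hp w) hT.le]
  have e1 : T ^ (1 + s) = T * T ^ s := by rw [Real.rpow_add hT, Real.rpow_one]
  have hTs : 0 < T ^ s := Real.rpow_pos_of_pos hT s
  calc (∑ w ∈ W, p w) ^ (1 + s) / T ^ (1 + s)
      ≤ ((W.card : ℝ) ^ s * ∑ w ∈ W, p w ^ (1 + s)) / T ^ (1 + s) :=
        div_le_div_of_nonneg_right h2 (by rw [e1]; positivity)
    _ = (∑ w ∈ W, (W.card / T : ℝ) ^ s * p w ^ (1 + s)) / T := by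
        rw [← Finset.mul_sum, Real.div_rpow (by positivity) hT.le, e1]
        field_simp
    _ ≤ _ := by
        apply div_le_div_of_nonneg_right _ hT.le
        apply Finset.sum_le_sum
        intro w hw
        apply mul_le_mul_of_nonneg_right _ (Real.rpow_nonneg (hp w) _)
        apply Real.rpow_le_rpow (by positivity) _ hs.le
        rw [← hcard]
        exact hY w (Finset.mem_filter.1 hw).2

theorem exp_le_quad {x : ℝ} (hx : x ≤ 0) : Real.exp x ≤ 1 + x + x ^ 2 := by
  by_cases h : -1 ≤ x
  · have := (abs_le.1 (Real.abs_exp_sub_one_sub_id_le (x := x) (abs_le.2 ⟨h, by linarith⟩))).2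
    linarith
  · have : Real.exp x ≤ 1 := Real.exp_le_one_iff.2 hx
    nlinarith

theorem mul_log_sq_le {p : ℝ} (h0 : 0 < p) (h1 : p ≤ 1) : p * Real.log p ^ 2 ≤ 4 := by
  have hs : 0 < Real.sqrt p := Real.sqrt_pos.2 h0
  have h2 := Real.log_le_sub_one_of_pos (inv_pos.2 hs)
  rw [Real.log_inv, Real.log_sqrt h0.le] at h2
  have h3 : -Real.log p ≤ 2 * (Real.sqrt p)⁻¹ := by linarith
  have h4 : 0 ≤ -Real.log p := by linarith [Real.log_nonpos h0.le h1]
  have h5 : (-Real.log p) ^ 2 ≤ (2 * (Real.sqrt p)⁻¹) ^ 2 := pow_le_pow_left₀ h4 h3 2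
  rw [mul_pow, inv_pow, Real.sq_sqrt h0.le] at h5
  have h6 := mul_le_mul_of_nonneg_left h5 h0.le
  have : p * (2 ^ 2 * p⁻¹) = 4 := by field_simp; norm_num
  rw [this] at h6
  linarith [neg_sq (Real.log p)]

theorem rpow_small {p s : ℝ} (h0 : 0 < p) (h1 : p ≤ 1) (hs : 0 ≤ s) :
    p ^ (1 + s) ≤ p - s * Real.negMulLog p + s ^ 2 * 4 := by
  rw [Real.rpow_add h0, Real.rpow_one, Real.rpow_def_of_pos h0]
  have h2 := exp_le_quad (x := Real.log p * s)
    (mul_nonpos_of_nonpos_of_nonneg (Real.log_nonpos h0.le h1) hs)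
  have h3 := mul_le_mul_of_nonneg_left h2 h0.le
  have h4 := mul_le_mul_of_nonneg_left (mul_log_sq_le h0 h1) (sq_nonneg s)
  unfold Real.negMulLog
  linarith

def Qr (s r : ℝ) (F : ℝ → ℝ) : ℝ := r⁻¹ * ∫ x, (pw F r x) ^ (1 + s)

section
variable {A s : ℝ} {F : ℝ → ℝ}

theorem IsCdf.int_rpow (h : IsCdf A F) (hs : 0 < s) (r : ℝ) :
    Integrable (fun x => (pw F r x) ^ (1 + s)) :=
  h.integrable_phi (f := fun x => x ^ (1 + s))
    (continuous_id.rpow_const fun _ => Or.inr (by linarith)) (Real.zero_rpow (by linarith))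

theorem Qr_nonneg (h : IsCdf A F) {r : ℝ} (hr : 0 < r) : 0 ≤ Qr s r F :=
  mul_nonneg (inv_pos.2 hr).le (integral_nonneg fun x => Real.rpow_nonneg (h.pw_nonneg hr.le x) _)

theorem Qr_le_one (h : IsCdf A F) (hs : 0 < s) {r : ℝ} (hr : 0 < r) : Qr s r F ≤ 1 := by
  unfold Qr
  rw [inv_mul_le_iff₀ hr, mul_one]
  calc _ ≤ ∫ x, pw F r x := integral_mono (h.int_rpow hs r) h.integrable_pw fun x => by
        have h0 := h.pw_nonneg hr.le x
        have h1 := h.pw_le_one (r := r) x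
        calc pw F r x ^ (1 + s) ≤ pw F r x ^ (1:ℝ) :=
              Real.rpow_le_rpow_of_exponent_ge_of_imp h0 h1 (by linarith) (fun _ h9 => absurd h9 (by positivity))
          _ = _ := Real.rpow_one _
    _ = r := h.integral_pw r

theorem Qr_small (h : IsCdf A F) (hs : 0 < s) (hA : 0 < A) {r : ℝ} (hr : 0 < r) (hr1 : r ≤ 1) :
    Qr s r F ≤ 1 - s * Phi r F + s ^ 2 * (r⁻¹ * (8 * (A + 1))) := by
  have hi : Integrable (fun x => Set.indicator (Icc (-(A + 1)) (A + 1)) (fun _ => s ^ 2 * 4) x) :=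
    (integrable_indicator_iff measurableSet_Icc).2 (integrableOn_const (by simp))
  have hI : ∫ x, Set.indicator (Icc (-(A + 1)) (A + 1)) (fun _ => s ^ 2 * 4) x =
      s ^ 2 * (8 * (A + 1)) := by
    rw [integral_indicator measurableSet_Icc, setIntegral_const, Measure.real, Real.volume_Icc,
      ENNReal.toReal_ofReal (by linarith), smul_eq_mul]
    ring
  have hb : ∫ x, (pw F r x) ^ (1 + s) ≤ ∫ x, (pw F r x - s * Real.negMulLog (pw F r x) +
      Set.indicator (Icc (-(A + 1)) (A + 1)) (fun _ => s ^ 2 * 4) x) := by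
    apply integral_mono (h.int_rpow hs r)
      ((h.integrable_pw.sub ((h.int_nml r).const_mul s)).add hi)
    intro x
    have h0 := h.pw_nonneg hr.le x
    have hind : 0 ≤ Set.indicator (Icc (-(A + 1)) (A + 1)) (fun _ => s ^ 2 * 4) x :=
      indicator_nonneg (fun _ _ => by positivity) _
    rcases h0.eq_or_lt with h0 | h0
    · show pw F r x ^ (1 + s) ≤ pw F r x - s * Real.negMulLog (pw F r x) +
        Set.indicator (Icc (-(A + 1)) (A + 1)) (fun _ => s ^ 2 * 4) x
      rw [← h0, Real.zero_rpow (by linarith), Real.negMulLog_zero]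
      simpa using hind
    · have hx : x ∈ Icc (-(A + 1)) (A + 1) := by
        apply abs_le.1
        by_contra hcon
        rw [not_le] at hcon
        have := h.pw_zero (r := r) (x := x) (by rw [abs_of_pos hr]; linarith)
        linarith
      show pw F r x ^ (1 + s) ≤ pw F r x - s * Real.negMulLog (pw F r x) +
        Set.indicator (Icc (-(A + 1)) (A + 1)) (fun _ => s ^ 2 * 4) x
      rw [indicator_of_mem hx]
      exact rpow_small h0 (h.pw_le_one x) hs.le
  have hi2 : Integrable (fun x => pw F r x - s * Real.negMulLog (pw F r x)) :=
    h.integrable_pw.sub ((h.int_nml r).const_mul s)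
  rw [integral_add hi2 hi,
    integral_sub h.integrable_pw ((h.int_nml r).const_mul s), integral_const_mul, h.integral_pw,
    hI] at hb
  unfold Qr Phi
  have := mul_le_mul_of_nonneg_left hb (inv_pos.2 hr).le
  have e : r⁻¹ * r = 1 := inv_mul_cancel₀ hr.ne'
  linarith

theorem Qr_aff {ρ r : ℝ} (hρ : 0 < ρ) (t : ℝ) : Qr s r (aff ρ t F) = Qr s (r / ρ) F := by
  unfold Qr
  simp_rw [pw_aff F hρ]
  rw [integral_comp_aff (fun y => pw F (r / ρ) y ^ (1 + s)) hρ]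
  rw [inv_div]; ring

theorem Qr_meas (h : IsCdf A F) : Measurable (fun τ => Qr s (Real.exp (-τ)) F) := by
  have hF : Measurable F := h.mono.measurable
  have : StronglyMeasurable (fun τ => ∫ x, (pw F (Real.exp (-τ)) x) ^ (1 + s)) := by
    apply StronglyMeasurable.integral_prod_right
    apply Measurable.stronglyMeasurable
    unfold pw Function.uncurry
    simp only
    apply Measurable.pow_const
    fun_prop
  unfold Qr
  exact (by fun_prop : Measurable fun τ : ℝ => (Real.exp (-τ))⁻¹).mul this.measurable

theorem Qr_int (h : IsCdf A F) (hs : 0 < s) (a b : ℝ) :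
    IntervalIntegrable (fun τ => Qr s (Real.exp (-τ)) F) volume a b := by
  refine IntervalIntegrable.mono_fun' (g := fun _ => 1) (by simp) (Qr_meas h).aestronglyMeasurable ?_
  refine Eventually.of_forall fun τ => ?_
  show ‖Qr s (Real.exp (-τ)) F‖ ≤ 1
  rw [Real.norm_eq_abs, abs_of_nonneg (Qr_nonneg h (Real.exp_pos _))]
  exact Qr_le_one h hs (Real.exp_pos _)

/-- pointwise Young bound -/
theorem young_point {k : ℕ} (hk : 0 < k) (hs : 0 < s) {p : ℝ} {q : ℕ → ℝ} (hp : 0 ≤ p)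
    (hq : ∀ i, 0 ≤ q i) :
    p * (∑ i ∈ Finset.range k, q i) ^ s ≤ (k:ℝ) ^ s * (1 / (1 + s) * p ^ (1 + s) +
      s / (1 + s) * ((k:ℝ)⁻¹ * ∑ i ∈ Finset.range k, q i ^ (1 + s))) := by
  have hk' : (0:ℝ) < k := by exact_mod_cast hk
  set G := ∑ i ∈ Finset.range k, q i with hG
  have hG0 : 0 ≤ G := Finset.sum_nonneg fun i _ => hq i
  have h1 : (G / k) ^ (1 + s) ≤ (k:ℝ)⁻¹ * ∑ i ∈ Finset.range k, q i ^ (1 + s) := by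
    have := Real.rpow_sum_le_const_mul_sum_rpow_of_nonneg (Finset.range k) (f := q) (p := 1 + s)
      (by linarith) (fun i _ => hq i)
    rw [Finset.card_range, add_sub_cancel_left, ← hG] at this
    rw [Real.div_rpow hG0 hk'.le, Real.rpow_add hk' 1 s, Real.rpow_one]
    have hks : 0 < (k:ℝ) ^ s := Real.rpow_pos_of_pos hk' s
    rw [div_le_iff₀ (by positivity)]
    calc _ ≤ _ := this
      _ = _ := by field_simp
  have h2 := Real.geom_mean_le_arith_mean2_weighted (w₁ := 1 / (1 + s)) (w₂ := s / (1 + s))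
    (p₁ := p ^ (1 + s)) (p₂ := (G / k) ^ (1 + s)) (by positivity) (by positivity)
    (Real.rpow_nonneg hp _) (Real.rpow_nonneg (by positivity) _) (by field_simp)
  rw [← Real.rpow_mul hp, ← Real.rpow_mul (by positivity)] at h2
  have e1 : (1 + s) * (1 / (1 + s)) = 1 := by field_simp
  have e2 : (1 + s) * (s / (1 + s)) = s := by field_simp
  rw [e1, e2, Real.rpow_one] at h2
  have e3 : G ^ s = (k:ℝ) ^ s * (G / k) ^ s := by
    rw [← Real.mul_rpow hk'.le (by positivity)]; congr 1; field_simp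
  rw [e3]
  calc p * ((k:ℝ) ^ s * (G / k) ^ s) = (k:ℝ) ^ s * (p * (G / k) ^ s) := by ring
    _ ≤ _ := by
        apply mul_le_mul_of_nonneg_left _ (by positivity)
        refine h2.trans ?_
        have := mul_le_mul_of_nonneg_left h1 (a := s / (1 + s)) (by positivity)
        linarith

theorem young_int (h : IsCdf A F) {k : ℕ} (hk : 0 < k) (hs : 0 < s) {r : ℝ} (a : ℕ → ℝ) :
    Integrable (fun x => (k:ℝ) ^ s * (1 / (1 + s) * pw F r x ^ (1 + s) +
      s / (1 + s) * ((k:ℝ)⁻¹ * ∑ i ∈ Finset.range k, pw F r (x + a i) ^ (1 + s)))) ∧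
    ∫ x, ((k:ℝ) ^ s * (1 / (1 + s) * pw F r x ^ (1 + s) +
      s / (1 + s) * ((k:ℝ)⁻¹ * ∑ i ∈ Finset.range k, pw F r (x + a i) ^ (1 + s)))) =
    (k:ℝ) ^ s * ∫ x, pw F r x ^ (1 + s) := by
  have hk' : (0:ℝ) < k := by exact_mod_cast hk
  have hi := h.int_rpow hs r
  have hi' : ∀ i, Integrable (fun x => pw F r (x + a i) ^ (1 + s)) := fun i =>
    hi.comp_add_right (a i)
  have hS : Integrable (fun x => ∑ i ∈ Finset.range k, pw F r (x + a i) ^ (1 + s)) :=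
    integrable_finsetSum _ fun i _ => hi' i
  refine ⟨((hi.const_mul _).add ((hS.const_mul _).const_mul _)).const_mul _, ?_⟩
  rw [integral_const_mul, integral_add (hi.const_mul _) ((hS.const_mul _).const_mul _),
    integral_const_mul, integral_const_mul, integral_const_mul,
    integral_finsetSum _ (fun i _ => hi' i)]
  have : ∀ i, ∫ x, pw F r (x + a i) ^ (1 + s) = ∫ x, pw F r x ^ (1 + s) := fun i =>
    integral_add_right_eq_self (fun x => pw F r x ^ (1 + s)) (a i)
  simp_rw [this]
  rw [Finset.sum_const, Finset.card_range, nsmul_eq_mul]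
  congr 1
  field_simp
end

end
end

section
open MeasureTheory Filter Set Topology
open scoped ENNReal
noncomputable section

namespace Fam
variable {N : ℕ} (S : Fam N)

def Yw (n : ℕ) (z : ℝ) (w : Fin n → Fin N) : ℝ :=
  wavg n (fun w' => if |S.tw n w' z - S.tw n w z| ≤ 2 * (S.A + 1) * S.b ^ n then (1:ℝ) else 0)

def QT (s T z : ℝ) : ℝ :=
  (Real.log 2)⁻¹ * ∫ τ in T..(T + Real.log 2), Qr s (Real.exp (-τ)) (S.F z)

theorem Yw_nonneg (n : ℕ) (z : ℝ) (w : Fin n → Fin N) : 0 ≤ S.Yw n z w :=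
  wavg_nonneg fun w' => by split_ifs <;> norm_num

theorem Yw_le_one (n : ℕ) (z : ℝ) (w : Fin n → Fin N) : S.Yw n z w ≤ 1 := by
  have h := wavg_const (n := n) S.hN0 1
  rw [← h]
  exact wavg_mono fun w' => by split_ifs <;> norm_num

theorem pw_wavg (n : ℕ) {z : ℝ} (hz : z ∈ S.K) (r x : ℝ) :
    pw (S.F z) r x = wavg n (fun w => pw (S.sig n z w) r x) := by
  unfold pw
  rw [S.self_sim n hz, S.self_sim n hz, wavg_sub]

theorem pw_sig_ne (n : ℕ) {z : ℝ} (hz : z ∈ S.K) (w : Fin n → Fin N) {r x : ℝ} (hr : 0 < r)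
    (hrb : r ≤ S.b ^ n) (h : pw (S.sig n z w) r x ≠ 0) :
    |x - S.tw n w z| ≤ (S.A + 1) * S.b ^ n := by
  by_contra hcon
  push Not at hcon
  apply h
  have hb := S.bpow_pos n
  unfold sig
  rw [pw_aff _ hb]
  apply (S.hF _ (S.zw_mem n w hz)).pw_zero
  rw [abs_div (x - _), abs_of_pos hb, lt_div_iff₀ hb, abs_of_pos (div_pos hr hb)]
  have : r / S.b ^ n ≤ 1 := (div_le_one hb).2 hrb
  nlinarith

theorem Qr_sig (n : ℕ) (z : ℝ) (w : Fin n → Fin N) (s r : ℝ) :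
    Qr s r (S.sig n z w) = Qr s (r / S.b ^ n) (S.F (S.zw n w z)) := by
  unfold sig
  rw [Qr_aff (S.bpow_pos n)]

theorem wavg_integral (n : ℕ) (f : (Fin n → Fin N) → ℝ → ℝ) (hf : ∀ w, Integrable (f w)) :
    ∫ x, wavg n (fun w => f w x) = wavg n (fun w => ∫ x, f w x) := by
  unfold wavg
  rw [integral_div, integral_finsetSum _ (fun w _ => hf w)]

theorem integrable_wavg (n : ℕ) (f : (Fin n → Fin N) → ℝ → ℝ) (hf : ∀ w, Integrable (f w)) :
    Integrable (fun x => wavg n (fun w => f w x)) := by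
  unfold wavg
  exact (integrable_finsetSum _ (fun w _ => hf w)).div_const _

theorem Qr_step (n : ℕ) {z s r : ℝ} (hz : z ∈ S.K) (hs : 0 < s) (hr : 0 < r) (hrb : r ≤ S.b ^ n) :
    Qr s r (S.F z) ≤ wavg n (fun w => S.Yw n z w ^ s * Qr s (r / S.b ^ n) (S.F (S.zw n w z))) := by
  have hpt : ∀ x, (pw (S.F z) r x) ^ (1 + s) ≤
      wavg n (fun w => S.Yw n z w ^ s * pw (S.sig n z w) r x ^ (1 + s)) := by
    intro x
    rw [S.pw_wavg n hz]
    apply wavg_rpow_le S.hN0 hs (fun w => (S.sig_cdf n hz w).pw_nonneg hr.le x)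
    intro w hw
    apply wavg_mono
    intro w'
    have h1 := S.pw_sig_ne n hz w hr hrb hw
    split_ifs with h2 h3 h3
    · exact le_rfl
    · have h4 := S.pw_sig_ne n hz w' hr hrb h2
      exfalso; apply h3
      rw [abs_le] at *
      constructor <;> linarith
    · norm_num
    · norm_num
  have hI : ∀ w, Integrable (fun x => S.Yw n z w ^ s * pw (S.sig n z w) r x ^ (1 + s)) :=
    fun w => ((S.sig_cdf n hz w).int_rpow hs r).const_mul _
  have h1 := integral_mono ((S.hF z hz).int_rpow hs r) (integrable_wavg n _ hI) hpt
  rw [wavg_integral n _ hI] at h1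
  unfold Qr at *
  calc _ ≤ r⁻¹ * _ := mul_le_mul_of_nonneg_left h1 (by positivity)
    _ = _ := by
      rw [← wavg_mul]
      congr 1; ext w
      rw [integral_const_mul]
      have := S.Qr_sig n z w s r
      unfold Qr at this
      rw [← this]; ring

theorem log2_pos : 0 < Real.log 2 := Real.log_pos (by norm_num)

theorem QT_nonneg {s T z : ℝ} (hz : z ∈ S.K) : 0 ≤ S.QT s T z := by
  have := log2_pos
  unfold QT
  apply mul_nonneg (by positivity)
  exact intervalIntegral.integral_nonneg (by linarith) fun τ _ => Qr_nonneg (S.hF z hz) (Real.exp_pos _)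

theorem QT_le {s T z B : ℝ} (hz : z ∈ S.K) (hs : 0 < s)
    (hB : ∀ τ ∈ Icc T (T + Real.log 2), Qr s (Real.exp (-τ)) (S.F z) ≤ B) : S.QT s T z ≤ B := by
  have := log2_pos
  unfold QT
  have h := intervalIntegral.integral_mono_on (by linarith) (Qr_int (S.hF z hz) hs T (T + Real.log 2))
    (intervalIntegrable_const (c := B)) hB
  rw [intervalIntegral.integral_const, smul_eq_mul] at h
  calc _ ≤ (Real.log 2)⁻¹ * _ := mul_le_mul_of_nonneg_left h (by positivity)
    _ = B := by field_simp; ring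

theorem le_QT {s T z B : ℝ} (hz : z ∈ S.K) (hs : 0 < s)
    (hB : ∀ τ ∈ Icc T (T + Real.log 2), B ≤ Qr s (Real.exp (-τ)) (S.F z)) : B ≤ S.QT s T z := by
  have := log2_pos
  unfold QT
  have h := intervalIntegral.integral_mono_on (by linarith) 
    (intervalIntegrable_const (c := B)) (Qr_int (S.hF z hz) hs T (T + Real.log 2)) hB
  rw [intervalIntegral.integral_const, smul_eq_mul] at h
  calc B = (Real.log 2)⁻¹ * ((T + Real.log 2 - T) * B) := by field_simp; ring
    _ ≤ _ := mul_le_mul_of_nonneg_left h (by positivity)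

theorem QT_le_one {s T z : ℝ} (hz : z ∈ S.K) (hs : 0 < s) : S.QT s T z ≤ 1 :=
  S.QT_le hz hs fun τ _ => Qr_le_one (S.hF z hz) hs (Real.exp_pos _)

/-- interval averages of word averages -/
theorem QT_wavg (n : ℕ) {s T : ℝ} (Z : (Fin n → Fin N) → ℝ) (hZ : ∀ w, Z w ∈ S.K) (hs : 0 < s)
    (y : (Fin n → Fin N) → ℝ) :
    IntervalIntegrable (fun τ => wavg n (fun w => y w * Qr s (Real.exp (-τ)) (S.F (Z w)))) volume
      T (T + Real.log 2) ∧
    (Real.log 2)⁻¹ * ∫ τ in T..(T + Real.log 2),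
      wavg n (fun w => y w * Qr s (Real.exp (-τ)) (S.F (Z w))) = wavg n (fun w => y w * S.QT s T (Z w)) := by
  have hI : ∀ w, IntervalIntegrable (fun τ => y w * Qr s (Real.exp (-τ)) (S.F (Z w))) volume
      T (T + Real.log 2) := fun w => (Qr_int (S.hF _ (hZ w)) hs _ _).const_mul _
  constructor
  · unfold wavg
    have := (IntervalIntegrable.sum Finset.univ (fun w _ => hI w)).div_const ((N:ℝ)^n)
    refine this.congr ?_
    intro τ _
    simp
  · unfold wavg
    rw [intervalIntegral.integral_div, intervalIntegral.integral_finsetSum (fun w _ => hI w)]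
    rw [← mul_div_assoc, Finset.mul_sum]
    congr 1
    apply Finset.sum_congr rfl
    intro w _
    rw [intervalIntegral.integral_const_mul]
    unfold QT; ring

theorem QT_step (n : ℕ) {z s T : ℝ} (hz : z ∈ S.K) (hs : 0 < s) (hT : 0 ≤ T) :
    S.QT s (n * S.chi + T) z ≤ wavg n (fun w => S.Yw n z w ^ s * S.QT s T (S.zw n w z)) := by
  have hl := log2_pos
  obtain ⟨hi, he⟩ := S.QT_wavg n (T := T) (fun w => S.zw n w z) (fun w => S.zw_mem n w hz) hs
    (fun w => S.Yw n z w ^ s)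
  rw [← he]
  unfold QT
  apply mul_le_mul_of_nonneg_left _ (by positivity)
  have e : ∫ τ in (n * S.chi + T)..(n * S.chi + T + Real.log 2), Qr s (Real.exp (-τ)) (S.F z) =
      ∫ τ in T..(T + Real.log 2), Qr s (Real.exp (-(τ + n * S.chi))) (S.F z) := by
    rw [intervalIntegral.integral_comp_add_right (fun τ => Qr s (Real.exp (-τ)) (S.F z))]
    congr 1 <;> ring
  rw [e]
  apply intervalIntegral.integral_mono_on (by linarith) _ hi
  · intro τ hτ
    have e2 : Real.exp (-(τ + n * S.chi)) = Real.exp (-τ) * S.b ^ n := by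
      rw [neg_add, Real.exp_add, S.exp_chi]
    have hb := S.bpow_pos n
    have h1 := S.Qr_step n hz hs (r := Real.exp (-(τ + n * S.chi))) (Real.exp_pos _) (by
      rw [e2]
      have : Real.exp (-τ) ≤ 1 := Real.exp_le_one_iff.2 (by linarith [hτ.1])
      nlinarith)
    rw [e2, mul_div_assoc, div_self hb.ne', mul_one] at h1
    rw [e2]; exact h1
  · have := (Qr_int (S.hF z hz) hs (T + n * S.chi) (T + Real.log 2 + n * S.chi)).comp_add_right (n * S.chi)
    simpa using this

/-- the number of pieces -/
def kk : ℕ := ⌈16 * S.A + 12⌉₊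

theorem kk_ge : 16 * S.A + 12 ≤ S.kk := Nat.le_ceil _
theorem kk_pos : 0 < S.kk := by
  have h1 := S.kk_ge
  have h2 := S.hA0
  have : (0:ℝ) < S.kk := by linarith
  exact_mod_cast this

theorem sum_pw (F : ℝ → ℝ) (r y : ℝ) (k : ℕ) :
    ∑ i ∈ Finset.range k, pw F r (y + i * r) = F (y + k * r) - F y := by
  induction k with
  | zero => simp
  | succ k ih =>
    rw [Finset.sum_range_succ, ih]; unfold pw; push_cast
    rw [show y + k * r + r = y + (k + 1) * r by ring]; ring

theorem Yw_le_mass (n : ℕ) {z x y y' : ℝ} (hz : z ∈ S.K) (w : Fin n → Fin N)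
    (hx : |x - S.tw n w z| ≤ (S.A + 1) * S.b ^ n) (hy : y + (4 * S.A + 3) * S.b ^ n ≤ x)
    (hy' : x + (4 * S.A + 3) * S.b ^ n ≤ y') :
    S.Yw n z w ≤ S.F z y' - S.F z y := by
  rw [S.self_sim n hz, S.self_sim n hz, ← wavg_sub]
  have hb := S.bpow_pos n
  have hyy : y ≤ y' := by nlinarith [S.hA0]
  apply wavg_mono
  intro w'
  split_ifs with h
  · unfold sig aff
    have hcdf := S.hF _ (S.zw_mem n w' hz)
    rw [abs_le] at h hx
    rw [hcdf.right, hcdf.left]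
    · norm_num
    · rw [div_le_iff₀ hb]; nlinarith
    · rw [le_div_iff₀ hb]; nlinarith
  · have := (S.sig_cdf n hz w').mono hyy
    linarith

theorem Yw_sum_le (n : ℕ) {z s r : ℝ} (hz : z ∈ S.K) (hs : 0 < s) (hr : 0 < r) (hrb : r ≤ S.b ^ n)
    (hrb2 : S.b ^ n ≤ 2 * r) :
    wavg n (fun w => S.Yw n z w ^ s) ≤ (S.kk : ℝ) ^ s * Qr s r (S.F z) := by
  set H := (4 * S.A + 3) * S.b ^ n with hH
  have hk := S.kk_ge
  have hA := S.hA0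
  have hb := S.bpow_pos n
  have hsig : ∀ w, Integrable (fun x => S.Yw n z w ^ s * pw (S.sig n z w) r x) := fun w =>
    (S.sig_cdf n hz w).integrable_pw.const_mul _
  have e1 : wavg n (fun w => S.Yw n z w ^ s) =
      r⁻¹ * ∫ x, wavg n (fun w => S.Yw n z w ^ s * pw (S.sig n z w) r x) := by
    rw [wavg_integral n _ hsig, ← wavg_mul]
    congr 1; ext w
    rw [integral_const_mul, (S.sig_cdf n hz w).integral_pw]
    field_simp
  have hF := S.hF z hz
  obtain ⟨hi, he⟩ := young_int hF S.kk_pos hs (r := r) (fun i => -H + i * r)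
  rw [e1]
  unfold Qr
  rw [mul_left_comm, ← he]
  apply mul_le_mul_of_nonneg_left _ (by positivity)
  apply integral_mono (integrable_wavg n _ hsig) hi
  intro x
  refine le_trans ?_ (young_point S.kk_pos hs (hF.pw_nonneg hr.le x)
    (fun i => hF.pw_nonneg hr.le (x + (-H + i * r))))
  have hs1 : ∑ i ∈ Finset.range S.kk, pw (S.F z) r (x + (-H + i * r)) =
      S.F z (x - H + S.kk * r) - S.F z (x - H) := by
    rw [← sum_pw]; apply Finset.sum_congr rfl; intro i _; congr 1; ring
  rw [hs1, S.pw_wavg n hz, mul_comm, ← wavg_mul]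
  apply wavg_mono
  intro w
  have h0 := (S.sig_cdf n hz w).pw_nonneg hr.le x
  by_cases hp : pw (S.sig n z w) r x = 0
  · rw [hp]; simp
  · apply mul_le_mul_of_nonneg_right _ h0
    apply Real.rpow_le_rpow (S.Yw_nonneg n z w) _ hs.le
    apply S.Yw_le_mass n hz w (S.pw_sig_ne n hz w hr hrb hp)
    · rw [← hH]; linarith
    · rw [← hH]
      have : 2 * H ≤ S.kk * r := by
        have h1 : (16 * S.A + 12) * r ≤ S.kk * r := mul_le_mul_of_nonneg_right hk hr.le
        have h2 : 2 * H ≤ (8 * S.A + 6) * (2 * r) := by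
          rw [hH]
          have := mul_le_mul_of_nonneg_left hrb2 (show 0 ≤ 8 * S.A + 6 by linarith)
          linarith
        linarith
      linarith

theorem Yw_sum_QT (n : ℕ) {z s : ℝ} (hz : z ∈ S.K) (hs : 0 < s) :
    wavg n (fun w => S.Yw n z w ^ s) ≤ (S.kk : ℝ) ^ s * S.QT s (n * S.chi) z := by
  have hk0 : (0:ℝ) < (S.kk : ℝ) ^ s := Real.rpow_pos_of_pos (by exact_mod_cast S.kk_pos) _
  rw [← div_le_iff₀' hk0]
  apply S.le_QT hz hs
  intro τ hτ
  rw [div_le_iff₀' hk0]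
  apply S.Yw_sum_le n hz hs (Real.exp_pos _)
  · rw [← S.exp_chi]; apply Real.exp_le_exp.2; linarith [hτ.1]
  · have : Real.exp (-(n * S.chi)) ≤ 2 * Real.exp (-τ) := by
      have h2 : (2:ℝ) = Real.exp (Real.log 2) := (Real.exp_log (by norm_num)).symm
      rw [h2, ← Real.exp_add]
      apply Real.exp_le_exp.2
      have := hτ.2
      rw [Real.exp_log (by norm_num)] at *
      linarith
    rwa [S.exp_chi] at this

theorem QT_mul (n : ℕ) {z s T B : ℝ} (hz : z ∈ S.K) (hs : 0 < s) (hT : 0 ≤ T)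
    (hB : ∀ z ∈ S.K, S.QT s T z ≤ B) :
    S.QT s (n * S.chi + T) z ≤ (S.kk : ℝ) ^ s * B * S.QT s (n * S.chi) z := by
  have hB0 : 0 ≤ B := (S.QT_nonneg hz).trans (hB z hz)
  calc _ ≤ _ := S.QT_step n hz hs hT
    _ ≤ wavg n (fun w => B * S.Yw n z w ^ s) := wavg_mono fun w => by
        rw [mul_comm]
        exact mul_le_mul_of_nonneg_right (hB _ (S.zw_mem n w hz))
          (Real.rpow_nonneg (S.Yw_nonneg n z w) _)
    _ = B * wavg n (fun w => S.Yw n z w ^ s) := wavg_mul _ _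
    _ ≤ B * ((S.kk : ℝ) ^ s * S.QT s (n * S.chi) z) :=
        mul_le_mul_of_nonneg_left (S.Yw_sum_QT n hz hs) hB0
    _ = _ := by ring

theorem QT_small {m : ℕ} {s z : ℝ} (hz : z ∈ S.K) (hs : 0 < s) :
    S.QT s (m * S.chi) z ≤ 1 - s * (Bf (m * S.chi) (S.F z) / Real.log 2) +
      s ^ 2 * (2 * (S.b ^ m)⁻¹ * (8 * (S.A + 1))) := by
  have hl := log2_pos
  have hF := S.hF z hz
  have hb := S.bpow_pos m
  set C := 2 * (S.b ^ m)⁻¹ * (8 * (S.A + 1)) with hC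
  have hc := (continuous_Phi_exp hF)
  have h := intervalIntegral.integral_mono_on (a := m * S.chi) (b := m * S.chi + Real.log 2)
    (f := fun τ => Qr s (Real.exp (-τ)) (S.F z))
    (g := fun τ => (1 + s ^ 2 * C) - s * Phi (Real.exp (-τ)) (S.F z)) (μ := volume)
    (by linarith) (Qr_int hF hs _ _) (Continuous.intervalIntegrable (by fun_prop) _ _) (by
      intro τ hτ
      have hm : 0 ≤ m * S.chi := by have := S.chi_pos; positivity
      have := Qr_small hF hs S.hA0 (Real.exp_pos (-τ)) (Real.exp_le_one_iff.2 (by linarith [hτ.1]))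
      have h2 : (Real.exp (-τ))⁻¹ ≤ 2 * (S.b ^ m)⁻¹ := by
        rw [← S.exp_chi, ← Real.exp_neg, ← Real.exp_neg]
        rw [show (2:ℝ) = Real.exp (Real.log 2) from (Real.exp_log (by norm_num)).symm, ← Real.exp_add]
        apply Real.exp_le_exp.2
        linarith [hτ.2]
      have h3 := mul_le_mul_of_nonneg_right h2 (show 0 ≤ 8 * (S.A + 1) by linarith [S.hA0])
      have h4 := mul_le_mul_of_nonneg_left h3 (sq_nonneg s)
      linarith)
  rw [intervalIntegral.integral_sub (intervalIntegrable_const) ((hc.intervalIntegrable _ _).const_mul _),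
    intervalIntegral.integral_const, intervalIntegral.integral_const_mul, smul_eq_mul] at h
  unfold QT Bf
  calc _ ≤ (Real.log 2)⁻¹ * _ := mul_le_mul_of_nonneg_left h (by positivity)
    _ = _ := by field_simp; ring

/-- main L^q estimate -/
theorem QT_decay {ε : ℝ} (hε : 0 < ε) : ∃ s0 > 0, ∀ s, 0 < s → s ≤ s0 → ∃ C > 0, ∀ T ≥ 0, ∀ z ∈ S.K,
    S.QT s T z ≤ C * Real.exp (-(s * (T / S.chi * (S.Lam / Real.log 2 - ε)))) := by
  have hl := log2_pos
  set L := S.Lam / Real.log 2 with hL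
  have hχ := S.chi_pos
  have hk1 : (1:ℝ) ≤ S.kk := by exact_mod_cast S.kk_pos
  have hk0 : (0:ℝ) < S.kk := by linarith
  obtain ⟨m0, hm0⟩ := S.Bf_lower (ε := ε * Real.log 2 / 4) (by positivity)
  obtain ⟨m1, hm1⟩ := exists_nat_ge (Real.log S.kk / (ε / 4))
  rw [div_le_iff₀ (by positivity)] at hm1
  set m := max (max m0 m1) 1 with hm
  have hmm0 : m0 ≤ m := (le_max_left _ _).trans (le_max_left _ _)
  have hmm1 : (m1:ℝ) ≤ m := by exact_mod_cast (le_max_right m0 m1).trans (le_max_left _ 1)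
  have hmpos : (1:ℝ) ≤ m := by exact_mod_cast le_max_right (max m0 m1) 1
  have hlogk : Real.log S.kk ≤ m * (ε / 4) := hm1.trans (by gcongr)
  set C := 2 * (S.b ^ m)⁻¹ * (8 * (S.A + 1)) with hC
  have hC0 : 0 < C := by have := S.bpow_pos m; have := S.hA0; positivity
  refine ⟨m * (ε / 4) / C, by positivity, fun s hs hs0 => ?_⟩
  rw [le_div_iff₀ hC0] at hs0
  set E := Real.exp (-(s * (m * (L - ε / 2)))) with hE
  have hB : ∀ z ∈ S.K, S.QT s (m * S.chi) z ≤ E := by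
    intro z hz
    refine (S.QT_small hz hs).trans ?_
    rw [← hC]
    have h1 : m * (L - ε / 4) ≤ Bf (m * S.chi) (S.F z) / Real.log 2 := by
      rw [le_div_iff₀ hl]
      refine le_trans (le_of_eq ?_) (hm0 m hmm0 z hz)
      rw [hL]; field_simp
    have h2 := mul_le_mul_of_nonneg_left h1 hs.le
    have h3 := mul_le_mul_of_nonneg_left hs0 hs.le
    rw [hE]
    refine le_trans ?_ (Real.add_one_le_exp _)
    nlinarith
  have hkE : (S.kk : ℝ) ^ s * E ≤ Real.exp (-(s * (m * (L - ε)))) := by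
    rw [Real.rpow_def_of_pos hk0, hE, ← Real.exp_add]
    apply Real.exp_le_exp.2
    have := mul_le_mul_of_nonneg_left hlogk hs.le
    nlinarith [mul_pos hs (mul_pos (lt_of_lt_of_le one_pos hmpos) hε)]
  have hind : ∀ j : ℕ, ∀ z ∈ S.K, S.QT s ((j * m : ℕ) * S.chi) z ≤
      Real.exp (-(s * (m * (L - ε)))) ^ j := by
    intro j
    induction j with
    | zero => intro z hz; simpa using S.QT_le_one hz hs
    | succ j ih =>
      intro z hz
      have h1 := S.QT_mul (j * m) hz hs (T := m * S.chi) (by positivity) hB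
      have e : ((j + 1) * m : ℕ) * S.chi = (j * m : ℕ) * S.chi + m * S.chi := by push_cast; ring
      rw [e, pow_succ']
      refine h1.trans (mul_le_mul hkE (ih z hz) (S.QT_nonneg hz) (Real.exp_pos _).le)
  refine ⟨(S.kk : ℝ) ^ s * Real.exp (s * (m * |L - ε|)), by positivity, fun T hT z hz => ?_⟩
  have hmχ : 0 < m * S.chi := by positivity
  set j := ⌊T / (m * S.chi)⌋₊ with hj
  have hj1 : j * (m * S.chi) ≤ T := by
    rw [← le_div_iff₀ hmχ]; exact Nat.floor_le (by positivity)
  have hj2 : T ≤ (j + 1) * (m * S.chi) := by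
    rw [← div_le_iff₀ hmχ]; exact (Nat.lt_floor_add_one _).le
  have h1 := S.QT_mul (j * m) hz hs (T := T - (j * m : ℕ) * S.chi)
    (by push_cast; linarith) (B := 1) (fun z hz => S.QT_le_one hz hs)
  rw [add_sub_cancel, mul_one] at h1
  refine h1.trans ?_
  rw [mul_assoc]
  apply mul_le_mul_of_nonneg_left _ (by positivity)
  refine (hind j z hz).trans ?_
  rw [← Real.exp_nat_mul, ← Real.exp_add]
  apply Real.exp_le_exp.2
  set x := T / S.chi with hx
  have hx1 : j * m ≤ x := by rw [hx, le_div_iff₀ hχ]; linarith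
  have hx2 : x ≤ j * m + m := by rw [hx, div_le_iff₀ hχ]; linarith
  have h3 : (x - j * m) * (L - ε) ≤ m * |L - ε| :=
    (mul_le_mul_of_nonneg_left (le_abs_self _) (by linarith)).trans
      (mul_le_mul_of_nonneg_right (by linarith) (abs_nonneg _))
  have := mul_le_mul_of_nonneg_left h3 hs.le
  linarith

/-- decay of the coincidence counts -/
theorem Yw_decay {s C δ : ℝ} (hs : 0 < s) (hC : ∀ T ≥ 0, ∀ z ∈ S.K,
    S.QT s T z ≤ C * Real.exp (-(s * (T / S.chi * δ)))) (n : ℕ) {z : ℝ} (hz : z ∈ S.K) :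
    wavg n (fun w => S.Yw n z w ^ s) ≤ (S.kk : ℝ) ^ s * C * Real.exp (-(s * (n * δ))) := by
  have hχ := S.chi_pos
  refine (S.Yw_sum_QT n hz hs).trans ?_
  have h := hC (n * S.chi) (by positivity) z hz
  rw [mul_div_assoc, div_self hχ.ne', mul_one] at h
  rw [mul_assoc]
  exact mul_le_mul_of_nonneg_left h (by positivity)

end Fam
end
end

section
open MeasureTheory Filter Set Topology
open scoped ENNReal
noncomputable section

namespace Fam
variable {N : ℕ} (S : Fam N)

theorem hw_sum (n : ℕ) (w : Fin n → Fin N) : S.hw n w = ∑ k : Fin n, S.c ^ (k:ℕ) * S.u (w k) := by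
  induction n with
  | zero => simp [hw]
  | succ n ih =>
    rw [Fin.sum_univ_succ]
    simp only [hw, ih, Fin.tail, Finset.mul_sum]
    simp [pow_succ']
    exact Finset.sum_congr rfl fun k _ => by ring

theorem hw_update (n : ℕ) (w : Fin n → Fin N) (k : Fin n) (j : Fin N) :
    S.hw n (Function.update w k j) = S.hw n w + S.c ^ (k:ℕ) * (S.u j - S.u (w k)) := by
  rw [hw_sum, hw_sum, ← sub_eq_iff_eq_add', ← Finset.sum_sub_distrib]
  rw [Finset.sum_eq_single k]
  · simp; ring
  · intro m _ hm; simp [Function.update_of_ne hm]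
  · simp

open Classical in
theorem hw_conc {D κ : ℝ} {M l : ℕ} (hD : 0 < D) (σ : Fin N → Fin N)
    (hσ : ∀ i, D ≤ |S.u (σ i) - S.u i|) (hM : 0 < M) (hl : M ≤ l)
    (hκ : 2 * κ ≤ S.c ^ M * (1 - S.c) * D) (a : ℝ) :
    wavg l (fun w => if |a - S.hw l w| < κ then (1:ℝ) else 0) ≤ N / M := by
  set E : ℝ → Finset (Fin l → Fin N) := fun a => Finset.univ.filter (fun w => |a - S.hw l w| < κ)
    with hE
  have hc1 := S.hc1
  have hc0 := S.hc
  -- positions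
  let pos : Fin M → Fin l := fun k => ⟨k, lt_of_lt_of_le k.2 hl⟩
  let sh : Fin N → Fin M → ℝ := fun i k => a + S.c ^ (k:ℕ) * (S.u (σ i) - S.u i)
  have hinj : ∀ i : Fin N, ∀ k : Fin M,
      ((E a).filter (fun w => w (pos k) = i)).card ≤ (E (sh i k)).card := by
    intro i k
    apply Finset.card_le_card_of_injOn (fun w => Function.update w (pos k) (σ i))
    · intro w hw
      simp only [hE, Finset.coe_filter, Finset.mem_filter, Finset.mem_univ, true_and, mem_ofPred_eq] at hw ⊢
      rw [S.hw_update, hw.2]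
      have : sh i k - (S.hw l w + S.c ^ ((pos k : Fin l) : ℕ) * (S.u (σ i) - S.u i)) = a - S.hw l w := by
        simp only [sh, pos]; ring
      rw [this]; exact hw.1
    · intro w hw w' hw' h
      simp only [Finset.coe_filter, mem_ofPred_eq] at hw hw'
      ext m
      by_cases hm : m = pos k
      · rw [hm, hw.2, hw'.2]
      · have := congrFun h m
        simp only [Function.update_of_ne hm] at this
        rw [this]
  have hdisj : ∀ i : Fin N, ∑ k : Fin M, (E (sh i k)).card ≤ N ^ l := by
    intro i
    rw [← Finset.card_biUnion]
    · refine (Finset.card_le_univ _).trans ?_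
      simp
    · have key : ∀ k k' : Fin M, (k:ℕ) < k' → Disjoint (E (sh i k)) (E (sh i k')) := by
        intro k k' hkk
        rw [Finset.disjoint_left]
        intro w h1 h2
        simp only [hE, Finset.mem_filter, Finset.mem_univ, true_and] at h1 h2
        have h3 : |sh i k - sh i k'| < 2 * κ := by
          rw [abs_lt] at *; constructor <;> linarith
        have h4 : sh i k - sh i k' = (S.c ^ (k:ℕ) - S.c ^ (k':ℕ)) * (S.u (σ i) - S.u i) := by
          simp only [sh]; ring
        have h5 : S.c ^ M * (1 - S.c) ≤ S.c ^ (k:ℕ) - S.c ^ (k':ℕ) := by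
          have h6 : S.c ^ (k':ℕ) ≤ S.c ^ ((k:ℕ) + 1) := pow_le_pow_of_le_one hc0.le hc1.le hkk
          have h7 : S.c ^ M ≤ S.c ^ (k:ℕ) := pow_le_pow_of_le_one hc0.le hc1.le k.2.le
          rw [pow_succ] at h6
          nlinarith
        have h8 : 0 ≤ S.c ^ M * (1 - S.c) := by
          have := pow_pos hc0 M
          nlinarith
        rw [h4, abs_mul, abs_of_nonneg (h8.trans h5)] at h3
        have := mul_le_mul h5 (hσ i) hD.le (h8.trans h5)
        linarith
      intro k _ k' _ hne
      rcases lt_or_gt_of_ne (fun h => hne (Fin.ext h) : (k:ℕ) ≠ k') with h | h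
      · exact key k k' h
      · exact (key k' k h).symm
  have hcount : M * (E a).card ≤ N * N ^ l := by
    calc M * (E a).card = ∑ k : Fin M, (E a).card := by simp
      _ = ∑ k : Fin M, ∑ i : Fin N, ((E a).filter (fun w => w (pos k) = i)).card :=
          Finset.sum_congr rfl fun k _ =>
            Finset.card_eq_sum_card_fiberwise (fun w _ => Finset.mem_coe.2 (Finset.mem_univ _))
      _ = ∑ i : Fin N, ∑ k : Fin M, ((E a).filter (fun w => w (pos k) = i)).card := Finset.sum_comm
      _ ≤ ∑ i : Fin N, N ^ l := Finset.sum_le_sum fun i _ =>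
          (Finset.sum_le_sum fun k _ => hinj i k).trans (hdisj i)
      _ = N * N ^ l := by simp
  unfold wavg
  have e : ∑ w : Fin l → Fin N, (if |a - S.hw l w| < κ then (1:ℝ) else 0) = (E a).card := by
    simp [hE]
  rw [e, div_le_div_iff₀ (by have := S.hN0; positivity) (by positivity)]
  have : (M:ℝ) * (E a).card ≤ N * N ^ l := by exact_mod_cast hcount
  linarith

theorem NA_of (h : ∃ i j, S.u i ≠ S.u j) : S.NA := by
  have hN0 := S.hN0
  have hA := S.hA0
  have hc0 := S.hc
  have hc1 := S.hc1
  -- choice of σ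
  have hσ : ∀ i, ∃ j, S.u j ≠ S.u i := by
    obtain ⟨i0, j0, h0⟩ := h
    intro i
    by_cases h1 : S.u i0 = S.u i
    · exact ⟨j0, fun h2 => h0 (h1.trans h2.symm)⟩
    · exact ⟨i0, h1⟩
  choose σ hσ using hσ
  obtain ⟨D, hD0, hD⟩ : ∃ D > 0, ∀ i, D ≤ |S.u (σ i) - S.u i| := by
    have : Nonempty (Fin N) := ⟨⟨0, hN0⟩⟩
    obtain ⟨i0, hi0⟩ := Finite.exists_min (fun i => |S.u (σ i) - S.u i|)
    exact ⟨_, abs_pos.2 (sub_ne_zero.2 (hσ i0)), hi0⟩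
  intro p hp
  obtain ⟨M, hM⟩ := exists_nat_ge (N / p + 1)
  have hM0 : (0:ℝ) < M := by have : 0 < (N:ℝ) / p := by positivity
                             linarith
  have hMp : (N:ℝ) / M ≤ p := by
    rw [div_le_iff₀ hM0]
    have : (N:ℝ) / p ≤ M := by linarith
    rw [div_le_iff₀ hp] at this; linarith
  have hcM : 0 < S.c ^ M * (1 - S.c) * D := by
    have := pow_pos hc0 M
    have : 0 < 1 - S.c := by linarith
    positivity
  set κ0 := S.c ^ M * (1 - S.c) * D / 2 with hκ0
  refine ⟨min (1/2) (κ0 / (2 * S.A + 1)), by positivity, M, ?_⟩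
  intro l hl z1 _ z2 _ δ
  set κ := min (1/2) (κ0 / (2 * S.A + 1)) with hκ
  have hκh : κ ≤ 1/2 := min_le_left _ _
  have hκ1 : κ * (2 * S.A + 1) ≤ κ0 := by
    rw [← le_div_iff₀ (by linarith)]; exact min_le_right _ _
  have hκp : 0 < κ := by positivity
  by_cases hz : z2 - z1 = 0
  · rw [hz]
    refine le_trans (le_of_eq ?_) hp.le
    refine Eq.trans ?_ (wavg_const (N := N) (n := l) hN0 0)
    congr 1; ext w
    rw [if_neg]
    have : max |(0:ℝ)| |δ| = |δ| := by simp
    rw [this, zero_mul, sub_zero]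
    nlinarith [abs_nonneg δ]
  · refine le_trans (wavg_mono ?_) ((S.hw_conc hD0 σ hD (by exact_mod_cast hM0) hl
      (κ := κ0) (by rw [hκ0]; linarith) (δ / (z2 - z1))).trans hMp)
    intro w
    set ζ := z2 - z1 with hζ
    have hζ0 := abs_pos.2 hz
    split_ifs with h1 h2 h2
    · exact le_rfl
    · exfalso; apply h2
      have h3 : |δ| ≤ |δ - ζ * S.hw l w| + |ζ| * S.A := by
        have h4 : |ζ * S.hw l w| ≤ |ζ| * S.A := by
          rw [abs_mul]; exact mul_le_mul_of_nonneg_left (S.hw_le l w) (abs_nonneg _)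
        have := abs_add_le (δ - ζ * S.hw l w) (ζ * S.hw l w)
        rw [sub_add_cancel] at this
        linarith
      have h5 : max |ζ| |δ| ≤ (2 * S.A + 1) * |ζ| := by
        apply max_le
        · nlinarith
        · have h6 : κ * max |ζ| |δ| ≤ 1/2 * (|ζ| + |δ|) := by
            apply mul_le_mul hκh _ _ (by norm_num)
            · exact max_le (by linarith [abs_nonneg δ]) (by linarith)
            · exact le_max_of_le_left (abs_nonneg _)
          linarith
      have h7 : |δ - ζ * S.hw l w| < κ0 * |ζ| := by
        calc _ < _ := h1
          _ ≤ κ * ((2 * S.A + 1) * |ζ|) := mul_le_mul_of_nonneg_left h5 hκp.le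
          _ ≤ κ0 * |ζ| := by rw [← mul_assoc]; exact mul_le_mul_of_nonneg_right hκ1 hζ0.le
      have h8 : δ / ζ - S.hw l w = (δ - ζ * S.hw l w) / ζ := by field_simp
      rw [h8, abs_div, div_lt_iff₀ hζ0]
      exact h7
    · norm_num
    · norm_num

theorem NA_triv (h : ∀ z ∈ S.K, z = 0) : S.NA := by
  intro p hp
  refine ⟨1, one_pos, 0, fun l _ z1 h1 z2 h2 δ => ?_⟩
  rw [h z1 h1, h z2 h2]
  refine le_trans (le_of_eq ?_) hp.le
  refine Eq.trans ?_ (wavg_const (N := N) (n := l) S.hN0 0)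
  congr 1; ext w
  rw [if_neg]
  simp

theorem psiWord_append (lam t : Fin N → ℝ) (l : List (Fin N)) (i : Fin N) (x : ℝ) :
    psiWord lam t (l ++ [i]) x = psiWord lam t l (lam i * x + t i) := by
  induction l with
  | nil => simp [psiWord]
  | cons j l ih => simp [psiWord, ih]

theorem zw_psi (n : ℕ) (w : Fin n → Fin N) (z : ℝ) :
    S.zw n w z = psiWord (fun _ => S.c / S.b) (fun i => -(S.d i / S.b)) (List.ofFn w).reverse z := by
  induction n generalizing z with
  | zero => simp [zw, psiWord]
  | succ n ih =>
    rw [List.ofFn_succ, List.reverse_cons, psiWord_append]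
    simp only [zw, ih]
    congr 1
    unfold g; ring

theorem hw_psi (n : ℕ) (w : Fin n → Fin N) :
    S.hw n w = psiWord (fun _ => S.c) S.u (List.ofFn w) 0 := by
  induction n with
  | zero => simp [hw, psiWord]
  | succ n ih =>
    rw [List.ofFn_succ]
    simp only [hw, ih, psiWord]
    rw [add_comm]; rfl

theorem tw_psi (hd : S.d = 0) (n : ℕ) (w : Fin n → Fin N) :
    S.tw n w 0 = psiWord (fun _ => S.b) S.v (List.ofFn w) 0 := by
  induction n with
  | zero => simp [tw, psiWord]
  | succ n ih =>
    rw [List.ofFn_succ]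
    have : S.g (w 0) 0 = 0 := by simp [g, hd]
    simp only [tw, this, ih, psiWord]
    rw [add_comm]; simp; left; rfl

theorem ofFn_rev_eq (n : ℕ) (w : Fin n → Fin N) :
    List.ofFn (fun k => w k.rev) = (List.ofFn w).reverse := by
  apply List.ext_getElem
  · simp
  · intro i h1 h2
    simp [List.getElem_reverse, Fin.rev]
    congr 1; ext; simp; omega

theorem exists_q {b ε : ℝ} (hb : 0 < b) (hb1 : b < 1) (hε : 0 < ε) : ∃ q : ℕ, ∀ n : ℕ, b ^ (q * n) ≤ ε ^ n := by
  obtain ⟨q, hq⟩ := exists_pow_lt_of_lt_one hε hb1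
  exact ⟨q, fun n => by rw [pow_mul]; exact pow_le_pow_left₀ (by positivity) hq.le n⟩

theorem Sep_z (h : HochmanESC N (fun _ => S.c / S.b) (fun i => -(S.d i / S.b))) : S.Sep := by
  obtain ⟨ε, hε, nk, hnk, hs⟩ := h
  obtain ⟨q, hq⟩ := exists_q S.hb0 S.hb hε
  refine ⟨q, fun n0 => ⟨nk n0, hnk.le_apply, fun z hz w w' hww => ?_⟩⟩
  refine (hq _).trans (le_max_of_le_left ?_)
  have h1 := hs n0 (fun k => w' k.rev) (fun k => w k.rev) (by
    intro h; apply hww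
    ext k
    have := congrFun h k.rev
    simp at this
    rw [this]) (by simp)
  rw [ofFn_rev_eq, ofFn_rev_eq, ← S.zw_psi, ← S.zw_psi] at h1
  rw [S.zw_affine _ w', S.zw_affine _ w, add_sub_add_left_eq_sub]
  exact h1.le

theorem Sep_t (hK : ∀ z ∈ S.K, z = 0) (hd : S.d = 0) (h : HochmanESC N (fun _ => S.b) S.v) : S.Sep := by
  obtain ⟨ε, hε, nk, hnk, hs⟩ := h
  obtain ⟨q, hq⟩ := exists_q S.hb0 S.hb hε
  refine ⟨q, fun n0 => ⟨nk n0, hnk.le_apply, fun z hz w w' hww => ?_⟩⟩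
  refine (hq _).trans (le_max_of_le_right ?_)
  rw [hK z hz, S.tw_psi hd, S.tw_psi hd]
  exact (hs n0 w' w hww.symm (by simp)).le

theorem exists_ne_of_ESC {c : ℝ} {u : Fin N → ℝ} (hN : 2 ≤ N) (h : HochmanESC N (fun _ => c) u) :
    ∃ i j, u i ≠ u j := by
  by_contra hcon
  push Not at hcon
  obtain ⟨ε, hε, nk, hnk, hs⟩ := h
  have hpos : 0 < nk 1 := lt_of_lt_of_le one_pos hnk.le_apply
  have hall : ∀ l l' : List (Fin N), l.length = l'.length →
      psiWord (fun _ => c) u l 0 = psiWord (fun _ => c) u l' 0 := by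
    intro l
    induction l with
    | nil => intro l' h; simp at h; have : l' = [] := List.length_eq_zero_iff.1 h.symm
             rw [this]
    | cons i l ih =>
      intro l' h
      cases l' with
      | nil => simp at h
      | cons j l' =>
        simp only [psiWord]
        rw [ih l' (by simpa using h), hcon i j]
  have h1 := hs 1 (fun _ => ⟨0, by omega⟩) (fun _ => ⟨1, by omega⟩) (by
    intro h; have := congrFun h ⟨0, hpos⟩; simp at this) (by simp)
  rw [hall _ (List.ofFn fun _ : Fin (nk 1) => (⟨1, by omega⟩ : Fin N)) (by simp)] at h1
  simp at h1
  exact absurd h1 (not_lt.2 (by positivity))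

end Fam
end
end

section
open MeasureTheory Filter Set Topology
open scoped ENNReal
noncomputable section

/-- prepend a symbol to an infinite word -/
def consS {N : ℕ} (i : Fin N) (x : ℕ → Fin N) : ℕ → Fin N
  | 0 => i
  | n + 1 => x n

section Bern
variable {N : ℕ}

def cyl (n : ℕ) (w : Fin n → Fin N) : Set (ℕ → Fin N) := {x | ∀ k : Fin n, x (k : ℕ) = w k}

theorem measurable_coord (k : ℕ) : Measurable (fun x : ℕ → Fin N => x k) := measurable_pi_apply k

theorem measurable_consS (i : Fin N) : Measurable (consS i) := by
  apply measurable_pi_lambda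
  intro n
  cases n with
  | zero => exact measurable_const
  | succ n => exact measurable_coord n

theorem meas_cyl (n : ℕ) (w : Fin n → Fin N) : MeasurableSet (cyl n w) := by
  have : cyl n w = ⋂ k : Fin n, (fun x : ℕ → Fin N => x k) ⁻¹' {w k} := by
    ext x; simp [cyl]
  rw [this]
  exact MeasurableSet.iInter fun k => measurable_coord _ (measurableSet_singleton _)

def cyls (N : ℕ) : Set (Set (ℕ → Fin N)) := {E | ∃ n w, E = cyl (N := N) n w}

theorem cyl_inter {n m : ℕ} (hnm : n ≤ m) (w : Fin n → Fin N) (w' : Fin m → Fin N)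
    (h : (cyl n w ∩ cyl m w').Nonempty) : cyl n w ∩ cyl m w' = cyl m w' := by
  obtain ⟨y, hy1, hy2⟩ := h
  apply inter_eq_right.2
  intro x hx k
  have h1 := hx ⟨k, lt_of_lt_of_le k.2 hnm⟩
  have h2 := hy2 ⟨k, lt_of_lt_of_le k.2 hnm⟩
  have h3 := hy1 k
  simp only at h1 h2
  rw [h1, ← h2, h3]

theorem cyls_pi : IsPiSystem (cyls N) := by
  rintro _ ⟨n, w, rfl⟩ _ ⟨m, w', rfl⟩ hne
  rcases le_total n m with h | h
  · rw [cyl_inter h w w' hne]; exact ⟨m, w', rfl⟩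
  · rw [inter_comm] at hne ⊢
    rw [cyl_inter h w' w hne]; exact ⟨n, w, rfl⟩

theorem cyls_gen : (MeasurableSpace.pi : MeasurableSpace (ℕ → Fin N)) =
    MeasurableSpace.generateFrom (cyls N) := by
  apply le_antisymm
  · apply iSup_le
    intro k
    rw [← measurable_iff_comap_le]
    apply @measurable_to_countable' _ _ _ _ (MeasurableSpace.generateFrom (cyls N))
    intro a
    have : (fun x : ℕ → Fin N => x k) ⁻¹' {a} =
        ⋃ w ∈ {w : Fin (k + 1) → Fin N | w (Fin.last k) = a}, cyl (k + 1) w := by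
      ext x
      simp only [mem_preimage, mem_singleton_iff, mem_iUnion, cyl, mem_ofPred_eq]
      constructor
      · intro h; exact ⟨fun j => x j, by simpa using h, fun j => rfl⟩
      · rintro ⟨w, hw, h⟩
        have := h (Fin.last k)
        simp at this
        rw [this, hw]
    rw [this]
    apply MeasurableSet.biUnion (Set.to_countable _)
    intro w _
    exact MeasurableSpace.measurableSet_generateFrom ⟨_, w, rfl⟩
  · apply MeasurableSpace.generateFrom_le
    rintro _ ⟨n, w, rfl⟩
    exact meas_cyl n w

theorem bern_eq (hN : 0 < N) {μ : Measure (ℕ → Fin N)} (hμ : IsUniformBernoulli N μ) :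
    μ = (N : ℝ≥0∞)⁻¹ • ∑ i, μ.map (consS i) := by
  have hp := hμ.1
  have hNne : (N : ℝ≥0∞) ≠ 0 := by exact_mod_cast hN.ne'
  apply ext_of_generate_finite (cyls N) cyls_gen cyls_pi
  · rintro _ ⟨n, w, rfl⟩
    rw [Measure.smul_apply, Measure.finsetSum_apply, smul_eq_mul]
    simp_rw [Measure.map_apply (measurable_consS _) (meas_cyl n w)]
    cases n with
    | zero =>
      have : ∀ w : Fin 0 → Fin N, cyl 0 w = univ := fun w => by ext x; simp [cyl]
      simp [this, ENNReal.inv_mul_cancel hNne]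
    | succ n =>
      have h1 : μ (cyl (n + 1) w) = (1 / (N : ℝ≥0∞)) ^ (n + 1) := hμ.2 (n + 1) w
      have h2 : ∀ i, μ (consS i ⁻¹' cyl (n + 1) w) =
          if i = w 0 then (1 / (N : ℝ≥0∞)) ^ n else 0 := by
        intro i
        split_ifs with h
        · rw [← hμ.2 n (fun k => w k.succ)]
          congr 1
          ext x
          simp only [cyl, mem_preimage, mem_ofPred_eq]
          rw [Fin.forall_fin_succ]
          simp [consS, h]
        · have : consS i ⁻¹' cyl (n + 1) w = ∅ := by
            ext x
            simp only [cyl, mem_preimage, mem_ofPred_eq, mem_empty_iff_false, iff_false]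
            intro hx
            exact h (hx 0)
          rw [this]; simp
      simp_rw [h2]
      rw [h1]
      simp [pow_succ']
  · rw [Measure.smul_apply, Measure.finsetSum_apply, smul_eq_mul]
    simp_rw [Measure.map_apply (measurable_consS _) MeasurableSet.univ]
    simp [ENNReal.inv_mul_cancel hNne]

theorem bern_step (hN : 0 < N) {μ : Measure (ℕ → Fin N)} (hμ : IsUniformBernoulli N μ)
    {E : Set (ℕ → Fin N)} (hE : MeasurableSet E) :
    μ.real E = (∑ i, μ.real {x | consS i x ∈ E}) / N := by
  have hp := hμ.1
  have h : μ E = ((N : ℝ≥0∞)⁻¹ • ∑ i, μ.map (consS i)) E := by rw [← bern_eq hN hμ]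
  rw [Measure.smul_apply, Measure.finsetSum_apply, smul_eq_mul] at h
  simp_rw [Measure.map_apply (measurable_consS _) hE] at h
  unfold Measure.real
  rw [h, ENNReal.toReal_mul, ENNReal.toReal_sum (fun i _ => measure_ne_top _ _)]
  rw [ENNReal.toReal_inv, ENNReal.toReal_natCast, div_eq_inv_mul]
  rfl

end Bern

/-- data of a random affine pair -/
structure Pair (N : ℕ) where
  μ : Measure (ℕ → Fin N)
  hμ : IsUniformBernoulli N μ
  b : ℝ
  c : ℝ
  u : Fin N → ℝ
  v : Fin N → ℝ
  d : Fin N → ℝ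
  X : (ℕ → Fin N) → ℝ
  Y : (ℕ → Fin N) → ℝ
  hN : 2 ≤ N
  hc : 0 < c
  hcb : c < b
  hb : b < 1
  mX : Measurable X
  mY : Measurable Y
  hX : ∀ x, X x ∈ Icc (0:ℝ) 1
  hY : ∀ x, Y x ∈ Icc (0:ℝ) 1
  hXs : ∀ i x, X (consS i x) = c * X x + u i
  hYs : ∀ i x, Y (consS i x) = d i * X x + b * Y x + v i

namespace Pair
variable {N : ℕ} (P : Pair N)

def R : ℝ := (∑ i, |P.d i|) / (P.b - P.c)
def AA : ℝ := 2 + P.R + (∑ i, |P.u i|) / (1 - P.c) + (∑ i, |P.v i| + P.R * ∑ i, |P.u i|) / (1 - P.b)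

theorem R_nonneg : 0 ≤ P.R := by
  have := P.hcb
  exact div_nonneg (Finset.sum_nonneg fun i _ => abs_nonneg _) (by linarith)

def cdf (z x : ℝ) : ℝ := P.μ.real {w | P.Y w - z * P.X w < x}

theorem mset (z x : ℝ) : MeasurableSet {w | P.Y w - z * P.X w < x} :=
  measurableSet_lt (P.mY.sub (P.mX.const_mul z)) measurable_const

theorem single_le {f : Fin N → ℝ} (i : Fin N) : |f i| ≤ ∑ j, |f j| :=
  Finset.single_le_sum (f := fun j => |f j|) (fun j _ => abs_nonneg _) (Finset.mem_univ i)

theorem AA_ge : 2 + P.R ≤ P.AA := by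
  have h1 := P.hcb
  have h2 := P.hb
  have h3 := P.R_nonneg
  have h4 : 0 ≤ ∑ i, |P.u i| := Finset.sum_nonneg fun i _ => abs_nonneg _
  have h5 : 0 ≤ ∑ i, |P.v i| := Finset.sum_nonneg fun i _ => abs_nonneg _
  have h6 : 0 ≤ (∑ i, |P.u i|) / (1 - P.c) := div_nonneg h4 (by linarith)
  have h7 : 0 ≤ (∑ i, |P.v i| + P.R * ∑ i, |P.u i|) / (1 - P.b) := div_nonneg (by positivity) (by linarith)
  unfold AA
  linarith

theorem zX {z : ℝ} (hz : z ∈ Icc (-P.R) P.R) (w : ℕ → Fin N) : |z * P.X w| ≤ P.R := by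
  have h := P.hX w
  have hR := P.R_nonneg
  rw [abs_mul, abs_of_nonneg h.1]
  have : |z| ≤ P.R := abs_le.2 hz
  nlinarith [h.2, h.1]

theorem cdf_isCdf {z : ℝ} (hz : z ∈ Icc (-P.R) P.R) : IsCdf P.AA (P.cdf z) where
  mono := fun x y hxy => by
    have := P.hμ.1
    exact measureReal_mono (fun w hw => lt_of_lt_of_le hw hxy)
  left := fun x hx => by
    have : {w | P.Y w - z * P.X w < x} = ∅ := by
      ext w
      simp only [mem_ofPred_eq, mem_empty_iff_false, iff_false, not_lt]
      have h1 := abs_le.1 (P.zX hz w)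
      have h2 := (P.hY w).1
      have := P.AA_ge
      linarith
    unfold cdf; rw [this]; simp
  right := fun x hx => by
    have hp := P.hμ.1
    have : {w | P.Y w - z * P.X w < x} = univ := by
      ext w
      simp only [mem_ofPred_eq, mem_univ, iff_true]
      have h1 := abs_le.1 (P.zX hz w)
      have h2 := (P.hY w).2
      have := P.AA_ge
      linarith
    unfold cdf; rw [this]; simp

def toFam : Fam N where
  b := P.b
  c := P.c
  A := P.AA
  u := P.u
  v := P.v
  d := P.d
  F := P.cdf
  K := Icc (-P.R) P.R
  hN := P.hN
  hc := P.hc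
  hcb := P.hcb
  hb := P.hb
  hKne := ⟨0, by have := P.R_nonneg; constructor <;> linarith⟩
  hKA := fun z hz => (abs_le.2 hz).trans (by have := P.AA_ge; linarith)
  hgK := fun i z hz => by
    have hb0 : 0 < P.b := P.hc.trans P.hcb
    have hc0 := P.hc
    have h1 := single_le (f := P.d) i
    have h2 : ∑ i, |P.d i| = P.R * (P.b - P.c) := by
      unfold R; have := P.hcb; have : P.b - P.c ≠ 0 := by linarith
      field_simp
    rw [h2] at h1
    have h3 := abs_le.1 h1
    have hz1 := mul_le_mul_of_nonneg_left hz.1 hc0.le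
    have hz2 := mul_le_mul_of_nonneg_left hz.2 hc0.le
    constructor
    · rw [le_div_iff₀ hb0]; linarith
    · rw [div_le_iff₀ hb0]; linarith
  hF := fun z hz => P.cdf_isCdf hz
  hself := fun z hz x => by
    have hb0 : 0 < P.b := P.hc.trans P.hcb
    have hN0 : 0 < N := by have := P.hN; omega
    unfold cdf
    rw [bern_step hN0 P.hμ (P.mset z x)]
    congr 1
    apply Finset.sum_congr rfl
    intro i _
    congr 1
    ext w
    simp only [mem_ofPred_eq, P.hXs, P.hYs]
    rw [lt_div_iff₀ hb0]
    have : (P.Y w - (P.c * z - P.d i) / P.b * P.X w) * P.b =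
      P.b * P.Y w - (P.c * z - P.d i) * P.X w := by field_simp
    rw [this]
    constructor <;> intro h <;> linarith
  hlip := fun z hz z' hz' => by
    have hp := P.hμ.1
    have key : ∀ z z' : ℝ, ∀ x, P.cdf z x ≤ P.cdf z' (x + |z - z'|) := by
      intro z z' x
      refine measureReal_mono ?_ (measure_ne_top _ _)
      intro w hw
      simp only [mem_ofPred_eq] at hw ⊢
      have h := P.hX w
      have : (z - z') * P.X w ≤ |z - z'| := by
        have := le_abs_self (z - z')
        have := abs_nonneg (z - z')
        nlinarith [h.1, h.2]
      linarith
    have := W1_le_of_close (P.cdf_isCdf hz) (P.cdf_isCdf hz') (abs_nonneg (z - z')) (key z z')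
      (by rw [abs_sub_comm]; exact key z' z)
    refine this.trans (mul_le_mul_of_nonneg_right ?_ (abs_nonneg _))
    have := P.AA_ge; have := P.R_nonneg; linarith
  hu := fun i => by
    have h1 := single_le (f := P.u) i
    have hc1 : 0 < 1 - P.c := by have := P.hcb; have := P.hb; linarith
    have hb1 : 0 < 1 - P.b := by have := P.hb; linarith
    rw [← div_le_iff₀ hc1]
    have hR := P.R_nonneg
    have h2 : |P.u i| / (1 - P.c) ≤ (∑ i, |P.u i|) / (1 - P.c) := by gcongr
    have h4 : 0 ≤ ∑ i, |P.u i| := Finset.sum_nonneg fun i _ => abs_nonneg _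
    have h5 : 0 ≤ ∑ i, |P.v i| := Finset.sum_nonneg fun i _ => abs_nonneg _
    have h3 : 0 ≤ (∑ i, |P.v i| + P.R * ∑ i, |P.u i|) / (1 - P.b) := by positivity
    unfold AA; linarith
  ht := fun i z hz => by
    have h1 := single_le (f := P.u) i
    have h1' := single_le (f := P.v) i
    have hc1 : 0 < 1 - P.c := by have := P.hcb; have := P.hb; linarith
    have hb1 : 0 < 1 - P.b := by have := P.hb; linarith
    rw [← div_le_iff₀ hb1]
    have hR := P.R_nonneg
    have h4 : 0 ≤ ∑ i, |P.u i| := Finset.sum_nonneg fun i _ => abs_nonneg _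
    have h3 : 0 ≤ (∑ i, |P.u i|) / (1 - P.c) := by positivity
    have h5 : |P.v i - z * P.u i| ≤ ∑ i, |P.v i| + P.R * ∑ i, |P.u i| := by
      calc _ ≤ |P.v i| + |z * P.u i| := abs_sub _ _
        _ ≤ _ := by
          rw [abs_mul]
          exact add_le_add h1' (mul_le_mul (abs_le.2 hz) h1 (abs_nonneg _) hR)
    have h2 : |P.v i - z * P.u i| / (1 - P.b) ≤ (∑ i, |P.v i| + P.R * ∑ i, |P.u i|) / (1 - P.b) := by
      gcongr
    unfold AA; linarith

end Pair
end
end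

section
open MeasureTheory Filter Set Topology
open scoped ENNReal
noncomputable section

section slab
variable {Ω : Type*} [MeasurableSpace Ω] {μ : Measure Ω} [IsProbabilityMeasure μ]

theorem slab_cdf {Y : Ω → ℝ} (hY : ∀ x, Y x ∈ Icc (0:ℝ) 1) (E : Set Ω)
    (hE0 : μ.real E ≠ 0) : IsCdf 2 (fun y => μ.real (E ∩ {x | Y x < y}) / μ.real E) where
  mono := fun x y hxy => by
    have : μ.real (E ∩ {w | Y w < x}) ≤ μ.real (E ∩ {w | Y w < y}) :=
      measureReal_mono (inter_subset_inter_right _ (fun w hw => lt_of_lt_of_le hw hxy)) (measure_ne_top _ _)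
    have h0 : 0 ≤ μ.real E := measureReal_nonneg
    simp only
    gcongr
  left := fun x hx => by
    have : {w | Y w < x} = ∅ := by
      ext w
      simp only [mem_ofPred_eq, mem_empty_iff_false, iff_false, not_lt]
      linarith [(hY w).1]
    simp [this]
  right := fun x hx => by
    have : {w | Y w < x} = univ := by
      ext w
      simp only [mem_ofPred_eq, mem_univ, iff_true]
      linarith [(hY w).2]
    simp [this, hE0]

theorem slab_diff {Y : Ω → ℝ} (mY : Measurable Y) (E : Set Ω) {ℓ : ℝ} (hℓ : 0 ≤ ℓ) (y : ℝ) :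
    μ.real (E ∩ {x | y ≤ Y x ∧ Y x < y + ℓ}) = μ.real (E ∩ {x | Y x < y + ℓ}) - μ.real (E ∩ {x | Y x < y}) := by
  have h1 : E ∩ {x | y ≤ Y x ∧ Y x < y + ℓ} = (E ∩ {x | Y x < y + ℓ}) \ {x | Y x < y} := by
    ext x; simp; tauto
  have h2 : E ∩ {x | Y x < y} = (E ∩ {x | Y x < y + ℓ}) ∩ {x | Y x < y} := by
    ext x; simp only [mem_inter_iff, mem_ofPred_eq]
    constructor
    · rintro ⟨a, b⟩; exact ⟨⟨a, by linarith⟩, b⟩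
    · rintro ⟨⟨a, _⟩, b⟩; exact ⟨a, b⟩
  rw [h1, h2, eq_sub_iff_add_eq, add_comm]
  exact measureReal_inter_add_sdiff (measurableSet_lt mY measurable_const) (measure_ne_top _ _)

theorem slab {Y : Ω → ℝ} (mY : Measurable Y) (hY : ∀ x, Y x ∈ Icc (0:ℝ) 1) (E : Set Ω)
    {ℓ : ℝ} (hℓ : 0 ≤ ℓ) (a : ℝ) :
    Integrable (fun y => μ.real (E ∩ {x | y + a ≤ Y x ∧ Y x < y + a + ℓ})) ∧
    ∫ y, μ.real (E ∩ {x | y + a ≤ Y x ∧ Y x < y + a + ℓ}) = ℓ * μ.real E := by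
  by_cases hE0 : μ.real E = 0
  · have : ∀ y, μ.real (E ∩ {x | y + a ≤ Y x ∧ Y x < y + a + ℓ}) = 0 := fun y =>
      le_antisymm ((measureReal_mono inter_subset_left (measure_ne_top _ _)).trans hE0.le) measureReal_nonneg
    simp [this, hE0]
  · have h := slab_cdf (μ := μ) hY E hE0
    have e : ∀ y, μ.real (E ∩ {x | y + a ≤ Y x ∧ Y x < y + a + ℓ}) =
        μ.real E * pw (fun y => μ.real (E ∩ {x | Y x < y}) / μ.real E) ℓ (y + a) := by
      intro y
      rw [slab_diff mY E hℓ]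
      unfold pw; field_simp
    simp_rw [e]
    refine ⟨(h.integrable_pw.comp_add_right a).const_mul _, ?_⟩
    rw [integral_const_mul, integral_add_right_eq_self (fun y => pw _ ℓ y), h.integral_pw]
    ring

end slab

def consW {N : ℕ} : (n : ℕ) → (Fin n → Fin N) → (ℕ → Fin N) → (ℕ → Fin N)
  | 0, _, x => x
  | n + 1, w, x => consS (w 0) (consW n (Fin.tail w) x)

theorem measurable_consW {N n : ℕ} (w : Fin n → Fin N) : Measurable (consW n w) := by
  induction n with
  | zero => exact measurable_id
  | succ n ih => exact (measurable_consS _).comp (ih _)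

theorem bern_iter {N : ℕ} (hN : 0 < N) {μ : Measure (ℕ → Fin N)} (hμ : IsUniformBernoulli N μ) (n : ℕ)
    {E : Set (ℕ → Fin N)} (hE : MeasurableSet E) :
    μ.real E = wavg n (fun w => μ.real {x | consW n w x ∈ E}) := by
  induction n generalizing E with
  | zero => rw [wavg_zero]; rfl
  | succ n ih =>
    rw [bern_step hN hμ hE, wavg_succ]
    congr 1
    apply Finset.sum_congr rfl
    intro i _
    exact ih ((measurable_consS i) hE)

namespace Pair
variable {N : ℕ} (P : Pair N)

theorem X_consW (n : ℕ) (w : Fin n → Fin N) (x : ℕ → Fin N) :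
    P.X (consW n w x) = P.c ^ n * P.X x + P.toFam.hw n w := by
  induction n with
  | zero => simp [consW, Fam.hw]
  | succ n ih =>
    simp only [consW, Fam.hw, P.hXs, ih]
    change _ = _ + (P.u (w 0) + P.c * _)
    ring

theorem Y_consW (n : ℕ) (w : Fin n → Fin N) (x : ℕ → Fin N) (z : ℝ) :
    P.Y (consW n w x) - z * P.X (consW n w x) =
      P.b ^ n * (P.Y x - P.toFam.zw n w z * P.X x) + P.toFam.tw n w z := by
  have hb0 : P.b ≠ 0 := (P.hc.trans P.hcb).ne'
  induction n generalizing z with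
  | zero => simp [consW, Fam.zw, Fam.tw]
  | succ n ih =>
    have h := ih (Fin.tail w) (P.toFam.g (w 0) z)
    simp only [consW, Fam.zw, Fam.tw, P.hXs, P.hYs]
    change _ = _ + (P.v (w 0) - z * P.u (w 0) + P.b * _)
    have hg : P.toFam.g (w 0) z = (P.c * z - P.d (w 0)) / P.b := rfl
    rw [pow_succ', mul_assoc, eq_comm, add_left_comm, ← mul_add, ← h, hg]
    field_simp
    ring

theorem cdf_sig (n : ℕ) (w : Fin n → Fin N) (y : ℝ) :
    P.toFam.sig n 0 w y = P.μ.real {x | P.Y (consW n w x) < y} := by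
  unfold Fam.sig aff
  change P.μ.real {x | P.Y x - P.toFam.zw n w 0 * P.X x < (y - P.toFam.tw n w 0) / P.b ^ n} = _
  congr 1
  ext x
  have hb : 0 < P.b ^ n := pow_pos (P.hc.trans P.hcb) n
  have := P.Y_consW n w x 0
  rw [zero_mul, sub_zero] at this
  simp only [mem_ofPred_eq]
  rw [lt_div_iff₀ hb, this, lt_sub_iff_add_lt, mul_comm]

/-- the horizontal pair -/
def horiz : Pair N where
  μ := P.μ
  hμ := P.hμ
  b := P.c
  c := P.c ^ 2
  u := 0
  v := P.u
  d := 0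
  X := fun _ => 0
  Y := P.X
  hN := P.hN
  hc := pow_pos P.hc 2
  hcb := by have := P.hc; have := P.hcb; have := P.hb; nlinarith
  hb := P.hcb.trans P.hb
  mX := measurable_const
  mY := P.mX
  hX := fun _ => by simp
  hY := P.hX
  hXs := fun i x => by simp
  hYs := fun i x => by simp [P.hXs]

theorem horiz_K : ∀ z ∈ P.horiz.toFam.K, z = 0 := by
  intro z hz
  have : P.horiz.R = 0 := by simp [R, horiz]
  change z ∈ Icc (-P.horiz.R) P.horiz.R at hz
  rw [this] at hz
  simpa using hz

theorem zero_mem_K : (0:ℝ) ∈ P.toFam.K := by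
  change (0:ℝ) ∈ Icc (-P.R) P.R
  have := P.R_nonneg
  constructor <;> linarith

theorem horiz_tw (n : ℕ) (w : Fin n → Fin N) : P.horiz.toFam.tw n w 0 = P.toFam.hw n w := by
  rw [Fam.tw_psi _ rfl, Fam.hw_psi]; rfl

/-- bad points at scale `n` -/
def bad (ρ η : ℝ) : Set (ℕ → Fin N) :=
  {x | ρ < P.μ.real {y | |P.X y - P.X x| ≤ η ∧ |P.Y y - P.Y x| ≤ η}}

theorem bad_meas (ρ η : ℝ) : MeasurableSet (P.bad ρ η) := by
  have hp := P.hμ.1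
  have hX := P.mX
  have hY := P.mY
  have h1 : MeasurableSet {q : (ℕ → Fin N) × (ℕ → Fin N) |
      |P.X q.2 - P.X q.1| ≤ η ∧ |P.Y q.2 - P.Y q.1| ≤ η} := by
    apply MeasurableSet.inter
    · exact measurableSet_le (continuous_abs.measurable.comp ((hX.comp measurable_snd).sub (hX.comp measurable_fst))) measurable_const
    · exact measurableSet_le (continuous_abs.measurable.comp ((hY.comp measurable_snd).sub (hY.comp measurable_fst))) measurable_const
  have h2 := (measurable_measure_prodMk_left (ν := P.μ) h1).ennreal_toReal
  exact measurableSet_lt measurable_const h2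

theorem bad_point (n : ℕ) {s r ρ η x y : ℝ} (hs : 0 < s) (hr : 0 < r) (hrc : r ≤ P.c ^ n)
    (hρ : 0 < ρ) (hη : η ≤ r / 4) :
    ρ ^ s * P.μ.real ((P.bad ρ η ∩ {w | x + r / 4 ≤ P.X w ∧ P.X w < x + r / 4 + r / 2}) ∩
      {w | y + r / 4 ≤ P.Y w ∧ P.Y w < y + r / 4 + r / 2}) ≤
    wavg n (fun w => (P.horiz.toFam.Yw n 0 w ^ s *
      (Icc (P.toFam.hw n w - r) (P.toFam.hw n w + P.c ^ n)).indicator 1 x) *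
        pw (P.toFam.sig n 0 w) r y ^ (1 + s)) := by
  have hp := P.hμ.1
  have hN0 : 0 < N := by have := P.hN; omega
  set Q : Set (ℕ → Fin N) := {w | (x ≤ P.X w ∧ P.X w < x + r) ∧ (y ≤ P.Y w ∧ P.Y w < y + r)} with hQ
  have hQm : MeasurableSet Q := by
    have hX := P.mX
    have hY := P.mY
    apply MeasurableSet.inter <;> apply MeasurableSet.inter
    · exact measurableSet_le measurable_const hX
    · exact measurableSet_lt hX measurable_const
    · exact measurableSet_le measurable_const hY
    · exact measurableSet_lt hY measurable_const
  have step1 : ρ ^ s * P.μ.real ((P.bad ρ η ∩ {w | x + r / 4 ≤ P.X w ∧ P.X w < x + r / 4 + r / 2}) ∩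
      {w | y + r / 4 ≤ P.Y w ∧ P.Y w < y + r / 4 + r / 2}) ≤ P.μ.real Q ^ (1 + s) := by
    rcases eq_empty_or_nonempty ((P.bad ρ η ∩ {w | x + r / 4 ≤ P.X w ∧ P.X w < x + r / 4 + r / 2}) ∩
      {w | y + r / 4 ≤ P.Y w ∧ P.Y w < y + r / 4 + r / 2}) with h | ⟨w0, ⟨hb, hx1, hx2⟩, hy1, hy2⟩
    · rw [h]; simp; exact Real.rpow_nonneg measureReal_nonneg _
    · have h1 : ρ < P.μ.real Q := by
        refine lt_of_lt_of_le hb (measureReal_mono ?_ (measure_ne_top _ _))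
        rintro w ⟨h1, h2⟩
        rw [abs_le] at h1 h2
        refine ⟨⟨?_, ?_⟩, ?_, ?_⟩ <;> linarith
      have h2 : P.μ.real ((P.bad ρ η ∩ {w | x + r / 4 ≤ P.X w ∧ P.X w < x + r / 4 + r / 2}) ∩
          {w | y + r / 4 ≤ P.Y w ∧ P.Y w < y + r / 4 + r / 2}) ≤ P.μ.real Q := by
        refine measureReal_mono ?_ (measure_ne_top _ _)
        rintro w ⟨⟨_, a1, a2⟩, b1, b2⟩
        refine ⟨⟨?_, ?_⟩, ?_, ?_⟩ <;> linarith
      rw [add_comm 1 s, Real.rpow_add (hρ.trans h1), Real.rpow_one]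
      exact mul_le_mul (Real.rpow_le_rpow hρ.le h1.le hs.le) h2 measureReal_nonneg
        (Real.rpow_nonneg measureReal_nonneg _)
  refine step1.trans ?_
  rw [bern_iter hN0 P.hμ n hQm]
  have hcn : 0 < P.c ^ n := pow_pos P.hc n
  have hne : ∀ w, P.μ.real {a | consW n w a ∈ Q} ≠ 0 →
      x ∈ Icc (P.toFam.hw n w - r) (P.toFam.hw n w + P.c ^ n) := by
    intro w hw
    have hne : {a | consW n w a ∈ Q}.Nonempty := by
      rw [nonempty_iff_ne_empty]; intro h; rw [h] at hw; simp at hw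
    obtain ⟨a, ⟨h1, h2⟩, _⟩ := hne
    rw [P.X_consW] at h1 h2
    have h3 := P.hX a
    have h4 : 0 ≤ P.c ^ n * P.X a := mul_nonneg hcn.le h3.1
    have h5 : P.c ^ n * P.X a ≤ P.c ^ n := mul_le_of_le_one_right hcn.le h3.2
    constructor <;> linarith
  refine (wavg_rpow_le hN0 hs (Y := fun w => P.horiz.toFam.Yw n 0 w)
    (fun w => measureReal_nonneg) ?_).trans ?_
  · intro w hw
    unfold Fam.Yw
    apply wavg_mono
    intro w'
    have h1 := hne w hw
    split_ifs with h2 h3 h3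
    · exact le_rfl
    · exfalso; apply h3
      have h4 := hne w' h2
      rw [P.horiz_tw, P.horiz_tw]
      have hA : 0 < P.horiz.toFam.A := P.horiz.toFam.hA0
      change _ ≤ 2 * (P.horiz.toFam.A + 1) * P.c ^ n
      have : 2 * P.c ^ n ≤ 2 * (P.horiz.toFam.A + 1) * P.c ^ n := by nlinarith
      refine le_trans ?_ this
      rw [abs_le]
      constructor <;> linarith [h1.1, h1.2, h4.1, h4.2]
    · norm_num
    · norm_num
  · apply wavg_mono
    intro w
    rw [mul_assoc]
    apply mul_le_mul_of_nonneg_left _ (Real.rpow_nonneg (Fam.Yw_nonneg _ _ _ _) _)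
    by_cases h0 : P.μ.real {a | consW n w a ∈ Q} = 0
    · rw [h0, Real.zero_rpow (by linarith)]
      apply mul_nonneg
      · exact indicator_nonneg (fun _ _ => zero_le_one) _
      · exact Real.rpow_nonneg ((Fam.sig_cdf _ n P.zero_mem_K w).pw_nonneg hr.le y) _
    · rw [indicator_of_mem (hne w h0), Pi.one_apply, one_mul]
      apply Real.rpow_le_rpow measureReal_nonneg _ (by linarith)
      unfold pw
      rw [P.cdf_sig, P.cdf_sig]
      have := slab_diff (μ := P.μ) (Y := fun a => P.Y (consW n w a)) (P.mY.comp (measurable_consW w)) univ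
        hr.le y
      simp only [univ_inter] at this
      rw [← this]
      refine measureReal_mono ?_ (measure_ne_top _ _)
      rintro a ⟨_, h⟩
      exact h

theorem bad_r (n : ℕ) {s r ρ η : ℝ} (hs : 0 < s) (hr : 0 < r) (hrc : r ≤ P.c ^ n)
    (hrc2 : P.c ^ n ≤ 2 * r) (hρ : 0 < ρ) (hη : η ≤ r / 4) :
    ρ ^ s * P.μ.real (P.bad ρ η) ≤ 12 * wavg n (fun w => P.horiz.toFam.Yw n 0 w ^ s *
      Qr s (r / P.b ^ n) (P.toFam.F (P.toFam.zw n w 0))) := by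
  have hp := P.hμ.1
  -- integrate in y
  have hy : ∀ x, ρ ^ s * (r / 2 * P.μ.real (P.bad ρ η ∩ {w | x + r / 4 ≤ P.X w ∧ P.X w < x + r / 4 + r / 2}))
      ≤ wavg n (fun w => (P.horiz.toFam.Yw n 0 w ^ s * (r * Qr s (r / P.b ^ n) (P.toFam.F (P.toFam.zw n w 0)))) *
      (Icc (P.toFam.hw n w - r) (P.toFam.hw n w + P.c ^ n)).indicator 1 x) := by
    intro x
    obtain ⟨i1, e1⟩ := slab (μ := P.μ) P.mY P.hY
      (P.bad ρ η ∩ {w | x + r / 4 ≤ P.X w ∧ P.X w < x + r / 4 + r / 2}) (by positivity : 0 ≤ r / 2) (r / 4)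
    rw [← e1, ← integral_const_mul]
    have i2 : ∀ w, Integrable (fun y => (P.horiz.toFam.Yw n 0 w ^ s *
      (Icc (P.toFam.hw n w - r) (P.toFam.hw n w + P.c ^ n)).indicator 1 x) *
        pw (P.toFam.sig n 0 w) r y ^ (1 + s)) := fun w =>
      ((Fam.sig_cdf _ n P.zero_mem_K w).int_rpow hs r).const_mul _
    have h := integral_mono (i1.const_mul (ρ ^ s)) (Fam.integrable_wavg n _ i2)
      (fun y => P.bad_point n hs hr hrc hρ hη (x := x) (y := y))
    rw [Fam.wavg_integral n _ i2] at h
    refine h.trans (le_of_eq ?_)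
    congr 1; ext w
    rw [integral_const_mul]
    have h3 := P.toFam.Qr_sig n 0 w s r
    change _ = Qr s (r / P.b ^ n) _ at h3
    rw [← h3]; unfold Qr
    field_simp
  obtain ⟨i1, e1⟩ := slab (μ := P.μ) P.mX P.hX (P.bad ρ η) (by positivity : 0 ≤ r / 2) (r / 4)
  have i2 : ∀ w, Integrable (fun x => (P.horiz.toFam.Yw n 0 w ^ s *
      (r * Qr s (r / P.b ^ n) (P.toFam.F (P.toFam.zw n w 0)))) *
      (Icc (P.toFam.hw n w - r) (P.toFam.hw n w + P.c ^ n)).indicator (1 : ℝ → ℝ) x) := fun w => by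
    apply Integrable.const_mul
    rw [integrable_indicator_iff measurableSet_Icc]
    exact integrableOn_const (by simp)
  have h := integral_mono ((i1.const_mul (r / 2)).const_mul (ρ ^ s)) (Fam.integrable_wavg n _ i2) hy
  rw [Fam.wavg_integral n _ i2, integral_const_mul, integral_const_mul, e1] at h
  have hcn : 0 < P.c ^ n := pow_pos P.hc n
  have e3 : ∀ w, ∫ x, (P.horiz.toFam.Yw n 0 w ^ s *
      (r * Qr s (r / P.b ^ n) (P.toFam.F (P.toFam.zw n w 0)))) *
      (Icc (P.toFam.hw n w - r) (P.toFam.hw n w + P.c ^ n)).indicator (1 : ℝ → ℝ) x =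
      (r * (P.c ^ n + r)) * (P.horiz.toFam.Yw n 0 w ^ s *
      Qr s (r / P.b ^ n) (P.toFam.F (P.toFam.zw n w 0))) := by
    intro w
    rw [integral_const_mul, integral_indicator_one measurableSet_Icc, Real.volume_real_Icc_of_le (by linarith)]
    ring
  simp_rw [e3] at h
  rw [wavg_mul] at h
  set W := wavg n (fun w => P.horiz.toFam.Yw n 0 w ^ s *
      Qr s (r / P.b ^ n) (P.toFam.F (P.toFam.zw n w 0))) with hW
  have hW0 : 0 ≤ W := wavg_nonneg fun w => mul_nonneg (Real.rpow_nonneg (Fam.Yw_nonneg _ _ _ _) _)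
    (Qr_nonneg (P.toFam.hF _ (Fam.zw_mem _ n w P.zero_mem_K))
      (div_pos hr (pow_pos (P.hc.trans P.hcb) n)))
  have h5 : r * (P.c ^ n + r) * W ≤ r * (3 * r) * W := by
    apply mul_le_mul_of_nonneg_right _ hW0
    apply mul_le_mul_of_nonneg_left _ hr.le
    linarith
  have h6 : r ^ 2 * (ρ ^ s * P.μ.real (P.bad ρ η)) ≤ r ^ 2 * (12 * W) := by nlinarith
  exact le_of_mul_le_mul_left h6 (by positivity)

end Pair
end
end

section
open MeasureTheory Filter Set Topology
open scoped ENNReal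
noncomputable section

namespace Pair
variable {N : ℕ} (P : Pair N)

theorem chi_lt : P.toFam.chi < P.horiz.toFam.chi := by
  change -Real.log P.b < -Real.log P.c
  exact neg_lt_neg (Real.log_lt_log P.hc P.hcb)

theorem exp_tau_c (n : ℕ) {τ : ℝ} (hτ : τ ∈ Icc (n * P.horiz.toFam.chi) (n * P.horiz.toFam.chi + Real.log 2)) :
    Real.exp (-τ) ≤ P.c ^ n ∧ P.c ^ n ≤ 2 * Real.exp (-τ) := by
  have h : Real.exp (-(n * P.horiz.toFam.chi)) = P.c ^ n := P.horiz.toFam.exp_chi n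
  rw [← h]
  constructor
  · apply Real.exp_le_exp.2; linarith [hτ.1]
  · have : (2:ℝ) = Real.exp (Real.log 2) := (Real.exp_log two_pos).symm
    rw [this, ← Real.exp_add]
    apply Real.exp_le_exp.2; linarith [hτ.2]

theorem bad_avg (n : ℕ) {s ρ : ℝ} (hs : 0 < s) (hρ : 0 < ρ) :
    ρ ^ s * P.μ.real (P.bad ρ (P.c ^ n / 8)) ≤ 12 * wavg n (fun w => P.horiz.toFam.Yw n 0 w ^ s *
      P.toFam.QT s (n * (P.horiz.toFam.chi - P.toFam.chi)) (P.toFam.zw n w 0)) := by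
  have hl := Fam.log2_pos
  set T := n * (P.horiz.toFam.chi - P.toFam.chi) with hT
  obtain ⟨i1, e1⟩ := P.toFam.QT_wavg n (s := s) (T := T) (fun w => P.toFam.zw n w 0)
    (fun w => Fam.zw_mem _ n w P.zero_mem_K) hs (fun w => P.horiz.toFam.Yw n 0 w ^ s)
  rw [← e1]
  have h := intervalIntegral.integral_mono_on (by linarith : T ≤ T + Real.log 2)
    (intervalIntegrable_const (c := ρ ^ s * P.μ.real (P.bad ρ (P.c ^ n / 8)))) (i1.const_mul 12) (by
      intro τ hτ
      have hr := Real.exp_pos (-(τ + n * P.toFam.chi))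
      have hm : τ + n * P.toFam.chi ∈ Icc (n * P.horiz.toFam.chi) (n * P.horiz.toFam.chi + Real.log 2) := by
        rw [hT] at hτ
        constructor <;> linarith [hτ.1, hτ.2]
      obtain ⟨h1, h2⟩ := P.exp_tau_c n hm
      have h3 := P.bad_r n hs hr h1 h2 hρ (η := P.c ^ n / 8) (by linarith)
      have h4 : Real.exp (-(τ + n * P.toFam.chi)) / P.b ^ n = Real.exp (-τ) := by
        have : Real.exp (-(n * P.toFam.chi)) = P.b ^ n := P.toFam.exp_chi n
        rw [← this, ← Real.exp_sub]; congr 1; ring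
      rw [h4] at h3
      exact h3)
  rw [intervalIntegral.integral_const, intervalIntegral.integral_const_mul, smul_eq_mul] at h
  rw [add_sub_cancel_left] at h
  have h5 : (Real.log 2)⁻¹ * (Real.log 2 * (ρ ^ s * P.μ.real (P.bad ρ (P.c ^ n / 8)))) =
    ρ ^ s * P.μ.real (P.bad ρ (P.c ^ n / 8)) := by field_simp
  rw [← h5]
  have := mul_le_mul_of_nonneg_left h (inv_pos.2 hl).le
  refine this.trans (le_of_eq ?_)
  ring

theorem bad_decay (hcN : P.c < 1 / N) (h1 : P.toFam.NA) (h2 : P.toFam.Sep) (h3 : P.horiz.toFam.NA)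
    (h4 : P.horiz.toFam.Sep) {D : ℝ}
    (hD : D * P.horiz.toFam.chi < (P.horiz.toFam.chi - P.toFam.chi) / P.toFam.chi *
      min P.toFam.chi (Real.log N) + Real.log N) :
    ∃ C > 0, ∃ θ > 0, θ < 1 ∧ ∀ n : ℕ, P.μ.real (P.bad (P.c ^ (n * D)) (P.c ^ n / 8)) ≤ C * θ ^ n := by
  have hN0 : (0:ℝ) < N := by have := P.hN; exact_mod_cast (by omega : 0 < N)
  have l2 := Fam.log2_pos
  have hχ1 := P.toFam.chi_pos
  have hχ2 := P.horiz.toFam.chi_pos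
  have hχ := P.chi_lt
  have hh : Real.log N ≤ P.horiz.toFam.chi := by
    change _ ≤ -Real.log P.c
    rw [← Real.log_inv]
    apply Real.log_le_log hN0
    rw [le_inv_comm₀ hN0 P.hc]
    rw [← one_div]; exact hcN.le
  have hL1 : min P.toFam.chi (Real.log N) ≤ P.toFam.Lam / Real.log 2 := by
    rw [le_div_iff₀ l2, mul_comm]; exact P.toFam.thmE h1 h2
  have hL2 : Real.log N ≤ P.horiz.toFam.Lam / Real.log 2 := by
    have := P.horiz.toFam.thmE h3 h4
    rw [min_eq_right hh] at this
    rw [le_div_iff₀ l2, mul_comm]; exact this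
  set χ1 := P.toFam.chi with e1
  set χ2 := P.horiz.toFam.chi with e2
  set L1 := P.toFam.Lam / Real.log 2 with eL1
  set L2 := P.horiz.toFam.Lam / Real.log 2 with eL2
  set m := min χ1 (Real.log N) with em
  set E := (χ2 - χ1) / χ1 * m + Real.log N with eE
  set κ := (E - D * χ2) / 2 with eκ
  have hκ : 0 < κ := by rw [eκ]; linarith
  set ε := κ * χ1 / χ2 with eε
  have hε : 0 < ε := by positivity
  obtain ⟨s1, hs1, H1⟩ := P.toFam.QT_decay hε
  obtain ⟨s2, hs2, H2⟩ := P.horiz.toFam.QT_decay hε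
  set s := min s1 s2 with es
  have hs : 0 < s := lt_min hs1 hs2
  obtain ⟨C1, hC1, H1⟩ := H1 s hs (min_le_left _ _)
  obtain ⟨C2, hC2, H2⟩ := H2 s hs (min_le_right _ _)
  rw [← eL1, ← e1] at H1
  rw [← eL2] at H2
  have hk : (0:ℝ) < (P.horiz.toFam.kk : ℝ) ^ s :=
    Real.rpow_pos_of_pos (by exact_mod_cast P.horiz.toFam.kk_pos) _
  refine ⟨12 * (C1 * ((P.horiz.toFam.kk : ℝ) ^ s * C2)), by positivity, Real.exp (-(s * κ)), Real.exp_pos _, ?_, ?_⟩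
  · rw [Real.exp_lt_one_iff]; nlinarith
  intro n
  have hρ : 0 < P.c ^ (n * D) := Real.rpow_pos_of_pos P.hc _
  have B := P.bad_avg n hs hρ
  have B2 := P.horiz.toFam.Yw_decay hs H2 n P.horiz.zero_mem_K
  have B3 : wavg n (fun w => P.horiz.toFam.Yw n 0 w ^ s *
      P.toFam.QT s (n * (χ2 - χ1)) (P.toFam.zw n w 0)) ≤
      (C1 * Real.exp (-(s * (n * (χ2 - χ1) / χ1 * (L1 - ε))))) *
      ((P.horiz.toFam.kk : ℝ) ^ s * C2 * Real.exp (-(s * (n * (L2 - ε))))) := by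
    refine le_trans (wavg_mono (g := fun w => (C1 * Real.exp (-(s * (n * (χ2 - χ1) / χ1 * (L1 - ε))))) *
      P.horiz.toFam.Yw n 0 w ^ s) fun w => ?_) ?_
    · rw [mul_comm]
      apply mul_le_mul_of_nonneg_right _ (Real.rpow_nonneg (Fam.Yw_nonneg _ _ _ _) _)
      exact H1 _ (mul_nonneg (Nat.cast_nonneg _) (by linarith)) _ (Fam.zw_mem _ n w P.zero_mem_K)
    · rw [wavg_mul]
      exact mul_le_mul_of_nonneg_left B2 (by positivity)
  have e3 : (P.c ^ (n * D)) ^ s = Real.exp (-(s * (n * (D * χ2)))) := by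
    have : χ2 = -Real.log P.c := rfl
    rw [← Real.rpow_mul P.hc.le, Real.rpow_def_of_pos P.hc, this]
    congr 1; ring
  rw [e3] at B
  have B4 := B.trans (mul_le_mul_of_nonneg_left B3 (by norm_num))
  have e4 : Real.exp (-(s * κ)) ^ n = Real.exp (-(s * (n * κ))) := by
    rw [← Real.exp_nat_mul]; congr 1; ring
  rw [e4]
  have hpos := Real.exp_pos (-(s * (n * (D * χ2))))
  rw [← mul_le_mul_iff_right₀ hpos]
  refine B4.trans ?_
  have e5 : ∀ a b : ℝ, 12 * (C1 * Real.exp a * ((P.horiz.toFam.kk : ℝ) ^ s * C2 * Real.exp b)) =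
      12 * (C1 * ((P.horiz.toFam.kk : ℝ) ^ s * C2)) * Real.exp (a + b) := by
    intro a b; rw [Real.exp_add]; ring
  rw [e5, mul_left_comm (Real.exp _), ← Real.exp_add]
  apply mul_le_mul_of_nonneg_left _ (by positivity)
  apply Real.exp_le_exp.2
  have hr : 0 ≤ (χ2 - χ1) / χ1 := div_nonneg (by linarith) hχ1.le
  have key : D * χ2 + κ ≤ (χ2 - χ1) / χ1 * (L1 - ε) + (L2 - ε) := by
    have a1 := mul_le_mul_of_nonneg_left hL1 hr
    have a2 : (χ2 - χ1) / χ1 * ε + ε = κ := by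
      rw [eε]; field_simp; ring
    have a3 : D * χ2 + 2 * κ = E := by rw [eκ]; ring
    rw [mul_sub]; linarith
  have := mul_le_mul_of_nonneg_left key (mul_nonneg hs.le (Nat.cast_nonneg n))
  have e6 : n * (χ2 - χ1) / χ1 = n * ((χ2 - χ1) / χ1) := by ring
  rw [e6]
  linarith

end Pair
end
end

section
open MeasureTheory Filter Set Topology
open scoped ENNReal NNReal
noncomputable section

theorem ball_meas (ν : Measure (ℝ × ℝ)) [IsProbabilityMeasure ν] (ρ η : ℝ) :
    MeasurableSet {p : ℝ × ℝ | ρ < ν.real (Metric.closedBall p η)} := by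
  have h1 : MeasurableSet {q : (ℝ × ℝ) × (ℝ × ℝ) | dist q.2 q.1 ≤ η} :=
    measurableSet_le (measurable_snd.dist measurable_fst) measurable_const
  have h2 := (measurable_measure_prodMk_left (ν := ν) h1).ennreal_toReal
  exact measurableSet_lt measurable_const h2

theorem mass_dist {ν : Measure (ℝ × ℝ)} [IsProbabilityMeasure ν] {c D C θ : ℝ} (hc : 0 < c) (hc1 : c < 1)
    (hD : 0 < D) (hC : 0 < C) (hθ : 0 < θ) (hθ1 : θ < 1)
    (h : ∀ n : ℕ, ν.real {p | c ^ (n * D) < ν.real (Metric.closedBall p (c ^ n / 8))} ≤ C * θ ^ n)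
    {A : Set (ℝ × ℝ)} (hA : ν A = 1) : ENNReal.ofReal D ≤ dimH A := by
  obtain ⟨n0, hn0⟩ : ∃ n0 : ℕ, C * θ ^ n0 * (1 - θ)⁻¹ < 1 := by
    have t : Tendsto (fun n : ℕ => C * θ ^ n * (1 - θ)⁻¹) atTop (𝓝 (C * 0 * (1 - θ)⁻¹)) :=
      ((tendsto_pow_atTop_nhds_zero_of_lt_one hθ.le hθ1).const_mul C).mul_const _
    rw [mul_zero, zero_mul] at t
    exact (t.eventually (gt_mem_nhds one_pos)).exists
  set B : ℕ → Set (ℝ × ℝ) := fun n => {p | c ^ (n * D) < ν.real (Metric.closedBall p (c ^ n / 8))} with hB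
  have mB : ∀ n, MeasurableSet (B n) := fun n => ball_meas ν _ _
  set G : Set (ℝ × ℝ) := (⋃ n, B (n + n0))ᶜ with hG
  have mG : MeasurableSet G := (MeasurableSet.iUnion fun n => mB _).compl
  have hGc : ν Gᶜ < 1 := by
    rw [hG, compl_compl]
    refine lt_of_le_of_lt (measure_iUnion_le _) ?_
    have hsum : HasSum (fun n : ℕ => C * θ ^ (n + n0)) (C * θ ^ n0 * (1 - θ)⁻¹) := by
      have := (hasSum_geometric_of_lt_one hθ.le hθ1).mul_left (C * θ ^ n0)
      have e : (fun n : ℕ => C * θ ^ (n + n0)) = fun n => C * θ ^ n0 * θ ^ n := by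
        ext n; rw [pow_add]; ring
      rw [e]; exact this
    calc ∑' n, ν (B (n + n0)) ≤ ∑' n, ENNReal.ofReal (C * θ ^ (n + n0)) := by
          apply ENNReal.tsum_le_tsum
          intro n
          rw [← ofReal_measureReal (measure_ne_top _ _)]
          exact ENNReal.ofReal_le_ofReal (h _)
      _ = ENNReal.ofReal (C * θ ^ n0 * (1 - θ)⁻¹) := by
          rw [← hsum.tsum_eq, ENNReal.ofReal_tsum_of_nonneg (fun n => by positivity) hsum.summable]
      _ < 1 := by rw [← ENNReal.ofReal_one]; exact (ENNReal.ofReal_lt_ofReal_iff one_pos).2 hn0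
  have hAG : ν (A ∩ G) ≠ 0 := by
    intro h0
    have : ν A ≤ ν (A ∩ G) + ν Gᶜ := by
      refine (measure_mono ?_).trans (measure_union_le _ _)
      intro x hx
      by_cases hxG : x ∈ G
      · left; exact ⟨hx, hxG⟩
      · right; exact hxG
    rw [h0, zero_add, hA] at this
    exact absurd hGc (not_lt.2 this)
  set k : ℝ := (8 / c) ^ D with hk
  have hk0 : 0 < k := Real.rpow_pos_of_pos (by positivity) _
  -- mass bound
  have hmass : ∀ U : Set (ℝ × ℝ), Metric.ediam U ≤ ENNReal.ofReal (c ^ n0 / 8) →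
      ν (U ∩ G) ≤ ENNReal.ofReal k * Metric.ediam U ^ D := by
    intro U hU
    rcases eq_empty_or_nonempty (U ∩ G) with h0 | ⟨p, hpU, hpG⟩
    · rw [h0]; simp
    have hfin : Metric.ediam U ≠ ⊤ := (hU.trans_lt ENNReal.ofReal_lt_top).ne
    set δ := (Metric.ediam U).toReal with hδ
    have hδe : Metric.ediam U = ENNReal.ofReal δ := (ENNReal.ofReal_toReal hfin).symm
    have hδ0 : 0 ≤ δ := ENNReal.toReal_nonneg
    have hδ1 : δ ≤ c ^ n0 / 8 := by
      rw [hδe] at hU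
      exact (ENNReal.ofReal_le_ofReal_iff (by positivity)).1 hU
    have hball : ∀ n, n0 ≤ n → δ ≤ c ^ n / 8 → ν (U ∩ G) ≤ ENNReal.ofReal (c ^ (n * D)) := by
      intro n hn hδn
      have h1 : p ∉ B n := by
        rw [hG, mem_compl_iff, mem_iUnion, not_exists] at hpG
        have := hpG (n - n0)
        rwa [Nat.sub_add_cancel hn] at this
      have h2 : ν.real (Metric.closedBall p (c ^ n / 8)) ≤ c ^ (n * D) := not_lt.1 h1
      refine le_trans (measure_mono ?_) (le_trans (le_of_eq (ofReal_measureReal (measure_ne_top ν _)).symm)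
        (ENNReal.ofReal_le_ofReal h2))
      rintro q ⟨hq, _⟩
      rw [Metric.mem_closedBall]
      refine le_trans ?_ hδn
      have := Metric.edist_le_ediam_of_mem hq hpU
      rw [hδe, edist_dist] at this
      exact (ENNReal.ofReal_le_ofReal_iff hδ0).1 this
    rcases hδ0.eq_or_lt with h0 | hpos
    · have : ν (U ∩ G) ≤ 0 := by
        have t : Tendsto (fun n : ℕ => ENNReal.ofReal (c ^ ((n:ℝ) * D))) atTop (𝓝 (ENNReal.ofReal 0)) := by
          apply ENNReal.tendsto_ofReal
          have e : ∀ n : ℕ, c ^ ((n:ℝ) * D) = (c ^ D) ^ n := fun n => by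
            rw [mul_comm, Real.rpow_mul hc.le, Real.rpow_natCast]
          simp_rw [e]
          exact tendsto_pow_atTop_nhds_zero_of_lt_one (Real.rpow_nonneg hc.le _)
            (Real.rpow_lt_one hc.le hc1 hD)
        rw [ENNReal.ofReal_zero] at t
        refine ge_of_tendsto t ?_
        filter_upwards [eventually_ge_atTop n0] with n hn
        exact hball n hn (by rw [← h0]; positivity)
      exact this.trans zero_le
    · have hle1 : 8 * δ ≤ 1 := by
        have : c ^ n0 ≤ 1 := pow_le_one₀ hc.le hc1.le
        linarith
      obtain ⟨n, hn1, hn2⟩ := exists_nat_pow_near_of_lt_one (by positivity : 0 < 8 * δ) hle1 hc hc1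
      have hnn : n0 ≤ n := by
        by_contra hcon
        have : n + 1 ≤ n0 := by omega
        have := pow_le_pow_of_le_one hc.le hc1.le this
        linarith
      refine (hball n hnn (by linarith)).trans ?_
      rw [hδe, ENNReal.ofReal_rpow_of_pos hpos, ← ENNReal.ofReal_mul hk0.le]
      apply ENNReal.ofReal_le_ofReal
      rw [hk, ← Real.mul_rpow (by positivity) hδ0, Real.rpow_mul hc.le, Real.rpow_natCast]
      apply Real.rpow_le_rpow (by positivity) _ hD.le
      rw [div_mul_eq_mul_div, le_div_iff₀ hc, ← pow_succ]
      exact hn1.le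
  have hle : (ENNReal.ofReal k)⁻¹ • ν.restrict G ≤ Measure.hausdorffMeasure D := by
    apply Measure.le_hausdorffMeasure D _ (ENNReal.ofReal (c ^ n0 / 8))
    · rw [ENNReal.ofReal_pos]; positivity
    · intro U hU
      rw [Measure.smul_apply, Measure.restrict_apply' mG, smul_eq_mul]
      have hkne : ENNReal.ofReal k ≠ 0 := (ENNReal.ofReal_pos.2 hk0).ne'
      calc _ ≤ (ENNReal.ofReal k)⁻¹ * (ENNReal.ofReal k * Metric.ediam U ^ D) := by
            gcongr; exact hmass U hU
        _ = _ := by rw [← mul_assoc, ENNReal.inv_mul_cancel hkne ENNReal.ofReal_ne_top, one_mul]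
  have hne : Measure.hausdorffMeasure ((D.toNNReal : ℝ≥0) : ℝ) A ≠ 0 := by
    rw [Real.coe_toNNReal D hD.le]
    have := hle A
    rw [Measure.smul_apply, Measure.restrict_apply' mG, smul_eq_mul] at this
    intro h0
    rw [h0, nonpos_iff_eq_zero, mul_eq_zero] at this
    rcases this with h1 | h1
    · exact ENNReal.ofReal_ne_top (ENNReal.inv_eq_zero.1 h1)
    · exact hAG h1
  exact le_dimH_of_hausdorffMeasure_ne_zero hne

end
end

section
open MeasureTheory Filter Set Topology
open scoped ENNReal NNReal
noncomputable section

theorem cover_dim {A : Set (ℝ × ℝ)} {r q C K D : ℝ} (hr : 0 < r) (hr1 : r < 1) (hq : 0 < q) (hC : 0 < C)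
    (hD : 0 ≤ D) (hqr : q * r ^ D ≤ 1) {ι : ℕ → Type} [∀ n, Fintype (ι n)] (t : ∀ n, ι n → Set (ℝ × ℝ))
    (ht : ∀ n i, Metric.ediam (t n i) ≤ ENNReal.ofReal (C * r ^ n)) (hA : ∀ n, A ⊆ ⋃ i, t n i)
    (hcard : ∀ n, (Fintype.card (ι n) : ℝ) ≤ K * q ^ n) : dimH A ≤ ENNReal.ofReal D := by
  have hK : 0 ≤ K := by
    have := (Nat.cast_nonneg _).trans (hcard 0)
    simpa using this
  apply dimH_le_of_hausdorffMeasure_ne_top (d := D.toNNReal)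
  rw [Real.coe_toNNReal D hD]
  have t0 : Tendsto (fun n : ℕ => ENNReal.ofReal (C * r ^ n)) atTop (𝓝 0) := by
    rw [← ENNReal.ofReal_zero]
    apply ENNReal.tendsto_ofReal
    have := (tendsto_pow_atTop_nhds_zero_of_lt_one hr.le hr1).const_mul C
    rwa [mul_zero] at this
  have h := Measure.hausdorffMeasure_le_liminf_sum D A (fun n : ℕ => ENNReal.ofReal (C * r ^ n)) t0 t
    (Eventually.of_forall ht) (Eventually.of_forall hA)
  have hsum : ∀ n, ∑ i, Metric.ediam (t n i) ^ D ≤ ENNReal.ofReal (K * C ^ D) := by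
    intro n
    have hCr : 0 < C * r ^ n := by positivity
    calc ∑ i, Metric.ediam (t n i) ^ D ≤ ∑ _i : ι n, ENNReal.ofReal (C * r ^ n) ^ D :=
          Finset.sum_le_sum fun i _ => ENNReal.rpow_le_rpow (ht n i) hD
      _ = ENNReal.ofReal (Fintype.card (ι n) * (C * r ^ n) ^ D) := by
          rw [Finset.sum_const, Finset.card_univ, nsmul_eq_mul, ENNReal.ofReal_mul (Nat.cast_nonneg _),
            ENNReal.ofReal_natCast, ENNReal.ofReal_rpow_of_pos hCr]
      _ ≤ _ := by
          apply ENNReal.ofReal_le_ofReal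
          have e : (C * r ^ n) ^ D = C ^ D * (r ^ D) ^ n := by
            rw [Real.mul_rpow hC.le (by positivity), ← Real.rpow_natCast r n, ← Real.rpow_natCast (r ^ D) n,
              ← Real.rpow_mul hr.le, ← Real.rpow_mul hr.le, mul_comm D]
          rw [e]
          have hrD : 0 < r ^ D := Real.rpow_pos_of_pos hr _
          have hCD : 0 < C ^ D := Real.rpow_pos_of_pos hC _
          calc _ ≤ (K * q ^ n) * (C ^ D * (r ^ D) ^ n) :=
                mul_le_mul_of_nonneg_right (hcard n) (by positivity)
            _ = (K * C ^ D) * (q * r ^ D) ^ n := by rw [mul_pow]; ring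
            _ ≤ (K * C ^ D) * 1 := by
                apply mul_le_mul_of_nonneg_left _ (by positivity)
                exact pow_le_one₀ (by positivity) hqr
            _ = _ := mul_one _
  have h2 : liminf (fun n => ∑ i, Metric.ediam (t n i) ^ D) atTop ≤ ENNReal.ofReal (K * C ^ D) :=
    liminf_le_of_frequently_le' (Frequently.of_forall hsum)
  exact ((h.trans h2).trans_lt ENNReal.ofReal_lt_top).ne

theorem box_diam {a l e m r : ℝ} (hl : l ≤ r) (hm : m ≤ r) :
    Metric.ediam (Icc a (a + l) ×ˢ Icc e (e + m)) ≤ ENNReal.ofReal r := by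
  apply Metric.ediam_le
  rintro ⟨x1, y1⟩ ⟨hx1, hy1⟩ ⟨x2, y2⟩ ⟨hx2, hy2⟩
  rw [edist_dist]
  apply ENNReal.ofReal_le_ofReal
  simp only [mem_Icc] at hx1 hy1 hx2 hy2
  rw [Prod.dist_eq]
  apply max_le <;> rw [Real.dist_eq, abs_le] <;> constructor <;> simp only <;> linarith

namespace Pair
variable {N : ℕ} (P : Pair N)

def boxQ (n : ℕ) (w : Fin n → Fin N) : Set (ℝ × ℝ) :=
  Icc (P.toFam.hw n w) (P.toFam.hw n w + P.c ^ n) ×ˢ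
    Icc (P.toFam.tw n w 0 - P.b ^ n * (1 + P.R))
      (P.toFam.tw n w 0 - P.b ^ n * (1 + P.R) + 2 * (1 + P.R) * P.b ^ n)

def att : Set (ℝ × ℝ) := ⋂ n, ⋃ w, P.boxQ n w

theorem att_closed : IsClosed P.att :=
  isClosed_iInter fun n => isClosed_iUnion_of_finite fun w => isClosed_Icc.prod isClosed_Icc

theorem consW_surj (n : ℕ) (x : ℕ → Fin N) : ∃ w y, consW n w y = x := by
  induction n generalizing x with
  | zero => exact ⟨Fin.elim0, x, rfl⟩
  | succ n ih =>
    obtain ⟨w, y, h⟩ := ih (fun k => x (k + 1))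
    refine ⟨Fin.cons (x 0) w, y, ?_⟩
    simp only [consW, Fin.cons_zero, Fin.tail_cons, h]
    ext k
    cases k <;> rfl

theorem mem_att (x : ℕ → Fin N) : (P.X x, P.Y x) ∈ P.att := by
  rw [att, mem_iInter]
  intro n
  obtain ⟨w, y, rfl⟩ := consW_surj n x
  rw [mem_iUnion]
  refine ⟨w, ?_⟩
  have hcn : 0 < P.c ^ n := pow_pos P.hc n
  have hbn : 0 < P.b ^ n := pow_pos (P.hc.trans P.hcb) n
  have hX := P.hX y
  have hY := P.hY y
  have e := P.Y_consW n w y 0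
  rw [zero_mul, sub_zero] at e
  have hz : P.toFam.zw n w 0 ∈ Icc (-P.R) P.R := Fam.zw_mem _ n w P.zero_mem_K
  have h1 := abs_le.1 (P.zX hz y)
  refine ⟨?_, ?_⟩
  · simp only [P.X_consW, mem_Icc]
    constructor <;> nlinarith [hX.1, hX.2]
  · simp only [e, mem_Icc]
    have hR := P.R_nonneg
    have a1 : -(1 + P.R) ≤ P.Y y - P.toFam.zw n w 0 * P.X y := by linarith [hY.1]
    have a2 : P.Y y - P.toFam.zw n w 0 * P.X y ≤ 1 + P.R := by linarith [hY.2]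
    have b1 := mul_le_mul_of_nonneg_left a1 hbn.le
    have b2 := mul_le_mul_of_nonneg_left a2 hbn.le
    constructor <;> linarith

theorem att_dim1 : dimH P.att ≤ ENNReal.ofReal (Real.log N / (-Real.log P.b)) := by
  have hb0 : 0 < P.b := P.hc.trans P.hcb
  have hN1 : (1:ℝ) ≤ N := by have := P.hN; exact_mod_cast (by omega : 1 ≤ N)
  have hN0 : (0:ℝ) < N := by linarith
  have hlb : Real.log P.b < 0 := Real.log_neg hb0 P.hb
  have hR := P.R_nonneg
  refine cover_dim (r := P.b) (q := N) (C := 2 * (1 + P.R)) (K := 1) hb0 P.hb hN0 (by positivity)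
    (div_nonneg (Real.log_nonneg hN1) (by linarith)) ?_ (fun n w => P.boxQ n w) ?_ ?_ ?_
  · apply le_of_eq
    rw [Real.rpow_def_of_pos hb0]
    have : Real.log P.b * (Real.log N / -Real.log P.b) = -Real.log N := by
      have := hlb.ne; field_simp
    rw [this, Real.exp_neg, Real.exp_log hN0, mul_inv_cancel₀ hN0.ne']
  · intro n w
    apply box_diam _ le_rfl
    have h1 : P.c ^ n ≤ P.b ^ n := pow_le_pow_left₀ P.hc.le P.hcb.le n
    have h2 : 0 < P.b ^ n := pow_pos hb0 n
    nlinarith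
  · intro n x hx
    exact mem_iInter.1 hx n
  · intro n
    simp

theorem att_dim2 : dimH P.att ≤ ENNReal.ofReal (1 + Real.log (N * P.b) / (-Real.log P.c)) := by
  have hb0 : 0 < P.b := P.hc.trans P.hcb
  have hc0 := P.hc
  have hc1 : P.c < 1 := P.hcb.trans P.hb
  have hN1 : (1:ℝ) ≤ N := by have := P.hN; exact_mod_cast (by omega : 1 ≤ N)
  have hN0 : (0:ℝ) < N := by linarith
  have hlc : Real.log P.c < 0 := Real.log_neg hc0 hc1
  have hR := P.R_nonneg
  have hM : ∀ n : ℕ, 0 < P.b ^ n / P.c ^ n := fun n => by positivity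
  refine cover_dim (r := P.c) (q := N * P.b / P.c) (C := 1) (K := 2 * (1 + P.R) + 1) hc0 hc1
    (by positivity) one_pos ?_ ?_ (ι := fun n => (Fin n → Fin N) × Fin (⌊2 * (1 + P.R) * P.b ^ n / P.c ^ n⌋₊ + 1))
    (fun n i => Icc (P.toFam.hw n i.1) (P.toFam.hw n i.1 + P.c ^ n) ×ˢ
    Icc (P.toFam.tw n i.1 0 - P.b ^ n * (1 + P.R) + (i.2 : ℕ) * P.c ^ n)
      (P.toFam.tw n i.1 0 - P.b ^ n * (1 + P.R) + (i.2 : ℕ) * P.c ^ n + P.c ^ n)) ?_ ?_ ?_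
  · have h1 : Real.log P.c ≤ Real.log (N * P.b) := Real.log_le_log hc0 (by nlinarith [P.hcb])
    have : -1 ≤ Real.log (N * P.b) / -Real.log P.c := by
      rw [le_div_iff₀ (by linarith)]; linarith
    linarith
  · apply le_of_eq
    rw [Real.rpow_def_of_pos hc0]
    have : Real.log P.c * (1 + Real.log (N * P.b) / -Real.log P.c) = Real.log P.c - Real.log (N * P.b) := by
      have := hlc.ne; field_simp; ring
    rw [this, Real.exp_sub, Real.exp_log hc0, Real.exp_log (by positivity)]
    field_simp
  · intro n i
    exact box_diam (by simp) (by simp)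
  · intro n p hp
    obtain ⟨w, hw⟩ := mem_iUnion.1 (mem_iInter.1 hp n)
    obtain ⟨h1, h2, h3⟩ := hw
    have hcn : 0 < P.c ^ n := pow_pos hc0 n
    set y0 := P.toFam.tw n w 0 - P.b ^ n * (1 + P.R) with hy0
    have hnn : 0 ≤ (p.2 - y0) / P.c ^ n := div_nonneg (by linarith) hcn.le
    have hk : ⌊(p.2 - y0) / P.c ^ n⌋₊ < ⌊2 * (1 + P.R) * P.b ^ n / P.c ^ n⌋₊ + 1 := by
      rw [Nat.lt_succ_iff]
      apply Nat.floor_mono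
      gcongr
      linarith
    rw [mem_iUnion]
    refine ⟨(w, ⟨_, hk⟩), h1, ?_⟩
    have f1 := Nat.floor_le hnn
    have f2 := Nat.lt_floor_add_one ((p.2 - y0) / P.c ^ n)
    rw [le_div_iff₀ hcn] at f1
    rw [div_lt_iff₀ hcn] at f2
    simp only [mem_Icc]
    constructor <;> linarith
  · intro n
    simp only [Fintype.card_prod, Fintype.card_fun, Fintype.card_fin]
    push_cast
    have f1 := Nat.floor_le (by positivity : 0 ≤ 2 * (1 + P.R) * P.b ^ n / P.c ^ n)
    have h1 : 1 ≤ P.b ^ n / P.c ^ n := by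
      rw [one_le_div (by positivity)]
      exact pow_le_pow_left₀ hc0.le P.hcb.le n
    have e1 : (2 * (1 + P.R) + 1) * (N * P.b / P.c) ^ n =
        N ^ n * (2 * (1 + P.R) * P.b ^ n / P.c ^ n + P.b ^ n / P.c ^ n) := by
      rw [div_pow, mul_pow]; ring
    rw [e1]
    apply mul_le_mul_of_nonneg_left _ (by positivity)
    linarith

end Pair
end
end

section
open MeasureTheory Filter Set Topology
open scoped ENNReal NNReal
noncomputable section

section PiFacts
variable {N : ℕ} {c b : ℝ} {u v d : Fin N → ℝ} {Pi : (ℕ → Fin N) → ℝ × ℝ}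

theorem Smap_cont (i : Fin N) : Continuous (Smap c b u v d i) := by
  unfold Smap; fun_prop

theorem Pi_consS (hPi : ∀ i, Tendsto (fun n => Sword c b u v d (prefixWord i n) 0) atTop (nhds (Pi i)))
    (i : Fin N) (x : ℕ → Fin N) : Pi (consS i x) = Smap c b u v d i (Pi x) := by
  have h1 := (tendsto_add_atTop_iff_nat 1).2 (hPi (consS i x))
  have h2 : Tendsto (fun n => Smap c b u v d i (Sword c b u v d (prefixWord x n) 0)) atTop
      (nhds (Smap c b u v d i (Pi x))) := ((Smap_cont i).tendsto _).comp (hPi x)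
  refine tendsto_nhds_unique h1 ?_
  convert h2 using 2 with n
  have : prefixWord (consS i x) (n + 1) = i :: prefixWord x n := by
    unfold prefixWord
    rw [List.ofFn_succ]
    rfl
  rw [this]; rfl

theorem Sword_mem (hmaps : ∀ i, Smap c b u v d i '' unitSq ⊆ unitSq) (w : List (Fin N)) :
    Sword c b u v d w 0 ∈ unitSq := by
  induction w with
  | nil =>
    change (0 : ℝ × ℝ) ∈ (Set.Icc 0 1 ×ˢ Set.Icc 0 1 : Set (ℝ × ℝ))
    refine ⟨⟨?_, ?_⟩, ?_, ?_⟩ <;> simp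
  | cons i w ih => exact hmaps i ⟨_, ih, rfl⟩

theorem Pi_mem (hmaps : ∀ i, Smap c b u v d i '' unitSq ⊆ unitSq)
    (hPi : ∀ i, Tendsto (fun n => Sword c b u v d (prefixWord i n) 0) atTop (nhds (Pi i)))
    (x : ℕ → Fin N) : Pi x ∈ unitSq := by
  have hcl : IsClosed unitSq := isClosed_Icc.prod isClosed_Icc
  exact hcl.mem_of_tendsto (hPi x) (Eventually.of_forall fun n => Sword_mem hmaps _)

theorem Pi_meas (hPi : ∀ i, Tendsto (fun n => Sword c b u v d (prefixWord i n) 0) atTop (nhds (Pi i))) :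
    Measurable Pi := by
  refine measurable_of_tendsto_metrizable (f := fun n x => Sword c b u v d (prefixWord x n) 0) (fun n => ?_)
    (tendsto_pi_nhds.2 hPi)
  have h1 : Measurable (fun w : Fin n → Fin N => Sword c b u v d (List.ofFn w) 0) :=
    measurable_of_countable _
  exact h1.comp (measurable_pi_lambda _ fun k => measurable_pi_apply _)

end PiFacts

theorem Pair.lower {N : ℕ} (P : Pair N) (hcN : P.c < 1 / N)
    (hC3 : HochmanESC N (fun _ => P.c / P.b) (fun i => -(P.d i / P.b)))
    (hC4 : HochmanESC N (fun _ => P.c) P.u) {ν : Measure (ℝ × ℝ)} (hν : ν = P.μ.map (fun x => (P.X x, P.Y x)))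
    {A : Set (ℝ × ℝ)} (hA : ν A = 1) :
    ENNReal.ofReal (min (Real.log N / (-Real.log P.b)) (1 + Real.log ((N : ℝ) * P.b) / (-Real.log P.c)))
      ≤ dimH A := by
  have hp := P.hμ.1
  have mP : Measurable (fun x => (P.X x, P.Y x)) := P.mX.prodMk P.mY
  have hpν : IsProbabilityMeasure ν := by
    rw [hν]; exact Measure.isProbabilityMeasure_map mP.aemeasurable
  set D := min (Real.log N / (-Real.log P.b)) (1 + Real.log ((N : ℝ) * P.b) / (-Real.log P.c)) with hD
  have hb0 : 0 < P.b := P.hc.trans P.hcb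
  have hN0 : (0:ℝ) < N := by have := P.hN; exact_mod_cast (by omega : 0 < N)
  have hχ1 : 0 < -Real.log P.b := P.toFam.chi_pos
  have hχ2 : 0 < -Real.log P.c := P.horiz.toFam.chi_pos
  have hχ : -Real.log P.b < -Real.log P.c := P.chi_lt
  have hDE : D * -Real.log P.c ≤ (-Real.log P.c - -Real.log P.b) / (-Real.log P.b) *
      min (-Real.log P.b) (Real.log N) + Real.log N := by
    rcases le_total (-Real.log P.b) (Real.log N) with h | h
    · rw [min_eq_left h]
      refine (mul_le_mul_of_nonneg_right (min_le_right _ _) hχ2.le).trans (le_of_eq ?_)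
      rw [Real.log_mul hN0.ne' hb0.ne', div_mul_cancel₀ _ hχ1.ne', add_mul, div_mul_cancel₀ _ hχ2.ne']
      ring
    · rw [min_eq_right h]
      refine (mul_le_mul_of_nonneg_right (min_le_left _ _) hχ2.le).trans (le_of_eq ?_)
      set a := -Real.log P.b
      have := hχ1.ne'
      field_simp
      ring
  by_contra hcon
  rw [not_le] at hcon
  have hfin : dimH A ≠ ⊤ := (hcon.trans ENNReal.ofReal_lt_top).ne
  set x := (dimH A).toReal with hx
  have hx0 : 0 ≤ x := ENNReal.toReal_nonneg
  have hxe : dimH A = ENNReal.ofReal x := (ENNReal.ofReal_toReal hfin).symm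
  have hxD : x < D := by
    rw [hxe] at hcon
    exact (ENNReal.ofReal_lt_ofReal_iff_of_nonneg hx0).1 hcon
  set D' := (x + D) / 2 with hD'
  have hD'0 : 0 < D' := by rw [hD']; linarith
  have hD'D : D' < D := by rw [hD']; linarith
  obtain ⟨C, hC, θ, hθ, hθ1, hdec⟩ := P.bad_decay hcN
    (Fam.NA_of _ (Fam.exists_ne_of_ESC P.hN hC4)) (Fam.Sep_z _ hC3)
    (Fam.NA_triv _ P.horiz_K) (Fam.Sep_t _ P.horiz_K rfl hC4) (D := D')
    (lt_of_lt_of_le (mul_lt_mul_of_pos_right hD'D P.horiz.toFam.chi_pos) hDE)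
  have hball : ∀ n : ℕ, ν.real {p | P.c ^ (n * D') < ν.real (Metric.closedBall p (P.c ^ n / 8))} ≤ C * θ ^ n := by
    intro n
    refine le_trans (le_of_eq ?_) (hdec n)
    have e : ∀ y, ν.real (Metric.closedBall (P.X y, P.Y y) (P.c ^ n / 8)) =
        P.μ.real {z | |P.X z - P.X y| ≤ P.c ^ n / 8 ∧ |P.Y z - P.Y y| ≤ P.c ^ n / 8} := by
      intro y
      rw [hν, map_measureReal_apply mP Metric.isClosed_closedBall.measurableSet]
      congr 1
      ext z
      simp [Prod.dist_eq, Real.dist_eq]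
    have hm := ball_meas ν (P.c ^ (n * D')) (P.c ^ n / 8)
    have : ν.real {p | P.c ^ (n * D') < ν.real (Metric.closedBall p (P.c ^ n / 8))} =
        P.μ.real ((fun x => (P.X x, P.Y x)) ⁻¹' {p | P.c ^ (n * D') < ν.real (Metric.closedBall p (P.c ^ n / 8))}) := by
      conv_lhs => rw [measureReal_def]
      rw [measureReal_def, ← Measure.map_apply mP hm, ← hν]
    rw [this]
    congr 1
    ext y
    simp only [mem_preimage, mem_ofPred_eq, e, Pair.bad]
  have := mass_dist P.hc (P.hcb.trans P.hb) hD'0 hC hθ hθ1 hball hA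
  rw [hxe, ENNReal.ofReal_le_ofReal_iff hx0] at this
  linarith

theorem Pair.final {N : ℕ} (P : Pair N) (hcN : P.c < 1 / N)
    (hC3 : HochmanESC N (fun _ => P.c / P.b) (fun i => -(P.d i / P.b)))
    (hC4 : HochmanESC N (fun _ => P.c) P.u) {ν : Measure (ℝ × ℝ)} (hν : ν = P.μ.map (fun x => (P.X x, P.Y x))) :
    dimH (range (fun x => (P.X x, P.Y x))) =
      ENNReal.ofReal (min (Real.log N / (-Real.log P.b)) (1 + Real.log ((N : ℝ) * P.b) / (-Real.log P.c))) ∧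
    measureDimH ν =
      ENNReal.ofReal (min (Real.log N / (-Real.log P.b)) (1 + Real.log ((N : ℝ) * P.b) / (-Real.log P.c))) := by
  have hp := P.hμ.1
  have mP : Measurable (fun x => (P.X x, P.Y x)) := P.mX.prodMk P.mY
  have hpν : IsProbabilityMeasure ν := by
    rw [hν]; exact Measure.isProbabilityMeasure_map mP.aemeasurable
  have hup : dimH P.att ≤ ENNReal.ofReal (min (Real.log N / (-Real.log P.b))
      (1 + Real.log ((N : ℝ) * P.b) / (-Real.log P.c))) := by
    rcases min_choice (Real.log N / (-Real.log P.b)) (1 + Real.log ((N : ℝ) * P.b) / (-Real.log P.c)) with h | h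
    · rw [h]; exact P.att_dim1
    · rw [h]; exact P.att_dim2
  constructor
  · apply le_antisymm
    · refine (dimH_mono ?_).trans hup
      rintro _ ⟨x, rfl⟩
      exact P.mem_att x
    · apply P.lower hcN hC3 hC4 hν
      rw [← measure_toMeasurable, hν, Measure.map_apply mP (measurableSet_toMeasurable _ _)]
      have : (fun x => (P.X x, P.Y x)) ⁻¹' toMeasurable (P.μ.map fun x => (P.X x, P.Y x))
          (range fun x => (P.X x, P.Y x)) = univ := by
        ext x
        simp only [mem_preimage, mem_univ, iff_true]
        exact subset_toMeasurable _ _ ⟨x, rfl⟩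
      rw [this, measure_univ]
  · apply le_antisymm
    · refine le_trans ?_ hup
      unfold measureDimH
      refine iInf₂_le P.att ?_
      rw [hν, Measure.map_apply mP P.att_closed.measurableSet.compl]
      have : (fun x => (P.X x, P.Y x)) ⁻¹' P.attᶜ = ∅ := by
        ext x
        simp only [mem_preimage, mem_compl_iff, mem_empty_iff_false, iff_false, not_not]
        exact P.mem_att x
      rw [this, measure_empty]
    · unfold measureDimH
      refine le_iInf₂ fun A hA => P.lower hcN hC3 hC4 hν ?_
      apply le_antisymm prob_le_one
      have := measure_union_le (μ := ν) A Aᶜ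
      rw [union_compl_self, hA, add_zero, measure_univ] at this
      exact this

theorem main13 (N : ℕ) (hN : 2 ≤ N) (b c : ℝ)
    (hb1 : b < 1) (hc0 : 0 < c)
    (u v d : Fin N → ℝ)
    (hmaps : ∀ i, Smap c b u v d i '' unitSq ⊆ unitSq)
    (Pi : (ℕ → Fin N) → ℝ × ℝ)
    (hPi : ∀ i, Tendsto (fun n => Sword c b u v d (prefixWord i n) 0) atTop (nhds (Pi i)))
    (μ : Measure (ℕ → Fin N)) (hμ : IsUniformBernoulli N μ)
    (ν : Measure (ℝ × ℝ)) (hν : ν = μ.map Pi)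
    (hC1 : c < 1 / (N : ℝ)) (hC2 : c < b)
    (hC3 : HochmanESC N (fun _ => c / b) (fun i => -(d i / b)))
    (hC4 : HochmanESC N (fun _ => c) u) :
    dimH (Set.range Pi) =
      ENNReal.ofReal (min (Real.log N / (-Real.log b))
        (1 + Real.log ((N : ℝ) * b) / (-Real.log c))) ∧
    measureDimH ν =
      ENNReal.ofReal (min (Real.log N / (-Real.log b))
        (1 + Real.log ((N : ℝ) * b) / (-Real.log c))) := by
  have hmem := Pi_mem hmaps hPi
  let P : Pair N :=
    { μ := μ, hμ := hμ, b := b, c := c, u := u, v := v, d := d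
      X := fun x => (Pi x).1
      Y := fun x => (Pi x).2
      hN := hN, hc := hc0, hcb := hC2, hb := hb1
      mX := (Pi_meas hPi).fst
      mY := (Pi_meas hPi).snd
      hX := fun x => (hmem x).1
      hY := fun x => (hmem x).2
      hXs := fun i x => by rw [Pi_consS hPi]; rfl
      hYs := fun i x => by rw [Pi_consS hPi]; rfl }
  exact P.final hC1 hC3 hC4 (ν := ν) hν

end
end

/-- under Assumption C,
`dim_H Λ = dim_H ν = min(log N/(-log b), 1 + log(Nb)/(-log c))`. -/
theorem statement13 (N : ℕ) (hN : 2 ≤ N) (b c : ℝ)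
    (hb0 : 0 < b) (hb1 : b < 1) (hc0 : 0 < c) (hc1 : c < 1)
    (u v d : Fin N → ℝ)
    (hmaps : ∀ i, Smap c b u v d i '' unitSq ⊆ unitSq)
    (Pi : (ℕ → Fin N) → ℝ × ℝ)
    (hPi : ∀ i, Tendsto (fun n => Sword c b u v d (prefixWord i n) 0) atTop (nhds (Pi i)))
    (μ : Measure (ℕ → Fin N)) (hμ : IsUniformBernoulli N μ)
    (ν : Measure (ℝ × ℝ)) (hν : ν = μ.map Pi)
    (hC1 : c < 1 / (N : ℝ)) (hC2 : c < b)
    (hC3 : HochmanESC N (fun _ => c / b) (fun i => -(d i / b)))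
    (hC4 : HochmanESC N (fun _ => c) u)
    (hC5 : min 1 (min (Real.log N / (-Real.log b))
        (2 * (1 - Real.log N / (-Real.log c)))) ≤ Real.log N / Real.log (b / c)) :
    dimH (Set.range Pi) =
      ENNReal.ofReal (min (Real.log N / (-Real.log b))
        (1 + Real.log ((N : ℝ) * b) / (-Real.log c))) ∧
    measureDimH ν =
      ENNReal.ofReal (min (Real.log N / (-Real.log b))
        (1 + Real.log ((N : ℝ) * b) / (-Real.log c))) := by
  exact main13 N hN b c hb1 hc0 u v d hmaps Pi hPi μ hμ ν hν hC1 hC2 hC3 hC4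

end
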